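/- Let X be a finitely irreducible countable Markov shift, φ: X → ℝ a measurable function and μ_φ a Gibbs state for the potential φ. For each n ≥ 1 let ξ_n be the distribution on M of the M-valued random variable x ↦ δ_x^n on the probability space (X, μ_φ). Then {ξ_n} is exponentially tight and satisfies the Large Deviation Principle with the convex good rate function I(μ) = -inf_{G ∋ μ} sup_G F, the infimum over all open subsets G of M containing μ. -/

import Mathlib

open MeasureTheory Filter Topology Set
open scoped ENNReal NNReal

namespace CMS

/-! ### Generic dynamical notions -/

variable {X : Type*}

/-- Birkhoff sum `S_n φ`. -/
noncomputable def birkhoff (T : X → X) (φ : X → ℝ) (n : ℕ) (x : X) : ℝ :=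
  ∑ i ∈ Finset.range n, φ (T^[i] x)

/-- A measure is invariant under `T`. -/
def Invariant [MeasurableSpace X] (T : X → X) (μ : Measure X) : Prop :=
  Measure.map T μ = μ

/-- `∫ φ dμ > -∞`, i.e. the negative part of `φ` is integrable. -/
def IntegralGtBot [MeasurableSpace X] (φ : X → ℝ) (μ : Measure X) : Prop :=
  (∫⁻ x, ENNReal.ofReal (-φ x) ∂μ) ≠ ⊤

/-- The integral of `φ`, with values in `EReal` (defined whenever one of the parts is finite). -/
noncomputable def eintegral [MeasurableSpace X] (φ : X → ℝ) (μ : Measure X) : EReal :=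
  ((∫⁻ x, ENNReal.ofReal (φ x) ∂μ : ℝ≥0∞) : EReal) -
    ((∫⁻ x, ENNReal.ofReal (-φ x) ∂μ : ℝ≥0∞) : EReal)

/-- Entropy of the countable partition induced by a map `g` with countable range. -/
noncomputable def partitionEntropy [MeasurableSpace X] {α : Type*} (μ : Measure X) (g : X → α) :
    ℝ≥0∞ :=
  ∑' a : α, ENNReal.ofReal (-((μ (g ⁻¹' {a})).toReal * Real.log ((μ (g ⁻¹' {a})).toReal)))

/-- Kolmogorov–Sinaĭ entropy of `T` with respect to `μ`: the supremum over finite measurable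
partitions (coded by maps `X → ℕ` with finite range) of the asymptotic entropy of iterated
joins of the partition. -/
noncomputable def entropy [MeasurableSpace X] (T : X → X) (μ : Measure X) : ℝ≥0∞ :=
  ⨆ (p : X → ℕ) (_ : Measurable p ∧ (Set.range p).Finite),
    atTop.liminf fun n : ℕ =>
      ENNReal.ofReal ((n : ℝ)⁻¹) * partitionEntropy μ (fun x => fun i : Fin n => p (T^[i] x))

/-- The empirical measure `δ_x^n = (1/n) ∑_{i<n} δ_{T^i x}` (with junk convention `n = 0 ↦ n = 1`,
irrelevant since only `n ≥ 1` is ever used). -/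
noncomputable def empirical [MeasurableSpace X] (T : X → X) (x : X) (n : ℕ) :
    ProbabilityMeasure X :=
  ⟨((max n 1 : ℕ) : ℝ≥0∞)⁻¹ • ∑ i ∈ Finset.range (max n 1), Measure.dirac (T^[i] x), by
    refine ⟨?_⟩
    have h1 : (∑ i ∈ Finset.range (max n 1), Measure.dirac (T^[i] x)) Set.univ
        = ((max n 1 : ℕ) : ℝ≥0∞) := by
      rw [Measure.finset_sum_apply]
      simp
    rw [Measure.smul_apply, h1, smul_eq_mul, ENNReal.inv_mul_cancel] <;> simp⟩

noncomputable instance [MeasurableSpace X] [TopologicalSpace X] [OpensMeasurableSpace X] :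
    MeasurableSpace (ProbabilityMeasure X) := borel _

/-- Sets of periodic points. -/
def perSet (T : X → X) (n : ℕ) : Set X := {x | T^[n] x = x}

/-- Sets of iterated preimages of a point. -/
def preimSet (T : X → X) (n : ℕ) (y : X) : Set X := {x | T^[n] x = y}

/-- The partition function `Z_n(φ, C)` over a subset `C`. -/
noncomputable def Zfn [MeasurableSpace X] (T : X → X) (φ : X → ℝ) (n : ℕ) (C : Set X) : ℝ≥0∞ :=
  ∑' x : C, ENNReal.ofReal (Real.exp (birkhoff T φ n x))

/-- The distribution of the empirical measures under `μ`. -/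
noncomputable def empDistr [MeasurableSpace X] [TopologicalSpace X] [OpensMeasurableSpace X]
    (T : X → X) (μ : Measure X) (n : ℕ) : Measure (ProbabilityMeasure X) :=
  Measure.map (fun x => empirical T x n) μ

/-- The distribution `Z_n(φ,C)⁻¹ ∑_{x ∈ C} e^{S_nφ(x)} δ_{δ_x^n}` on the space of probability
measures, for a countable set `C` (of weighted periodic points or iterated preimages). -/
noncomputable def weightedDistr [MeasurableSpace X] [TopologicalSpace X] [OpensMeasurableSpace X]
    (T : X → X) (φ : X → ℝ) (n : ℕ) (C : Set X) : Measure (ProbabilityMeasure X) :=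
  (Zfn T φ n C)⁻¹ •
    Measure.sum (fun x : C =>
      ENNReal.ofReal (Real.exp (birkhoff T φ n x)) • Measure.dirac (empirical T (x : X) n))

/-! ### Large deviations notions -/

variable {Y : Type*}

/-- The large deviation principle for a sequence of (sub)probability measures with rate
function `J`. -/
def HasLDP [TopologicalSpace Y] [MeasurableSpace Y] (μ : ℕ → Measure Y) (J : Y → EReal) : Prop :=
  (∀ G : Set Y, IsOpen G →
      -(⨅ y ∈ G, J y) ≤
        atTop.liminf fun n : ℕ => (((n : ℝ)⁻¹ : ℝ) : EReal) * ENNReal.log (μ n G)) ∧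
  (∀ K : Set Y, IsClosed K →
      atTop.limsup (fun n : ℕ => (((n : ℝ)⁻¹ : ℝ) : EReal) * ENNReal.log (μ n K)) ≤
        -(⨅ y ∈ K, J y))

/-- Exponential tightness of a sequence of measures. -/
def ExpTight [TopologicalSpace Y] [MeasurableSpace Y] (μ : ℕ → Measure Y) : Prop :=
  ∀ L : ℝ, 0 < L → ∃ K : Set Y, IsCompact K ∧
    atTop.limsup (fun n : ℕ => (((n : ℝ)⁻¹ : ℝ) : EReal) * ENNReal.log (μ n Kᶜ)) ≤ ((-L : ℝ) : EReal)

/-- A good rate function: lower semicontinuous with compact sublevel sets. -/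
def GoodRate [TopologicalSpace Y] (J : Y → EReal) : Prop :=
  LowerSemicontinuous J ∧ ∀ α : ℝ, 0 ≤ α → IsCompact {y | J y ≤ (α : EReal)}

/-- The rate function `I(μ) = - inf_{G ∋ μ} sup_G F`. -/
noncomputable def rateOf [TopologicalSpace Y] (F : Y → EReal) (μ : Y) : EReal :=
  -(⨅ (G : Set Y) (_ : IsOpen G ∧ μ ∈ G), ⨆ ν ∈ G, F ν)

/-- The convex combination `t μ + (1-t) ν` of two probability measures. -/
noncomputable def mix [MeasurableSpace X] (t : ℝ) (h0 : 0 ≤ t) (h1 : t ≤ 1)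
    (μ ν : ProbabilityMeasure X) : ProbabilityMeasure X :=
  ⟨ENNReal.ofReal t • (μ : Measure X) + ENNReal.ofReal (1 - t) • (ν : Measure X), by
    refine ⟨?_⟩
    simp only [Measure.add_apply, Measure.smul_apply, smul_eq_mul, measure_univ, mul_one]
    rw [← ENNReal.ofReal_add h0 (by linarith)]
    norm_num⟩

/-- Convexity of a rate function on probability measures. -/
def ConvexRate [MeasurableSpace X] (J : ProbabilityMeasure X → EReal) : Prop :=
  ∀ μ ν : ProbabilityMeasure X, ∀ t : ℝ, ∀ (h0 : 0 ≤ t) (h1 : t ≤ 1),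
    J (mix t h0 h1 μ ν) ≤ ((t : ℝ) : EReal) * J μ + ((1 - t : ℝ) : EReal) * J ν

-- The free energy functional `F`.
open Classical in
noncomputable def freeEnergy [MeasurableSpace X] (T : X → X) (φ : X → ℝ) (P : ℝ)
    (ν : ProbabilityMeasure X) : EReal :=
  if Invariant T (ν : Measure X) ∧ IntegralGtBot φ (ν : Measure X)
  then ((entropy T (ν : Measure X) : ℝ≥0∞) : EReal) + eintegral φ (ν : Measure X) - ((P : ℝ) : EReal)
  else ⊥

/-! ### Countable Markov shifts -/

variable {S : Type*}

/-- The topological Markov shift with alphabet `S` and transition relation `A`. -/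
def Space (A : S → S → Prop) : Type _ := {x : ℕ → S // ∀ i, A (x i) (x (i + 1))}

variable (A : S → S → Prop)

instance [TopologicalSpace S] : TopologicalSpace (Space A) :=
  inferInstanceAs (TopologicalSpace {x : ℕ → S // ∀ i, A (x i) (x (i + 1))})

noncomputable instance [TopologicalSpace S] : MeasurableSpace (Space A) := borel _

instance [TopologicalSpace S] : BorelSpace (Space A) := ⟨rfl⟩

/-- The left shift. -/
def shift : Space A → Space A := fun x => ⟨fun i => x.1 (i + 1), fun i => x.2 (i + 1)⟩

/-- Admissible words. -/
def Admissible (w : List S) : Prop := w ≠ [] ∧ w.Chain' A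

/-- The cylinder set of a word. -/
def cylinder (w : List S) : Set (Space A) := {x | ∀ i : Fin w.length, x.1 i = w.get i}

variable {A}

/-- The initial word of length `n` of a point. -/
def word (x : Space A) (n : ℕ) : List S := List.ofFn (fun i : Fin n => x.1 i)

variable (A)

/-- `μ` is a Gibbs state for the potential `φ` with constants `c₀` and `P`. -/
def IsGibbsWith [TopologicalSpace S] (φ : Space A → ℝ) (μ : Measure (Space A)) (c₀ P : ℝ) :
    Prop :=
  ∀ n : ℕ, 1 ≤ n → ∀ x : Space A,
    c₀⁻¹ * Real.exp (-(P * n) + birkhoff (shift A) φ n x)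
        ≤ (μ (cylinder A (word x n))).toReal ∧
      (μ (cylinder A (word x n))).toReal
        ≤ c₀ * Real.exp (-(P * n) + birkhoff (shift A) φ n x)

/-- `μ` is a Gibbs state for `φ`. -/
def IsGibbs [TopologicalSpace S] (φ : Space A → ℝ) (μ : Measure (Space A)) : Prop :=
  ∃ c₀ P : ℝ, 1 ≤ c₀ ∧ IsGibbsWith A φ μ c₀ P

/-- The transition matrix has no row or column identically zero. -/
def NoZeroRowCol : Prop := (∀ a : S, ∃ b, A a b) ∧ ∀ b : S, ∃ a, A a b

/-- Finite irreducibility. -/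
def FinitelyIrreducible : Prop :=
  ∃ Λ : Finset (List S), ∀ v w : List S, Admissible A v → Admissible A w →
    ∃ l ∈ Λ, Admissible A (v ++ l ++ w)

/-- Finite primitiveness. -/
def FinitelyPrimitive : Prop :=
  ∃ Λ : Finset (List S), (∃ N : ℕ, ∀ l ∈ Λ, l.length = N) ∧
    ∀ v w : List S, Admissible A v → Admissible A w →
      ∃ l ∈ Λ, Admissible A (v ++ l ++ w)

/-- Topological transitivity. -/
def TopTransitive : Prop :=
  ∀ a b : S, ∃ n : ℕ, 1 ≤ n ∧
    (cylinder A [a] ∩ (shift A)^[n] ⁻¹' (cylinder A [b])).Nonempty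

/-- Varadhan's functional `Q(ψ) = sup_μ (∫ψ dμ - I(μ))`. -/
noncomputable def varQ {X : Type*} [MeasurableSpace X] (I : ProbabilityMeasure X → EReal)
    (ψ : X → ℝ) : EReal :=
  ⨆ μ : ProbabilityMeasure X, (((∫ x, ψ x ∂(μ : Measure X)) : ℝ) : EReal) - I μ

/-- `φ` is uniformly continuous for the standard metric of the shift space. -/
def UnifCont (φ : Space A → ℝ) : Prop :=
  ∀ ε : ℝ, 0 < ε → ∃ N : ℕ, ∀ x y : Space A, (∀ i < N, x.1 i = y.1 i) → |φ x - φ y| ≤ ε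

/-- `φ` is bounded. -/
def Bdd (φ : Space A → ℝ) : Prop := ∃ C : ℝ, ∀ x : Space A, |φ x| ≤ C

end CMS

namespace CMS

/-! ### Entropy of countable partitions -/

section PartitionEntropy

variable {X : Type*} [MeasurableSpace X] {α γ : Type*}
  [MeasurableSpace α] [Countable α] [MeasurableSingletonClass α]
  [MeasurableSpace γ] [Countable γ] [MeasurableSingletonClass γ]

lemma lintegral_comp_countable (μ : Measure X) {f : X → α} (hf : Measurable f) (h : α → ℝ≥0∞) :
    ∫⁻ x, h (f x) ∂μ = ∑' a, h a * μ (f ⁻¹' {a}) := by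
  rw [← lintegral_map (f := h) (measurable_of_countable h) hf, lintegral_countable']
  refine tsum_congr fun a => ?_
  rw [Measure.map_apply hf (measurableSet_singleton a)]

lemma partitionEntropy_eq_lintegral (μ : Measure X) [IsProbabilityMeasure μ] {f : X → α}
    (hf : Measurable f) :
    partitionEntropy μ f = ∫⁻ x, ENNReal.ofReal (-Real.log (μ.real (f ⁻¹' {f x}))) ∂μ := by
  rw [lintegral_comp_countable μ hf
    (fun a => ENNReal.ofReal (-Real.log (μ.real (f ⁻¹' {a}))))]
  refine tsum_congr fun a => ?_
  rw [show -((μ (f ⁻¹' {a})).toReal * Real.log ((μ (f ⁻¹' {a})).toReal)) =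
    -Real.log ((μ (f ⁻¹' {a})).toReal) * (μ (f ⁻¹' {a})).toReal by ring,
    ENNReal.ofReal_mul' ENNReal.toReal_nonneg, ENNReal.ofReal_toReal (measure_ne_top _ _)]
  rfl

lemma ae_fiber_pos (μ : Measure X) (f : X → α) :
    ∀ᵐ x ∂μ, μ (f ⁻¹' {f x}) ≠ 0 := by
  have h : {x | ¬ μ (f ⁻¹' {f x}) ≠ 0} = ⋃ a ∈ {a | μ (f ⁻¹' {a}) = 0}, f ⁻¹' {a} := by
    ext x; simp
  rw [ae_iff, h, measure_biUnion_null_iff (Set.to_countable _)]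
  exact fun a ha => ha

lemma ae_fiber_real_pos (μ : Measure X) [IsFiniteMeasure μ] (f : X → α) :
    ∀ᵐ x ∂μ, 0 < μ.real (f ⁻¹' {f x}) := by
  filter_upwards [ae_fiber_pos μ f] with x hx
  exact ENNReal.toReal_pos hx (measure_ne_top _ _)

lemma tsum_fiber (μ : Measure X) [IsProbabilityMeasure μ] {f : X → α} (hf : Measurable f) :
    ∑' a, μ (f ⁻¹' {a}) = 1 := by
  have := lintegral_comp_countable μ hf (fun _ => 1)
  simpa using this.symm

/-- The Gibbs inequality. -/
lemma partitionEntropy_le_cross (μ : Measure X) [IsProbabilityMeasure μ] {f : X → α}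
    (hf : Measurable f) (q : α → ℝ) (hq1 : ∑' a, ENNReal.ofReal (q a) ≤ 1)
    (hpos : ∀ᵐ x ∂μ, 0 < q (f x)) :
    partitionEntropy μ f ≤ ∫⁻ x, ENNReal.ofReal (-Real.log (q (f x))) ∂μ := by
  have hpos' : ∀ a, μ (f ⁻¹' {a}) ≠ 0 → 0 < q a := by
    intro a ha
    by_contra hqa
    apply ha
    rw [ae_iff] at hpos
    refine measure_mono_null ?_ hpos
    rintro x rfl
    exact hqa
  rw [lintegral_comp_countable μ hf (fun a => ENNReal.ofReal (-Real.log (q a)))]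
  have key : ∀ a, μ (f ⁻¹' {a}) + ENNReal.ofReal
      (-((μ (f ⁻¹' {a})).toReal * Real.log ((μ (f ⁻¹' {a})).toReal)))
      ≤ ENNReal.ofReal (-Real.log (q a)) * μ (f ⁻¹' {a}) + ENNReal.ofReal (q a) := by
    intro a
    by_cases ha : μ (f ⁻¹' {a}) = 0
    · simp [ha]
    have hq := hpos' a ha
    set t := (μ (f ⁻¹' {a})).toReal with ht
    have htpos : 0 < t := ENNReal.toReal_pos ha (measure_ne_top _ _)
    have ht1 : t ≤ 1 := by
      rw [ht]; exact ENNReal.toReal_le_of_le_ofReal zero_le_one (by simpa using prob_le_one)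
    have hμ : μ (f ⁻¹' {a}) = ENNReal.ofReal t := by
      rw [ht, ENNReal.ofReal_toReal (measure_ne_top _ _)]
    have hq1' : q a ≤ 1 := by
      have := (ENNReal.le_tsum a).trans hq1
      simpa using this
    have hl : 0 ≤ -Real.log (q a) := by
      have := Real.log_nonpos hq.le hq1'; linarith
    have hl' : 0 ≤ -(t * Real.log t) := by
      have := Real.mul_log_nonpos htpos.le ht1; linarith
    rw [hμ, ← ENNReal.ofReal_add htpos.le hl', ← ENNReal.ofReal_mul hl,
      ← ENNReal.ofReal_add (by positivity) hq.le]
    apply ENNReal.ofReal_le_ofReal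
    have h1 := Real.log_le_sub_one_of_pos (div_pos hq htpos)
    rw [Real.log_div hq.ne' htpos.ne'] at h1
    have h2 : t * (Real.log (q a) - Real.log t) ≤ t * (q a / t - 1) :=
      mul_le_mul_of_nonneg_left h1 htpos.le
    have h3 : t * (q a / t - 1) = q a - t := by field_simp
    nlinarith
  have h1 := ENNReal.tsum_le_tsum key
  rw [ENNReal.tsum_add, ENNReal.tsum_add, tsum_fiber μ hf] at h1
  have h2 := h1.trans (add_le_add_right hq1 _)
  rw [add_comm] at h2
  exact (ENNReal.add_le_add_iff_right ENNReal.one_ne_top).1 h2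

lemma partitionEntropy_mono (μ : Measure X) [IsProbabilityMeasure μ] {f : X → α} {h : X → γ}
    (hf : Measurable f) (hh : Measurable h) (hfh : ∀ x y, h x = h y → f x = f y) :
    partitionEntropy μ f ≤ partitionEntropy μ h := by
  rw [partitionEntropy_eq_lintegral μ hf, partitionEntropy_eq_lintegral μ hh]
  refine lintegral_mono_ae ?_
  filter_upwards [ae_fiber_real_pos μ h] with x hx
  apply ENNReal.ofReal_le_ofReal
  have h1 : μ.real (h ⁻¹' {h x}) ≤ μ.real (f ⁻¹' {f x}) :=
    measureReal_mono (fun y hy => hfh _ _ hy)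
  have := Real.log_le_log hx h1
  linarith

/-- Entropy of a join, bounded by a conditional cross entropy. -/
lemma partitionEntropy_prod_le (μ : Measure X) [IsProbabilityMeasure μ] {f : X → α} {g : X → γ}
    (hf : Measurable f) (hg : Measurable g) (κ : γ → α → ℝ)
    (hκ1 : ∀ c, ∑' a, ENNReal.ofReal (κ c a) ≤ 1) (hpos : ∀ᵐ x ∂μ, 0 < κ (g x) (f x)) :
    partitionEntropy μ (fun x => (g x, f x)) ≤ partitionEntropy μ g +
      ∫⁻ x, ENNReal.ofReal (-Real.log (κ (g x) (f x))) ∂μ := by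
  have hκle : ∀ c a, κ c a ≤ 1 := fun c a => by
    have := (ENNReal.le_tsum a).trans (hκ1 c)
    simpa using this
  refine (partitionEntropy_le_cross μ (hg.prodMk hf)
    (fun z => μ.real (g ⁻¹' {z.1}) * κ z.1 z.2) ?_ ?_).trans ?_
  · rw [ENNReal.tsum_prod']
    calc ∑' c, ∑' a, ENNReal.ofReal (μ.real (g ⁻¹' {c}) * κ c a)
        = ∑' c, μ (g ⁻¹' {c}) * ∑' a, ENNReal.ofReal (κ c a) := by
          refine tsum_congr fun c => ?_
          rw [← ENNReal.tsum_mul_left]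
          refine tsum_congr fun a => ?_
          rw [ENNReal.ofReal_mul measureReal_nonneg, ofReal_measureReal]
      _ ≤ ∑' c, μ (g ⁻¹' {c}) * 1 := ENNReal.tsum_le_tsum fun c => by gcongr; exact hκ1 c
      _ = 1 := by simpa using tsum_fiber μ hg
      _ ≤ 1 := le_rfl
  · filter_upwards [hpos, ae_fiber_real_pos μ g] with x h1 h2
    exact mul_pos h2 h1
  · rw [partitionEntropy_eq_lintegral μ hg, ← lintegral_add_left]
    · refine lintegral_mono_ae ?_
      filter_upwards [hpos, ae_fiber_real_pos μ g] with x h1 h2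
      rw [Real.log_mul h2.ne' h1.ne', neg_add]
      exact ENNReal.ofReal_add_le
    · exact (measurable_of_countable
        (fun c => ENNReal.ofReal (-Real.log (μ.real (g ⁻¹' {c}))))).comp hg

lemma partitionEntropy_prod_le_add (μ : Measure X) [IsProbabilityMeasure μ] {f : X → α}
    {g : X → γ} (hf : Measurable f) (hg : Measurable g) :
    partitionEntropy μ (fun x => (g x, f x)) ≤ partitionEntropy μ g + partitionEntropy μ f := by
  rw [partitionEntropy_eq_lintegral μ hf]
  refine partitionEntropy_prod_le μ hf hg (fun _ a => μ.real (f ⁻¹' {a}))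
    (fun _ => ?_) (ae_fiber_real_pos μ f)
  simpa [ofReal_measureReal] using (tsum_fiber μ hf).le

lemma partitionEntropy_comp {T : X → X} (μ : Measure X) (hT : MeasurePreserving T μ μ)
    {f : X → α} (hf : Measurable f) :
    partitionEntropy μ (fun x => f (T x)) = partitionEntropy μ f := by
  refine tsum_congr fun a => ?_
  have : μ ((fun x => f (T x)) ⁻¹' {a}) = μ (f ⁻¹' {a}) :=
    hT.measure_preimage (hf (measurableSet_singleton a)).nullMeasurableSet
  rw [this]

/-- The itinerary of length `n` with respect to a partition. -/
def itin {β : Type*} (T : X → X) (p : X → β) (n : ℕ) (x : X) : Fin n → β := fun i => p (T^[i] x)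

lemma measurable_itin {β : Type*} [MeasurableSpace β] {T : X → X} (hT : Measurable T) {p : X → β}
    (hp : Measurable p) (n : ℕ) : Measurable (itin T p n) :=
  measurable_pi_lambda _ fun i => hp.comp (hT.iterate i)

lemma itin_eq_iff {β : Type*} {T : X → X} {p : X → β} {n : ℕ} {x y : X} :
    itin T p n x = itin T p n y ↔ ∀ i < n, p (T^[i] x) = p (T^[i] y) := by
  rw [funext_iff]
  exact ⟨fun h i hi => h ⟨i, hi⟩, fun h i => h i i.2⟩

lemma partitionEntropy_itin_mul_le {T : X → X} (μ : Measure X) [IsProbabilityMeasure μ]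
    (hT : MeasurePreserving T μ μ) {p : X → γ} (hp : Measurable p) (k m : ℕ) :
    partitionEntropy μ (itin T p (m * k)) ≤ m * partitionEntropy μ (itin T p k) := by
  induction m with
  | zero =>
    refine (partitionEntropy_mono (γ := Unit) μ (h := fun _ => ())
      (measurable_itin hT.measurable hp _) measurable_const ?_).trans ?_
    · intro x y _
      rw [itin_eq_iff]
      simp
    · simp [partitionEntropy_eq_lintegral μ (measurable_const (a := ()))]
  | succ m ih =>
    have h1 := measurable_itin hT.measurable hp (m * k)
    have h2 := (measurable_itin hT.measurable hp k).comp (hT.iterate (m * k)).measurable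
    refine (partitionEntropy_mono μ (measurable_itin hT.measurable hp _) (h1.prodMk h2)
      ?_).trans ?_
    · intro x y hxy
      rw [Prod.mk.injEq, itin_eq_iff] at hxy
      have h3 := hxy.2
      simp only [Function.comp] at h3
      rw [itin_eq_iff] at h3
      rw [itin_eq_iff]
      intro i hi
      by_cases him : i < m * k
      · exact hxy.1 i him
      · have := h3 (i - m * k) (by rw [Nat.succ_mul] at hi; omega)
        rw [← Function.iterate_add_apply, ← Function.iterate_add_apply,
          Nat.sub_add_cancel (not_lt.1 him)] at this
        exact this
    · refine (partitionEntropy_prod_le_add μ h2 h1).trans ?_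
      push_cast
      rw [add_mul, one_mul]
      refine add_le_add ih (le_of_eq ?_)
      exact partitionEntropy_comp μ (hT.iterate (m * k)) (measurable_itin hT.measurable hp k)

end PartitionEntropy

end CMS

namespace CMS

section Entropy

variable {X : Type*} [MeasurableSpace X]

/-- A channel on `ℕ` that keeps its input with probability at least `1 - δ`, and is otherwise
uniform on the finite set `R`. -/
noncomputable def channel (R : Finset ℕ) (δ : ℝ) (b a : ℕ) : ℝ :=
  (if a = b then 1 - δ else 0) + if a ∈ R then δ / R.card else 0

lemma tsum_channel_le {R : Finset ℕ} {δ : ℝ} (h0 : 0 < δ) (h1 : δ < 1) (b : ℕ) :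
    ∑' a, ENNReal.ofReal (channel R δ b a) ≤ 1 := by
  have h (a : ℕ) : ENNReal.ofReal (channel R δ b a) =
      (if a = b then ENNReal.ofReal (1 - δ) else 0) +
        if a ∈ R then ENNReal.ofReal (δ / R.card) else 0 := by
    rw [channel, ENNReal.ofReal_add (by split_ifs <;> linarith) (by split_ifs <;> positivity)]
    split_ifs <;> simp
  simp_rw [h]
  rw [ENNReal.tsum_add, tsum_ite_eq, tsum_eq_sum (s := R) (by intro a ha; simp [ha]),
    Finset.sum_ite_mem, Finset.inter_self, Finset.sum_const, nsmul_eq_mul]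
  have h2 : (R.card : ℝ≥0∞) * ENNReal.ofReal (δ / R.card) ≤ ENNReal.ofReal δ := by
    rw [← ENNReal.ofReal_natCast, ← ENNReal.ofReal_mul (by positivity)]
    apply ENNReal.ofReal_le_ofReal
    rcases eq_or_ne (R.card : ℝ) 0 with h | h
    · rw [h]; simpa using h0.le
    · rw [mul_div_cancel₀ _ h]
  refine (add_le_add_right h2 _).trans ?_
  rw [← ENNReal.ofReal_add (by linarith) h0.le]
  simp

/-- The error term in the comparison of the entropies of two close partitions. -/
noncomputable def channelLoss (M : ℕ) (δ : ℝ) : ℝ :=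
  -Real.log (1 - δ) + δ * -Real.log (δ / M)

lemma channelLoss_nonneg {M : ℕ} {δ : ℝ} (h0 : 0 < δ) (h1 : δ < 1) (hM : 1 ≤ M) :
    0 ≤ channelLoss M δ := by
  have h2 : Real.log (1 - δ) ≤ 0 := Real.log_nonpos (by linarith) (by linarith)
  have hM' : (1 : ℝ) ≤ M := by exact_mod_cast hM
  have h3 : Real.log (δ / M) ≤ 0 := Real.log_nonpos (by positivity)
    ((div_le_self h0.le hM').trans h1.le)
  have h4 := mul_nonneg h0.le (neg_nonneg.2 h3)
  rw [channelLoss]; linarith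

lemma tendsto_channelLoss (M : ℕ) (hM : 1 ≤ M) :
    Tendsto (channelLoss M) (𝓝[>] 0) (𝓝 0) := by
  have h1 : Tendsto (fun δ : ℝ => -Real.log (1 - δ)) (𝓝[>] 0) (𝓝 (-Real.log (1 - 0))) := by
    refine tendsto_nhdsWithin_of_tendsto_nhds ?_
    exact ((Real.continuousAt_log (by norm_num)).tendsto.comp
      (tendsto_const_nhds.sub tendsto_id)).neg
  have h2 : Tendsto (fun δ : ℝ => Real.negMulLog δ + δ * Real.log M) (𝓝[>] 0)
      (𝓝 (Real.negMulLog 0 + 0 * Real.log M)) := by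
    refine tendsto_nhdsWithin_of_tendsto_nhds ?_
    exact (Real.continuous_negMulLog.tendsto 0).add (tendsto_id.mul_const _)
  have h3 := h1.add h2
  simp only [sub_zero, Real.log_one, neg_zero, Real.negMulLog_zero, zero_mul, add_zero] at h3
  refine h3.congr' ?_
  filter_upwards [self_mem_nhdsWithin] with δ (hδ : 0 < δ)
  have hM' : (M : ℝ) ≠ 0 := by positivity
  rw [channelLoss, Real.log_div hδ.ne' hM', Real.negMulLog]
  ring

lemma partitionEntropy_itin_le_of_close {T : X → X} (μ : Measure X) [IsProbabilityMeasure μ]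
    (hT : MeasurePreserving T μ μ) {p q : X → ℕ} (hp : Measurable p) (hq : Measurable q)
    (R : Finset ℕ) (hR : ∀ x, p x ∈ R) {δ : ℝ} (h0 : 0 < δ) (h1 : δ < 1)
    (hδ : μ {x | p x ≠ q x} ≤ ENNReal.ofReal δ) (n : ℕ) :
    partitionEntropy μ (itin T p n) ≤ partitionEntropy μ (itin T q n) +
      n * ENNReal.ofReal (channelLoss R.card δ) := by
  rcases isEmpty_or_nonempty X with hX | ⟨⟨x₀⟩⟩
  · have := measure_univ (μ := μ)
    rw [Set.eq_empty_of_isEmpty (univ : Set X)] at this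
    simp at this
  have hcard : 1 ≤ R.card := Finset.card_pos.2 ⟨_, hR x₀⟩
  have hcard' : (1 : ℝ) ≤ R.card := by exact_mod_cast hcard
  have hpos (x : X) : 0 < channel R δ (q x) (p x) := by
    rw [channel, if_pos (hR x)]
    have : 0 < δ / R.card := by positivity
    split_ifs <;> linarith
  have hlog (x : X) : ENNReal.ofReal (-Real.log (channel R δ (q x) (p x))) ≤
      ENNReal.ofReal (-Real.log (1 - δ)) +
        {x | p x ≠ q x}.indicator (fun _ => ENNReal.ofReal (-Real.log (δ / R.card))) x := by
    by_cases h : p x = q x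
    · rw [indicator_of_notMem (by simpa using h), add_zero]
      apply ENNReal.ofReal_le_ofReal
      have : 1 - δ ≤ channel R δ (q x) (p x) := by
        rw [channel, if_pos h, if_pos (hR x)]
        have : 0 < δ / R.card := by positivity
        linarith
      have := Real.log_le_log (by linarith) this
      linarith
    · rw [indicator_of_mem (by simpa using h)]
      refine le_trans (ENNReal.ofReal_le_ofReal ?_) le_add_self
      rw [channel, if_neg h, if_pos (hR x), zero_add]
  have hmeas : Measurable fun x => ENNReal.ofReal (-Real.log (channel R δ (q x) (p x))) :=
    (measurable_of_countable
      fun z : ℕ × ℕ => ENNReal.ofReal (-Real.log (channel R δ z.1 z.2))).comp (hq.prodMk hp)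
  have hset : MeasurableSet {x | p x ≠ q x} := (measurableSet_eq_fun hp hq).compl
  have hInt : ∫⁻ x, ENNReal.ofReal (-Real.log (channel R δ (q x) (p x))) ∂μ ≤
      ENNReal.ofReal (channelLoss R.card δ) := by
    refine (lintegral_mono hlog).trans ?_
    rw [lintegral_add_left measurable_const, lintegral_const, measure_univ, mul_one,
      lintegral_indicator_const hset]
    have h2 : 0 ≤ -Real.log (δ / R.card) := by
      have := Real.log_nonpos (x := δ / R.card) (by positivity)
        ((div_le_self h0.le hcard').trans h1.le)
      linarith
    have h3 : 0 ≤ -Real.log (1 - δ) := by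
      have := Real.log_nonpos (x := 1 - δ) (by linarith) (by linarith)
      linarith
    rw [channelLoss, ENNReal.ofReal_add h3 (by positivity), mul_comm δ, ENNReal.ofReal_mul h2]
    gcongr
  have hjoin (j : ℕ) (hj : j ≤ n) :
      partitionEntropy μ (fun x => (itin T q n x, itin T p j x)) ≤
        partitionEntropy μ (itin T q n) + j * ENNReal.ofReal (channelLoss R.card δ) := by
    have hqn := measurable_itin hT.measurable hq n
    induction j with
    | zero =>
      simp only [Nat.cast_zero, zero_mul, add_zero]
      refine partitionEntropy_mono μ
        (hqn.prodMk (measurable_itin hT.measurable hp 0)) hqn ?_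
      intro x y hxy
      rw [Prod.mk.injEq]
      exact ⟨hxy, Subsingleton.elim _ _⟩
    | succ j ih =>
      have hpj := measurable_itin hT.measurable hp j
      have hpj' := hp.comp (hT.measurable.iterate j)
      refine (partitionEntropy_mono μ (hqn.prodMk (measurable_itin hT.measurable hp (j + 1)))
        ((hqn.prodMk hpj).prodMk hpj') ?_).trans ?_
      · intro x y hxy
        simp only [Prod.mk.injEq] at hxy ⊢
        obtain ⟨⟨h1, h2⟩, h3⟩ := hxy
        refine ⟨h1, ?_⟩
        rw [itin_eq_iff] at h2 ⊢
        intro i hi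
        rcases Nat.lt_succ_iff_lt_or_eq.1 hi with h | rfl
        · exact h2 i h
        · exact h3
      · refine (partitionEntropy_prod_le μ hpj' (hqn.prodMk hpj)
          (fun c a => channel R δ (c.1 ⟨j, hj⟩) a) (fun c => tsum_channel_le h0 h1 _)
          (ae_of_all _ fun x => hpos _)).trans ?_
        push_cast
        rw [add_mul, one_mul, ← add_assoc]
        refine add_le_add (ih (by omega)) ?_
        refine le_trans (le_of_eq ?_) hInt
        exact (hT.iterate j).lintegral_comp hmeas
  refine (partitionEntropy_mono μ (measurable_itin hT.measurable hp n)
    ((measurable_itin hT.measurable hq n).prodMk (measurable_itin hT.measurable hp n)) ?_).trans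
    (hjoin n le_rfl)
  intro x y hxy
  exact (Prod.mk.inj hxy).2

/-- A partition all of whose refinements generate, in the sense that finite partitions can be
approximated in measure, bounds the entropy from above. -/
lemma entropy_le_of_generating {γ : Type*} [MeasurableSpace γ] [Countable γ]
    [MeasurableSingletonClass γ] {T : X → X} (μ : Measure X) [IsProbabilityMeasure μ]
    (hT : MeasurePreserving T μ μ) {p₀ : X → γ} (hp₀ : Measurable p₀)
    (hgen : ∀ p : X → ℕ, Measurable p → (range p).Finite → ∀ δ : ℝ, 0 < δ →
      ∃ (N : ℕ) (g : (Fin N → γ) → ℕ),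
        μ {x | p x ≠ g (itin T p₀ N x)} ≤ ENNReal.ofReal δ)
    {k : ℕ} (hk : 1 ≤ k) {h : ℝ} (h_nonneg : 0 ≤ h)
    (hh : partitionEntropy μ (itin T p₀ k) ≤ ENNReal.ofReal h) :
    entropy T μ ≤ ENNReal.ofReal (h / k) := by
  refine iSup₂_le fun p ⟨hp, hfin⟩ => ?_
  rcases isEmpty_or_nonempty X with hX | ⟨⟨x₀⟩⟩
  · have := measure_univ (μ := μ)
    rw [Set.eq_empty_of_isEmpty (univ : Set X)] at this
    simp at this
  set R := hfin.toFinset with hRdef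
  have hR (x : X) : p x ∈ R := by simp [hRdef]
  have hcard : 1 ≤ R.card := Finset.card_pos.2 ⟨_, hR x₀⟩
  have hk' : (0 : ℝ) < k := by exact_mod_cast hk
  have key (δ : ℝ) (h0 : 0 < δ) (h1 : δ < 1) :
      atTop.liminf (fun n : ℕ => ENNReal.ofReal ((n : ℝ)⁻¹) * partitionEntropy μ (itin T p n)) ≤
        ENNReal.ofReal (h / k + channelLoss R.card δ + δ) := by
    obtain ⟨N, g, hg⟩ := hgen p hp hfin δ h0
    have hc := channelLoss_nonneg h0 h1 hcard
    set c := channelLoss R.card δ with hcdef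
    have hq : Measurable fun x => g (itin T p₀ N x) :=
      (measurable_of_countable g).comp (measurable_itin hT.measurable hp₀ N)
    refine liminf_le_of_frequently_le' ?_
    rw [frequently_atTop]
    intro a
    obtain ⟨m₀, hm₀⟩ := exists_nat_ge (N * h / δ)
    set m := max a (max m₀ 1) with hm
    have hm1 : 1 ≤ m := by omega
    have hm1' : (0 : ℝ) < m := by exact_mod_cast hm1
    refine ⟨m * k, ?_, ?_⟩
    · calc a ≤ m := le_max_left _ _
        _ ≤ m * k := Nat.le_mul_of_pos_right _ hk
    have e1 := partitionEntropy_itin_le_of_close μ hT hp hq R hR h0 h1 hg (m * k)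
    have e2 : partitionEntropy μ (itin T (fun x => g (itin T p₀ N x)) (m * k)) ≤
        partitionEntropy μ (itin T p₀ ((m + N) * k)) := by
      refine partitionEntropy_mono μ (measurable_itin hT.measurable hq _)
        (measurable_itin hT.measurable hp₀ _) ?_
      intro x y hxy
      rw [itin_eq_iff] at hxy ⊢
      intro i hi
      congr 1
      rw [itin_eq_iff]
      intro j hj
      rw [← Function.iterate_add_apply, ← Function.iterate_add_apply]
      apply hxy
      have : N ≤ N * k := Nat.le_mul_of_pos_right _ hk
      rw [add_mul]; omega
    have e3 := partitionEntropy_itin_mul_le μ hT hp₀ k (m + N)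
    have e4 : partitionEntropy μ (itin T p (m * k)) ≤
        ENNReal.ofReal ((m + N) * h + (m * k) * c) := by
      refine (e1.trans (add_le_add_left (e2.trans (e3.trans (mul_le_mul_right hh _))) _)).trans
        (le_of_eq ?_)
      rw [ENNReal.ofReal_add (by positivity) (by positivity), ENNReal.ofReal_mul (by positivity),
        ENNReal.ofReal_mul (by positivity)]
      congr 2 <;> norm_cast
    refine (mul_le_mul_right e4 _).trans ?_
    rw [← ENNReal.ofReal_mul (by positivity)]
    apply ENNReal.ofReal_le_ofReal
    have hm2 : N * h / δ ≤ m := hm₀.trans (by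
      exact_mod_cast (le_max_left m₀ 1).trans (le_max_right a _))
    have hk1 : (1 : ℝ) ≤ k := by exact_mod_cast hk
    rw [div_le_iff₀ h0] at hm2
    push_cast
    rw [inv_mul_le_iff₀ (by positivity)]
    have e5 : (m : ℝ) * k * (h / k + c + δ) = m * h + m * k * c + m * δ * k := by
      field_simp
    rw [e5]
    have e6 : (m : ℝ) * δ ≤ m * δ * k := le_mul_of_one_le_right (by positivity) hk1
    linarith
  have hlim : Tendsto (fun δ : ℝ => ENNReal.ofReal (h / k + channelLoss R.card δ + δ))
      (𝓝[>] 0) (𝓝 (ENNReal.ofReal (h / k))) := by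
    refine ENNReal.tendsto_ofReal ?_
    have := ((tendsto_channelLoss R.card hcard).const_add (h / k)).add
      (tendsto_nhdsWithin_of_tendsto_nhds (tendsto_id (x := 𝓝 (0 : ℝ))))
    simpa using this
  refine ge_of_tendsto hlim ?_
  filter_upwards [Ioo_mem_nhdsGT (zero_lt_one' ℝ)] with δ hδ
  exact key δ hδ.1 hδ.2

end Entropy

end CMS

namespace CMS

section EntropyLower

variable {X : Type*} [MeasurableSpace X]

lemma measure_real_le_one (μ : Measure X) [IsProbabilityMeasure μ] (s : Set X) :
    (μ s).toReal ≤ 1 :=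
  ENNReal.toReal_le_of_le_ofReal zero_le_one (by simpa using prob_le_one)

/-- Concavity of the entropy of a partition. -/
lemma sum_partitionEntropy_le {ι α : Type*} (s : Finset ι) (t : ι → ℝ) (ht : ∀ i ∈ s, 0 ≤ t i)
    (ht1 : ∑ i ∈ s, t i = 1) (m : ι → Measure X) (hm : ∀ i, IsProbabilityMeasure (m i))
    (μ : Measure X) (g : X → α)
    (hμ : ∀ a, (μ (g ⁻¹' {a})).toReal = ∑ i ∈ s, t i * (m i (g ⁻¹' {a})).toReal) :
    ∑ i ∈ s, ENNReal.ofReal (t i) * partitionEntropy (m i) g ≤ partitionEntropy μ g := by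
  unfold partitionEntropy
  simp_rw [← ENNReal.tsum_mul_left]
  rw [← Summable.tsum_finsetSum (fun _ _ => ENNReal.summable)]
  refine ENNReal.tsum_le_tsum fun a => ?_
  have h1 (i : ι) : 0 ≤ -((m i (g ⁻¹' {a})).toReal * Real.log ((m i (g ⁻¹' {a})).toReal)) := by
    have := Real.mul_log_nonpos (x := (m i (g ⁻¹' {a})).toReal) ENNReal.toReal_nonneg
      (measure_real_le_one _ _)
    linarith
  have h2 := Real.concaveOn_negMulLog.le_map_sum (t := s) (w := t)
    (p := fun i => (m i (g ⁻¹' {a})).toReal) ht ht1 (fun i _ => ENNReal.toReal_nonneg)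
  simp only [smul_eq_mul, Real.negMulLog] at h2
  calc ∑ i ∈ s, ENNReal.ofReal (t i) *
        ENNReal.ofReal (-((m i (g ⁻¹' {a})).toReal * Real.log ((m i (g ⁻¹' {a})).toReal)))
      = ENNReal.ofReal (∑ i ∈ s, t i *
        -((m i (g ⁻¹' {a})).toReal * Real.log ((m i (g ⁻¹' {a})).toReal))) := by
        rw [ENNReal.ofReal_sum_of_nonneg fun i hi => mul_nonneg (ht i hi) (h1 i)]
        exact Finset.sum_congr rfl fun i hi => (ENNReal.ofReal_mul (ht i hi)).symm
    _ ≤ _ := by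
        apply ENNReal.ofReal_le_ofReal
        rw [hμ]
        simpa only [neg_mul] using h2

lemma liminf_add_liminf_le (u v : ℕ → ℝ≥0∞) :
    atTop.liminf u + atTop.liminf v ≤ atTop.liminf (fun n => u n + v n) := by
  simp only [liminf_eq_iSup_iInf_of_nat]
  rw [ENNReal.iSup_add_iSup_of_monotone]
  · refine iSup_mono fun N => le_iInf₂ fun n hn => add_le_add ?_ ?_
    · exact iInf₂_le n hn
    · exact iInf₂_le n hn
  all_goals
    intro a b hab
    exact le_iInf₂ fun n hn => iInf₂_le n (le_trans hab hn)

/-- Concavity of the entropy. -/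
lemma entropy_mix_le {T : X → X} (hT : Measurable T) (t : ℝ) (h0 : 0 ≤ t) (h1 : t ≤ 1)
    (μ ν : ProbabilityMeasure X) :
    ENNReal.ofReal t * entropy T (μ : Measure X) +
      ENNReal.ofReal (1 - t) * entropy T (ν : Measure X) ≤
        entropy T (mix t h0 h1 μ ν : Measure X) := by
  unfold entropy
  simp_rw [ENNReal.mul_iSup]
  have hne : ∃ p : X → ℕ, Measurable p ∧ (range p).Finite :=
    ⟨fun _ => 0, measurable_const, (finite_singleton 0).subset (by rintro _ ⟨_, rfl⟩; rfl)⟩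
  refine ENNReal.biSup_add_biSup_le' hne hne ?_
  rintro p ⟨hp, hpf⟩ q ⟨hq, hqf⟩
  set r : X → ℕ := fun x => Nat.pair (p x) (q x) with hr
  have hrm : Measurable r :=
    (measurable_of_countable fun z : ℕ × ℕ => Nat.pair z.1 z.2).comp (hp.prodMk hq)
  have hrf : (range r).Finite := by
    refine ((hpf.prod hqf).image fun z : ℕ × ℕ => Nat.pair z.1 z.2).subset ?_
    rintro _ ⟨x, rfl⟩
    exact ⟨(p x, q x), ⟨⟨x, rfl⟩, ⟨x, rfl⟩⟩, rfl⟩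
  refine le_trans ?_ (le_iSup₂ (f := fun (p : X → ℕ) (_ : Measurable p ∧ (range p).Finite) =>
    atTop.liminf fun n : ℕ => ENNReal.ofReal ((n : ℝ)⁻¹) *
      partitionEntropy (mix t h0 h1 μ ν : Measure X) (itin T p n)) r ⟨hrm, hrf⟩)
  rw [← ENNReal.liminf_const_mul_of_ne_top ENNReal.ofReal_ne_top,
    ← ENNReal.liminf_const_mul_of_ne_top ENNReal.ofReal_ne_top]
  refine (liminf_add_liminf_le _ _).trans (liminf_le_liminf (Eventually.of_forall fun n => ?_))
  have e1 : partitionEntropy (μ : Measure X) (itin T p n) ≤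
      partitionEntropy (μ : Measure X) (itin T r n) :=
    partitionEntropy_mono _ (measurable_itin hT hp n) (measurable_itin hT hrm n) fun x y h => by
      rw [itin_eq_iff] at h ⊢
      exact fun i hi => (Nat.pair_eq_pair.1 (h i hi)).1
  have e2 : partitionEntropy (ν : Measure X) (itin T q n) ≤
      partitionEntropy (ν : Measure X) (itin T r n) :=
    partitionEntropy_mono _ (measurable_itin hT hq n) (measurable_itin hT hrm n) fun x y h => by
      rw [itin_eq_iff] at h ⊢
      exact fun i hi => (Nat.pair_eq_pair.1 (h i hi)).2
  have e3 := sum_partitionEntropy_le Finset.univ (fun b : Bool => cond b t (1 - t))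
    (by intro b _; cases b <;> simp <;> linarith) (by simp)
    (fun b : Bool => cond b (μ : Measure X) (ν : Measure X))
    (by intro b; cases b <;> simp <;> infer_instance) (mix t h0 h1 μ ν : Measure X) (itin T r n)
    (by
      intro a
      have : (mix t h0 h1 μ ν : Measure X) =
        ENNReal.ofReal t • (μ : Measure X) + ENNReal.ofReal (1 - t) • (ν : Measure X) := rfl
      rw [this, Measure.add_apply, Measure.smul_apply, Measure.smul_apply, ENNReal.toReal_add]
      · simp [ENNReal.toReal_ofReal h0, ENNReal.toReal_ofReal (sub_nonneg.2 h1)]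
      · exact ENNReal.mul_ne_top ENNReal.ofReal_ne_top (measure_ne_top _ _)
      · exact ENNReal.mul_ne_top ENNReal.ofReal_ne_top (measure_ne_top _ _))
  simp only [Fintype.univ_bool, Finset.mem_singleton, Bool.true_eq_false, not_false_eq_true,
    Finset.sum_insert, Finset.sum_singleton, cond_true, cond_false] at e3
  calc _ ≤ ENNReal.ofReal t * (ENNReal.ofReal (n : ℝ)⁻¹ *
          partitionEntropy (μ : Measure X) (itin T r n)) +
        ENNReal.ofReal (1 - t) * (ENNReal.ofReal (n : ℝ)⁻¹ *
          partitionEntropy (ν : Measure X) (itin T r n)) := by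
        gcongr
        · exact e1
        · exact e2
    _ = ENNReal.ofReal (n : ℝ)⁻¹ * (ENNReal.ofReal t *
          partitionEntropy (μ : Measure X) (itin T r n) + ENNReal.ofReal (1 - t) *
          partitionEntropy (ν : Measure X) (itin T r n)) := by ring
    _ ≤ _ := mul_le_mul_right e3 _

/-! ### Bernoulli block measures -/

variable {ι : Type*} [MeasurableSpace ι] [Countable ι] [MeasurableSingletonClass ι]

lemma partitionEntropy_infinitePi (π : Measure ι) [IsProbabilityMeasure π] (m c : ℕ) :
    partitionEntropy (Measure.infinitePi fun _ : ℕ => π)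
      (fun ω : ℕ → ι => fun i : Fin m => ω (c + i)) = m * partitionEntropy π id := by
  set Q := Measure.infinitePi fun _ : ℕ => π
  have hf : Measurable fun ω : ℕ → ι => fun i : Fin m => ω (c + i) :=
    measurable_pi_lambda _ fun i => measurable_pi_apply _
  rw [partitionEntropy_eq_lintegral Q hf, partitionEntropy_eq_lintegral π measurable_id]
  have hfib (ω : ℕ → ι) : Q.real ((fun ω : ℕ → ι => fun i : Fin m => ω (c + i)) ⁻¹'
      {fun i : Fin m => ω (c + i)}) = ∏ i : Fin m, π.real {ω (c + i)} := by
    have e : (fun ω : ℕ → ι => fun i : Fin m => ω (c + i)) ⁻¹' {fun i : Fin m => ω (c + i)} =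
        (↑((Finset.univ : Finset (Fin m)).image fun i : Fin m => c + (i : ℕ)) : Set ℕ).pi
          fun j => {ω j} := by
      ext ω'
      simp [funext_iff, Set.pi]
    rw [Measure.real, e, Measure.infinitePi_pi _ fun _ _ => measurableSet_singleton _,
      Finset.prod_image (by intro i _ j _ h; exact Fin.ext (by simpa using h)), ENNReal.toReal_prod]
    rfl
  simp_rw [hfib]
  have hm : Measurable fun a : ι => ENNReal.ofReal (-Real.log (π.real {a})) :=
    measurable_of_countable _
  have hpos : ∀ᵐ ω ∂Q, ∀ i : Fin m, 0 < π.real {ω (c + i)} := by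
    rw [ae_all_iff]
    intro i
    have h1 : ∀ᵐ a ∂π, 0 < π.real {a} := ae_fiber_real_pos π id
    exact (measurePreserving_eval_infinitePi (fun _ : ℕ => π) (c + i)).quasiMeasurePreserving.ae h1
  calc ∫⁻ ω, ENNReal.ofReal (-Real.log (∏ i : Fin m, π.real {ω (c + i)})) ∂Q
      = ∫⁻ ω, ∑ i : Fin m, ENNReal.ofReal (-Real.log (π.real {ω (c + i)})) ∂Q := by
        refine lintegral_congr_ae ?_
        filter_upwards [hpos] with ω hω
        rw [Real.log_prod fun i _ => (hω i).ne', ← Finset.sum_neg_distrib,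
          ENNReal.ofReal_sum_of_nonneg]
        intro i _
        have := Real.log_nonpos (x := π.real {ω (c + i)}) measureReal_nonneg
          (measure_real_le_one _ _)
        linarith
    _ = ∑ i : Fin m, ∫⁻ ω, ENNReal.ofReal (-Real.log (π.real {ω (c + i)})) ∂Q :=
        lintegral_finsetSum _ fun i _ => hm.comp (measurable_pi_apply _)
    _ = ∑ _i : Fin m, ∫⁻ a, ENNReal.ofReal (-Real.log (π.real {a})) ∂π := by
        refine Finset.sum_congr rfl fun i _ => ?_
        exact (measurePreserving_eval_infinitePi (fun _ : ℕ => π) (c + i)).lintegral_comp hm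
    _ = _ := by simp

/-- The average over one block of the image of a Bernoulli measure under a coding map. -/
noncomputable def blockMeasure (T : X → X) (Θ : (ℕ → ι) → X) (π : Measure ι)
    [IsProbabilityMeasure π] (N : ℕ) : Measure X :=
  (N : ℝ≥0∞)⁻¹ • ∑ i ∈ Finset.range N,
    Measure.map (fun ω => T^[i] (Θ ω)) (Measure.infinitePi fun _ : ℕ => π)

variable {T : X → X} {Θ : (ℕ → ι) → X} (π : Measure ι) [IsProbabilityMeasure π] {N : ℕ}

lemma isProbabilityMeasure_blockMeasure (hT : Measurable T) (hΘ : Measurable Θ) (hN : 1 ≤ N) :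
    IsProbabilityMeasure (blockMeasure T Θ π N) := by
  refine ⟨?_⟩
  have (i : ℕ) : Measure.map (fun ω => T^[i] (Θ ω)) (Measure.infinitePi fun _ : ℕ => π) univ = 1 := by
    have hm : Measurable fun ω : ℕ → ι => T^[i] (Θ ω) := (hT.iterate i).comp hΘ
    rw [Measure.map_apply hm MeasurableSet.univ]
    simp
  rw [blockMeasure, Measure.smul_apply, Measure.finsetSum_apply]
  simp_rw [this]
  simp only [Finset.sum_const, Finset.card_range, nsmul_eq_mul, mul_one, smul_eq_mul]
  exact ENNReal.inv_mul_cancel (by simpa using Nat.one_le_iff_ne_zero.1 hN) (by simp)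

lemma invariant_blockMeasure (hT : Measurable T) (hΘ : Measurable Θ) (hN : 1 ≤ N)
    (hshift : ∀ ω, T^[N] (Θ ω) = Θ (fun i => ω (i + 1))) :
    Invariant T (blockMeasure T Θ π N) := by
  have hm (i : ℕ) : Measurable fun ω : ℕ → ι => T^[i] (Θ ω) := (hT.iterate i).comp hΘ
  have h1 (i : ℕ) : Measure.map T (Measure.map (fun ω => T^[i] (Θ ω))
      (Measure.infinitePi fun _ : ℕ => π)) =
      Measure.map (fun ω => T^[i + 1] (Θ ω)) (Measure.infinitePi fun _ : ℕ => π) := by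
    rw [Measure.map_map hT (hm i)]
    simp [Function.comp_def, Function.iterate_succ_apply']
  have h2 : Measure.map (fun ω => T^[N] (Θ ω)) (Measure.infinitePi fun _ : ℕ => π) =
      Measure.map (fun ω => T^[0] (Θ ω)) (Measure.infinitePi fun _ : ℕ => π) := by
    simp_rw [hshift]
    conv_rhs => rw [← Measure.map_infinitePi_infinitePi_of_inj (P := fun _ : ℕ => π)
      (f := fun i : ℕ => i + 1) (add_left_injective 1)]
    rw [Measure.map_map (hm 0)
      (measurable_pi_lambda _ fun i => measurable_pi_apply _)]
    rfl
  rw [Invariant, blockMeasure, Measure.map_smul, ← Measure.mapₗ_apply_of_measurable hT, map_sum]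
  simp_rw [Measure.mapₗ_apply_of_measurable hT, h1]
  congr 1
  obtain ⟨M, rfl⟩ : ∃ M, N = M + 1 := ⟨N - 1, by omega⟩
  rw [Finset.sum_range_succ, Finset.sum_range_succ', h2]

lemma blockMeasure_real_apply (hT : Measurable T) (hΘ : Measurable Θ) {s : Set X}
    (hs : MeasurableSet s) :
    (blockMeasure T Θ π N s).toReal = ∑ i ∈ Finset.range N, (N : ℝ)⁻¹ *
      (Measure.map (fun ω => T^[i] (Θ ω)) (Measure.infinitePi fun _ : ℕ => π) s).toReal := by
  have hm (i : ℕ) : Measurable fun ω : ℕ → ι => T^[i] (Θ ω) := (hT.iterate i).comp hΘ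
  rw [blockMeasure, Measure.smul_apply, Measure.finsetSum_apply, smul_eq_mul, ENNReal.toReal_mul,
    ENNReal.toReal_sum, Finset.mul_sum]
  · simp
  · intro i _
    rw [Measure.map_apply (hm i) hs]
    exact measure_ne_top _ _

lemma lintegral_blockMeasure (hT : Measurable T) (hΘ : Measurable Θ) {f : X → ℝ≥0∞}
    (hf : Measurable f) :
    ∫⁻ x, f x ∂(blockMeasure T Θ π N) = (N : ℝ≥0∞)⁻¹ *
      ∫⁻ ω, ∑ i ∈ Finset.range N, f (T^[i] (Θ ω)) ∂(Measure.infinitePi fun _ : ℕ => π) := by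
  have hm (i : ℕ) : Measurable fun ω : ℕ → ι => T^[i] (Θ ω) := (hT.iterate i).comp hΘ
  have h : ∫⁻ ω, ∑ i ∈ Finset.range N, f (T^[i] (Θ ω)) ∂(Measure.infinitePi fun _ : ℕ => π) =
      ∑ i ∈ Finset.range N, ∫⁻ ω, f (T^[i] (Θ ω)) ∂(Measure.infinitePi fun _ : ℕ => π) :=
    lintegral_finsetSum _ fun i _ => hf.comp (hm i)
  rw [blockMeasure, lintegral_smul_measure, lintegral_finsetSum_measure, h, smul_eq_mul]
  congr 1
  exact Finset.sum_congr rfl fun i _ => lintegral_map hf (hm i)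

/-- The entropy of a block measure is at least the entropy of a symbol per block length, provided
that the symbols can be read off from the coded point. -/
lemma le_entropy_blockMeasure (hT : Measurable T) (hΘ : Measurable Θ) (hN : 1 ≤ N)
    (p : X → ℕ) (hp : Measurable p) (hpf : (range p).Finite) (idx : ι → ℕ)
    (hidx : Function.Injective idx) (hread : ∀ ω c, p (T^[N * c] (Θ ω)) = idx (ω c)) :
    ENNReal.ofReal ((N : ℝ)⁻¹) * partitionEntropy π id ≤ entropy T (blockMeasure T Θ π N) := by
  have hm (i : ℕ) : Measurable fun ω : ℕ → ι => T^[i] (Θ ω) := (hT.iterate i).comp hΘ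
  have hN' : (0 : ℝ) < N := by exact_mod_cast hN
  refine le_trans ?_ (le_iSup₂ (f := fun (p : X → ℕ) (_ : Measurable p ∧ (range p).Finite) =>
    atTop.liminf fun n : ℕ => ENNReal.ofReal ((n : ℝ)⁻¹) *
      partitionEntropy (blockMeasure T Θ π N) (itin T p n)) p ⟨hp, hpf⟩)
  have hbound (q : ℕ) : ((q / N - 1 : ℕ) : ℝ≥0∞) * partitionEntropy π id ≤
      partitionEntropy (blockMeasure T Θ π N) (itin T p q) := by
    have hq := measurable_itin hT hp q
    have h1 := sum_partitionEntropy_le (Finset.range N) (fun _ => (N : ℝ)⁻¹)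
      (fun _ _ => by positivity) (by simp [hN'.ne'])
      (fun i => Measure.map (fun ω => T^[i] (Θ ω)) (Measure.infinitePi fun _ : ℕ => π))
      (fun i => Measure.isProbabilityMeasure_map (hm i).aemeasurable)
      (blockMeasure T Θ π N) (itin T p q)
      (fun a => blockMeasure_real_apply π hT hΘ (hq (measurableSet_singleton a)))
    refine le_trans ?_ h1
    have h2 (i : ℕ) (hi : i ∈ Finset.range N) :
        ((q / N - 1 : ℕ) : ℝ≥0∞) * partitionEntropy π id ≤
        partitionEntropy (Measure.map (fun ω => T^[i] (Θ ω)) (Measure.infinitePi fun _ : ℕ => π))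
          (itin T p q) := by
      rw [← partitionEntropy_infinitePi π (q / N - 1) 1]
      have h3 : partitionEntropy
          (Measure.map (fun ω => T^[i] (Θ ω)) (Measure.infinitePi fun _ : ℕ => π)) (itin T p q) =
          partitionEntropy (Measure.infinitePi fun _ : ℕ => π)
            (fun ω => itin T p q (T^[i] (Θ ω))) := by
        refine tsum_congr fun a => ?_
        rw [Measure.map_apply (hm i) (hq (measurableSet_singleton a))]
        rfl
      rw [h3]
      refine partitionEntropy_mono _ (measurable_pi_lambda _ fun i => measurable_pi_apply _)
        (hq.comp (hm i)) fun ω ω' h => ?_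
      rw [itin_eq_iff] at h
      ext j
      apply hidx
      rw [← hread, ← hread]
      have hj := j.2
      have hi' := Finset.mem_range.1 hi
      have h4 : N * (1 + j) + N ≤ q := by
        calc N * (1 + j) + N = N * (j + 2) := by ring
          _ ≤ N * (q / N) := Nat.mul_le_mul_left _ (by omega)
          _ ≤ q := Nat.mul_div_le _ _
      have h5 : N ≤ N * (1 + j) := Nat.le_mul_of_pos_right _ (by omega)
      have := h (N * (1 + j) - i) (by omega)
      rwa [← Function.iterate_add_apply, ← Function.iterate_add_apply,
        Nat.sub_add_cancel (by omega)] at this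
    calc _ = ∑ i ∈ Finset.range N, ENNReal.ofReal (N : ℝ)⁻¹ *
          (((q / N - 1 : ℕ) : ℝ≥0∞) * partitionEntropy π id) := by
          rw [Finset.sum_const, Finset.card_range, nsmul_eq_mul, ← mul_assoc,
            ENNReal.ofReal_inv_of_pos hN', ENNReal.ofReal_natCast, ENNReal.mul_inv_cancel,
            one_mul]
          · simpa using Nat.one_le_iff_ne_zero.1 hN
          · simp
      _ ≤ _ := Finset.sum_le_sum fun i hi => mul_le_mul_right (h2 i hi) _
  have hlim : Tendsto (fun q : ℕ => ENNReal.ofReal ((N : ℝ)⁻¹ - 2 * (q : ℝ)⁻¹) *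
      partitionEntropy π id) atTop (𝓝 (ENNReal.ofReal ((N : ℝ)⁻¹) * partitionEntropy π id)) := by
    refine ENNReal.Tendsto.mul_const ?_ (Or.inl ?_)
    · refine ENNReal.tendsto_ofReal ?_
      simpa using (tendsto_inv_atTop_nhds_zero_nat (𝕜 := ℝ)).const_mul 2 |>.const_sub (N : ℝ)⁻¹
    · simpa using Nat.one_le_iff_ne_zero.1 hN
  rw [← hlim.liminf_eq]
  refine liminf_le_liminf ?_
  filter_upwards [eventually_ge_atTop 1] with q hq
  refine le_trans ?_ (mul_le_mul_right (hbound q) _)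
  rw [← mul_assoc]
  refine mul_le_mul_left ?_ _
  rw [← ENNReal.ofReal_natCast, ← ENNReal.ofReal_mul (by positivity)]
  apply ENNReal.ofReal_le_ofReal
  have hq' : (0 : ℝ) < q := by exact_mod_cast hq
  rw [le_inv_mul_iff₀ hq']
  have e1 : (q : ℝ) * ((N : ℝ)⁻¹ - 2 * (q : ℝ)⁻¹) = q / N - 2 := by field_simp
  rw [e1]
  have e2 : (q : ℝ) / N < (q / N : ℕ) + 1 := by
    rw [div_lt_iff₀ hN']
    exact_mod_cast Nat.lt_mul_of_div_lt (Nat.lt_succ_self (q / N)) hN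
  have e3 : ((q / N : ℕ) : ℝ) ≤ (q / N - 1 : ℕ) + 1 := by
    exact_mod_cast (by omega : q / N ≤ (q / N - 1) + 1)
  linarith

end EntropyLower

end CMS

namespace CMS

section ShiftBasics

variable {S : Type*} {A : S → S → Prop}

lemma mem_cylinder {w : List S} {x : Space A} :
    x ∈ cylinder A w ↔ ∀ (i : ℕ) (hi : i < w.length), x.1 i = w[i] :=
  ⟨fun h i hi => h ⟨i, hi⟩, fun h i => h i i.2⟩

@[simp] lemma length_word (x : Space A) (n : ℕ) : (word x n).length = n := by simp [word]

@[simp] lemma getElem_word (x : Space A) (n i : ℕ) (hi : i < (word x n).length) :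
    (word x n)[i] = x.1 i := by simp [word]

lemma mem_cylinder_iff_word {w : List S} {x : Space A} :
    x ∈ cylinder A w ↔ word x w.length = w := by
  rw [mem_cylinder]
  constructor
  · intro h
    refine List.ext_getElem (by simp) fun i h1 h2 => ?_
    rw [getElem_word, h]
  · intro h i hi
    have : (word x w.length)[i]'(by simpa using hi) = x.1 i := getElem_word _ _ _ _
    rw [← this]
    congr

lemma mem_cylinder_word (x : Space A) (n : ℕ) : x ∈ cylinder A (word x n) := by
  rw [mem_cylinder_iff_word, length_word]

lemma mem_cylinder_word_iff {x y : Space A} {n : ℕ} :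
    y ∈ cylinder A (word x n) ↔ ∀ i < n, y.1 i = x.1 i := by
  rw [mem_cylinder]; simp

@[simp] lemma cylinder_nil : cylinder A ([] : List S) = univ := by
  ext x; simp [mem_cylinder]

@[simp] lemma iterate_shift_apply (n i : ℕ) (x : Space A) : ((shift A)^[n] x).1 i = x.1 (i + n) := by
  induction n generalizing x with
  | zero => rfl
  | succ n ih =>
    rw [Function.iterate_succ_apply, ih]
    rfl

lemma mem_cylinder_append {u v : List S} {x : Space A} :
    x ∈ cylinder A (u ++ v) ↔ x ∈ cylinder A u ∧ (shift A)^[u.length] x ∈ cylinder A v := by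
  simp only [mem_cylinder, iterate_shift_apply]
  constructor
  · intro h
    refine ⟨fun i hi => ?_, fun i hi => ?_⟩
    · rw [h i (by simp; omega), List.getElem_append_left hi]
    · rw [h (i + u.length) (by simp; omega), List.getElem_append_right (by omega)]
      simp
  · rintro ⟨h1, h2⟩ i hi
    rcases lt_or_ge i u.length with h | h
    · rw [h1 i h, List.getElem_append_left h]
    · rw [List.getElem_append_right h]
      have := h2 (i - u.length) (by simp at hi; omega)
      rwa [Nat.sub_add_cancel h] at this

lemma cylinder_append_subset (u v : List S) : cylinder A (u ++ v) ⊆ cylinder A u :=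
  fun _ h => (mem_cylinder_append.1 h).1

lemma disjoint_cylinder {u v : List S} (hl : u.length = v.length) (h : u ≠ v) :
    Disjoint (cylinder A u) (cylinder A v) := by
  rw [Set.disjoint_left]
  intro x hu hv
  rw [mem_cylinder_iff_word] at hu hv
  exact h (by rw [← hu, hl, hv])

lemma cylinder_subset_of_inter {u v : List S} (hl : u.length ≤ v.length)
    (h : (cylinder A u ∩ cylinder A v).Nonempty) : cylinder A v ⊆ cylinder A u := by
  obtain ⟨x, hu, hv⟩ := h
  intro y hy
  rw [mem_cylinder] at *
  intro i hi
  rw [hy i (by omega), ← hv i (by omega), hu i hi]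

lemma admissible_word (x : Space A) {n : ℕ} (hn : 1 ≤ n) : Admissible A (word x n) := by
  refine ⟨fun h => ?_, ?_⟩
  · have := length_word x n
    rw [h] at this
    simp at this; omega
  · change List.IsChain A _
    rw [List.isChain_iff_getElem]
    intro i hi
    rw [getElem_word, getElem_word]
    exact x.2 i

lemma admissible_of_mem {w : List S} (hw : w ≠ []) {x : Space A} (hx : x ∈ cylinder A w) :
    Admissible A w := by
  rw [mem_cylinder_iff_word] at hx
  rw [← hx]
  exact admissible_word x (List.length_pos_iff.2 hw)

lemma NoZeroRowCol.cylinder_nonempty (hA : NoZeroRowCol A) {w : List S} (hw : Admissible A w) :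
    (cylinder A w).Nonempty := by
  obtain ⟨h1, h2⟩ := hw
  replace h2 : List.IsChain A w := h2
  induction w with
  | nil => exact absurd rfl h1
  | cons a w ih =>
    cases w with
    | nil =>
      choose next hnext using hA.1
      refine ⟨⟨fun i => next^[i] a, fun i => ?_⟩, ?_⟩
      · change A (next^[i] a) (next^[i + 1] a)
        rw [Function.iterate_succ_apply']
        exact hnext _
      · refine mem_cylinder.2 fun i hi => ?_
        have : i = 0 := by simpa using hi
        subst this
        rfl
    | cons b w =>
      rw [List.isChain_cons_cons] at h2
      obtain ⟨x, hx⟩ := ih (by simp) h2.2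
      rw [mem_cylinder] at hx
      have hy : ∀ i, A (Nat.casesOn i a x.1 : S) (Nat.casesOn (i + 1) a x.1 : S) := by
        intro i
        cases i with
        | zero =>
          have := hx 0 (by simp)
          change A a (x.1 0)
          rw [this]
          exact h2.1
        | succ i => exact x.2 i
      have hy' : (⟨fun i => (Nat.casesOn i a x.1 : S), hy⟩ : Space A) ∈ cylinder A (a :: b :: w) := by
        refine mem_cylinder.2 fun i hi => ?_
        cases i with
        | zero => rfl
        | succ i =>
          have := hx i (by simpa using hi)
          change x.1 i = _
          rw [this]
          rfl
      exact ⟨_, hy'⟩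

lemma birkhoff_add {X : Type*} (T : X → X) (φ : X → ℝ) (m n : ℕ) (x : X) :
    birkhoff T φ (m + n) x = birkhoff T φ m x + birkhoff T φ n (T^[m] x) := by
  simp only [birkhoff, Finset.sum_range_add]
  congr 1
  refine Finset.sum_congr rfl fun i _ => ?_
  rw [← Function.iterate_add_apply, add_comm]

lemma birkhoff_le {X : Type*} (T : X → X) {φ : X → ℝ} {B : ℝ} (hB : ∀ x, φ x ≤ B) (n : ℕ) (x : X) :
    birkhoff T φ n x ≤ n * B := by
  refine (Finset.sum_le_sum fun i _ => hB _).trans ?_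
  simp

section Topology

variable [TopologicalSpace S] [DiscreteTopology S]

lemma continuous_coord (i : ℕ) : Continuous fun x : Space A => x.1 i :=
  (continuous_apply i).comp continuous_subtype_val

lemma isClopen_cylinder (w : List S) : IsClopen (cylinder A w) := by
  have : cylinder A w = ⋂ i : Fin w.length, (fun x : Space A => x.1 i) ⁻¹' {w.get i} := by
    ext x; simp [cylinder]
  rw [this]
  exact isClopen_iInter_of_finite fun i => (isClopen_discrete _).preimage (continuous_coord i)

lemma measurableSet_cylinder (w : List S) : MeasurableSet (cylinder A w) :=
  (isClopen_cylinder w).isOpen.measurableSet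

lemma continuous_shift : Continuous (shift A) :=
  Continuous.subtype_mk (continuous_pi fun i => continuous_coord (A := A) (i + 1)) _

lemma measurable_shift : Measurable (shift A) := continuous_shift.measurable

lemma measurable_iterate_shift (n : ℕ) : Measurable (shift A)^[n] := measurable_shift.iterate n

lemma exists_cylinder_subset {U : Set (Space A)} (hU : IsOpen U) {x : Space A} (hx : x ∈ U) :
    ∃ n, cylinder A (word x n) ⊆ U := by
  obtain ⟨V, hV, rfl⟩ := isOpen_induced_iff.1 hU
  obtain ⟨I, u, hu, hI⟩ := isOpen_pi_iff.1 hV x.1 hx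
  obtain ⟨n, hn⟩ := I.exists_nat_subset_range
  refine ⟨n, fun y hy => hI ?_⟩
  intro i hi
  rw [mem_cylinder_word_iff] at hy
  rw [hy i (Finset.mem_range.1 (hn hi))]
  exact (hu i hi).2

variable [Countable S]

lemma isEmbedding_val : IsEmbedding fun x : Space A => x.1 := IsEmbedding.subtypeVal

instance : SecondCountableTopology (Space A) := isEmbedding_val.secondCountableTopology

instance : TopologicalSpace.MetrizableSpace (Space A) := isEmbedding_val.metrizableSpace

lemma measurable_word (n : ℕ) (D : Set (List S)) :
    MeasurableSet {x : Space A | word x n ∈ D} := by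
  have : {x : Space A | word x n ∈ D} = ⋃ w ∈ D ∩ {w | w.length = n}, cylinder A w := by
    ext x
    simp only [mem_ofPred_eq, mem_inter_iff, mem_iUnion, exists_prop, mem_cylinder_iff_word]
    constructor
    · exact fun h => ⟨word x n, ⟨h, by simp⟩, by simp⟩
    · rintro ⟨w, ⟨h1, rfl⟩, h3⟩
      rwa [h3]
  rw [this]
  exact MeasurableSet.biUnion (to_countable _) fun w _ => measurableSet_cylinder w

lemma measure_word_mem (m : Measure (Space A)) (n : ℕ) (D : Set (List S)) :
    m {x : Space A | word x n ∈ D} =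
      ∑' w : ↥(D ∩ {w | w.length = n}), m (cylinder A (w : List S)) := by
  rw [← measure_biUnion (to_countable _)]
  · congr 1
    ext x
    simp only [mem_ofPred_eq, mem_inter_iff, mem_iUnion, exists_prop, mem_cylinder_iff_word]
    constructor
    · exact fun h => ⟨word x n, ⟨h, by simp⟩, by simp⟩
    · rintro ⟨w, ⟨h1, rfl⟩, h3⟩
      rwa [h3]
  · rintro u ⟨_, hu⟩ v ⟨_, hv⟩ huv
    exact disjoint_cylinder (hu.trans hv.symm) huv
  · exact fun w _ => measurableSet_cylinder w

/-- The points whose initial word of length `n` forces membership in `U`. -/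
def innerApprox (U : Set (Space A)) (n : ℕ) : Set (Space A) :=
  {x | word x n ∈ {w | cylinder A w ⊆ U}}

lemma monotone_innerApprox (U : Set (Space A)) : Monotone (innerApprox U) := by
  intro m n hmn x hx y hy
  apply hx
  rw [mem_cylinder_word_iff] at hy ⊢
  exact fun i hi => hy i (by omega)

lemma innerApprox_subset (U : Set (Space A)) (n : ℕ) : innerApprox U n ⊆ U :=
  fun x hx => hx (mem_cylinder_word x n)

lemma iUnion_innerApprox {U : Set (Space A)} (hU : IsOpen U) : ⋃ n, innerApprox U n = U := by
  apply Subset.antisymm (iUnion_subset fun n => innerApprox_subset U n)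
  intro x hx
  obtain ⟨n, hn⟩ := exists_cylinder_subset hU hx
  exact mem_iUnion.2 ⟨n, hn⟩

/-- A finite measure dominated on cylinders is dominated. -/
lemma measure_le_of_cylinder_le (m₁ m₂ : Measure (Space A)) [IsFiniteMeasure m₂]
    (h : ∀ w : List S, w ≠ [] → m₁ (cylinder A w) ≤ m₂ (cylinder A w)) : m₁ ≤ m₂ := by
  have h_univ : m₁ univ ≤ m₂ univ := by
    have e (m : Measure (Space A)) := measure_word_mem m 1 univ
    simp only [mem_univ, ofPred_true] at e
    rw [e, e]
    refine ENNReal.tsum_le_tsum fun w => h _ fun h0 => ?_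
    have := w.2.2
    rw [h0] at this
    simp at this
  have hopen (U : Set (Space A)) (hU : IsOpen U) : m₁ U ≤ m₂ U := by
    rw [← iUnion_innerApprox hU, (monotone_innerApprox U).measure_iUnion,
      (monotone_innerApprox U).measure_iUnion]
    refine iSup_mono fun n => ?_
    rw [innerApprox, measure_word_mem, measure_word_mem]
    refine ENNReal.tsum_le_tsum fun w => ?_
    rcases eq_or_ne (w : List S) [] with h0 | h0
    · rw [h0, cylinder_nil]
      exact h_univ
    · exact h _ h0
  refine Measure.le_iff'.2 fun s => ?_
  rw [s.measure_eq_iInf_isOpen m₂]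
  exact le_iInf₂ fun U hsU => le_iInf fun hU => (measure_mono hsU).trans (hopen U hU)

/-- Neighbourhoods of a probability measure given by finitely many cylinders. -/
def nbd (μ : ProbabilityMeasure (Space A)) (U : Finset (List S)) (ε : ℝ) :
    Set (ProbabilityMeasure (Space A)) :=
  {ν | ∀ u ∈ U, |(ν : Measure (Space A)).real (cylinder A u) -
    (μ : Measure (Space A)).real (cylinder A u)| < ε}

lemma continuous_real_cylinder (u : List S) :
    Continuous fun ν : ProbabilityMeasure (Space A) => (ν : Measure (Space A)).real (cylinder A u) := by
  rw [continuous_iff_continuousAt]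
  intro ν
  have := ProbabilityMeasure.tendsto_measure_of_isClopen_of_tendsto (tendsto_id (x := 𝓝 ν))
    (isClopen_cylinder (A := A) u)
  exact (NNReal.continuous_coe.tendsto _).comp this

lemma isOpen_nbd (μ : ProbabilityMeasure (Space A)) (U : Finset (List S)) (ε : ℝ) :
    IsOpen (nbd μ U ε) := by
  have : nbd μ U ε = ⋂ u ∈ U, {ν : ProbabilityMeasure (Space A) | |(ν : Measure (Space A)).real (cylinder A u) -
      (μ : Measure (Space A)).real (cylinder A u)| < ε} := by
    ext; simp [nbd]
  rw [this]
  exact isOpen_biInter_finset fun u _ =>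
    isOpen_lt ((continuous_real_cylinder u).sub continuous_const).abs continuous_const

lemma mem_nbd_self (μ : ProbabilityMeasure (Space A)) (U : Finset (List S)) {ε : ℝ} (hε : 0 < ε) :
    μ ∈ nbd μ U ε := fun u _ => by simpa using hε

lemma exists_nbd_subset {G : Set (ProbabilityMeasure (Space A))} (hG : IsOpen G)
    {μ : ProbabilityMeasure (Space A)} (hμ : μ ∈ G) :
    ∃ (U : Finset (List S)) (ε : ℝ), 0 < ε ∧ nbd μ U ε ⊆ G := by
  set F : ProbabilityMeasure (Space A) → List S → ℝ :=
    fun ν u => (ν : Measure (Space A)).real (cylinder A u) with hF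
  have ht : Tendsto id (comap F (𝓝 (F μ))) (𝓝 μ) := by
    have hpi : IsPiSystem (insert ∅ (range fun u : List S => cylinder A u)) := by
      have key (u v : List S) (hl : u.length ≤ v.length)
          (h : (cylinder A u ∩ cylinder A v).Nonempty) :
          cylinder A u ∩ cylinder A v = cylinder A v :=
        inter_eq_right.2 (cylinder_subset_of_inter hl h)
      apply IsPiSystem.insert_empty
      rintro _ ⟨u, rfl⟩ _ ⟨v, rfl⟩ h
      rcases le_total u.length v.length with hl | hl
      · exact ⟨v, (key u v hl h).symm⟩
      · rw [inter_comm] at h ⊢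
        exact ⟨u, (key v u hl h).symm⟩
    refine hpi.tendsto_probabilityMeasure_of_tendsto_of_mem ?_ ?_ ?_
    · rintro s (rfl | ⟨u, rfl⟩)
      · exact MeasurableSet.empty
      · exact measurableSet_cylinder u
    · intro U hU x hx
      obtain ⟨n, hn⟩ := exists_cylinder_subset hU hx
      exact ⟨_, Or.inr ⟨_, rfl⟩, (isClopen_cylinder _).isOpen.mem_nhds (mem_cylinder_word x n), hn⟩
    · rintro s (rfl | ⟨u, rfl⟩)
      · simpa using tendsto_const_nhds
      · have h1 : Tendsto (fun ν => F ν u) (comap F (𝓝 (F μ))) (𝓝 (F μ u)) :=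
          tendsto_pi_nhds.1 (tendsto_comap (f := F) (x := 𝓝 (F μ))) u
        rw [← NNReal.tendsto_coe]
        exact h1
  have h1 := ht (hG.mem_nhds hμ)
  rw [mem_map, mem_comap] at h1
  obtain ⟨V, hV, hVG⟩ := h1
  rw [nhds_pi, Filter.mem_pi'] at hV
  obtain ⟨I, t, ht, hI⟩ := hV
  have h2 : ∀ u, ∃ ε : ℝ, 0 < ε ∧ ∀ r, |r - F μ u| < ε → r ∈ t u := fun u =>
    Metric.mem_nhds_iff.1 (ht u)
  choose e he0 he using h2
  obtain ⟨ε, hε0, hε⟩ : ∃ ε : ℝ, 0 < ε ∧ ∀ u ∈ I, ε ≤ e u := by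
    rcases I.eq_empty_or_nonempty with rfl | hne
    · exact ⟨1, one_pos, by simp⟩
    · exact ⟨I.inf' hne e, by simpa using fun u _ => he0 u, fun u hu => Finset.inf'_le e hu⟩
  refine ⟨I, ε, hε0, fun ν hν => hVG (hI fun u hu => he u _ ?_)⟩
  exact (hν u hu).trans_le (hε u hu)

end Topology

/-! ### Empirical measures -/

section Empirical

lemma empirical_real_apply {X : Type*} [MeasurableSpace X] (T : X → X) (x : X) {n : ℕ} (hn : 1 ≤ n)
    {s : Set X} (hs : MeasurableSet s) :
    (empirical T x n : Measure X).real s =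
      (n : ℝ)⁻¹ * birkhoff T (s.indicator fun _ => 1) n x := by
  have : (empirical T x n : Measure X) =
    ((max n 1 : ℕ) : ℝ≥0∞)⁻¹ • ∑ i ∈ Finset.range (max n 1), Measure.dirac (T^[i] x) := rfl
  rw [this, max_eq_left hn, Measure.real, Measure.smul_apply, Measure.finsetSum_apply,
    smul_eq_mul, ENNReal.toReal_mul, ENNReal.toReal_sum (by intro i _; exact measure_ne_top _ _),
    birkhoff]
  congr 1
  · simp
  · refine Finset.sum_congr rfl fun i _ => ?_
    rw [Measure.dirac_apply' _ hs]
    by_cases h : T^[i] x ∈ s <;> simp [h]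

lemma continuous_empirical [TopologicalSpace S] [DiscreteTopology S] (n : ℕ) :
    Continuous fun x : Space A => empirical (shift A) x n := by
  rw [continuous_iff_continuousAt]
  intro x
  rw [ContinuousAt, ProbabilityMeasure.tendsto_iff_forall_integral_tendsto]
  intro f
  have h (y : Space A) : ∫ ω, f ω ∂(empirical (shift A) y n : Measure (Space A)) =
      ((max n 1 : ℕ) : ℝ)⁻¹ * ∑ i ∈ Finset.range (max n 1), f ((shift A)^[i] y) := by
    have : (empirical (shift A) y n : Measure (Space A)) = ((max n 1 : ℕ) : ℝ≥0∞)⁻¹ •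
      ∑ i ∈ Finset.range (max n 1), Measure.dirac ((shift A)^[i] y) := rfl
    rw [this, integral_smul_measure, integral_finsetSum_measure]
    · simp [integral_dirac' _ _ f.continuous.stronglyMeasurable]
    · intro i _
      exact f.integrable _
  simp_rw [h]
  refine Continuous.tendsto (f := fun y => ((max n 1 : ℕ) : ℝ)⁻¹ *
    ∑ i ∈ Finset.range (max n 1), f ((shift A)^[i] y)) ?_ x
  exact continuous_const.mul (continuous_finsetSum _ fun i _ =>
    f.continuous.comp (continuous_shift.iterate i))

end Empirical

end ShiftBasics

end CMS

namespace CMS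

section Gibbs

variable {S : Type*} [Countable S] [TopologicalSpace S] [DiscreteTopology S] {A : S → S → Prop}
  {φ : Space A → ℝ} {μ : Measure (Space A)} [IsProbabilityMeasure μ] {c₀ P : ℝ}

namespace IsGibbsWith

lemma real_cylinder_le (hG : IsGibbsWith A φ μ c₀ P) (hc : 1 ≤ c₀) {w : List S} {x : Space A}
    (hx : x ∈ cylinder A w) :
    μ.real (cylinder A w) ≤ c₀ * Real.exp (-(P * w.length) + birkhoff (shift A) φ w.length x) := by
  rcases eq_or_ne w [] with rfl | hw
  · simpa [birkhoff] using hc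
  · have := (hG w.length (List.length_pos_iff.2 hw) x).2
    rwa [mem_cylinder_iff_word.1 hx] at this

lemma exp_le (hG : IsGibbsWith A φ μ c₀ P) (hc : 1 ≤ c₀) {w : List S} {x : Space A}
    (hx : x ∈ cylinder A w) :
    Real.exp (-(P * w.length) + birkhoff (shift A) φ w.length x) ≤ c₀ * μ.real (cylinder A w) := by
  rcases eq_or_ne w [] with rfl | hw
  · simpa [birkhoff] using hc
  · have := (hG w.length (List.length_pos_iff.2 hw) x).1
    rwa [mem_cylinder_iff_word.1 hx, inv_mul_le_iff₀ (by linarith)] at this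

lemma real_cylinder_pos (hG : IsGibbsWith A φ μ c₀ P) (hc : 1 ≤ c₀) {w : List S} {x : Space A}
    (hx : x ∈ cylinder A w) : 0 < μ.real (cylinder A w) := by
  have := (Real.exp_pos _).trans_le (hG.exp_le hc hx)
  exact pos_of_mul_pos_right this (by linarith)

lemma birkhoff_le_log (hG : IsGibbsWith A φ μ c₀ P) (hc : 1 ≤ c₀) {w : List S} {x : Space A}
    (hx : x ∈ cylinder A w) : birkhoff (shift A) φ w.length x ≤
      Real.log (μ.real (cylinder A w)) + P * w.length + Real.log c₀ := by
  have h := Real.log_le_log (Real.exp_pos _) (hG.exp_le hc hx)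
  rw [Real.log_exp, Real.log_mul (by linarith) (hG.real_cylinder_pos hc hx).ne'] at h
  linarith

lemma log_le_birkhoff (hG : IsGibbsWith A φ μ c₀ P) (hc : 1 ≤ c₀) {w : List S} {x : Space A}
    (hx : x ∈ cylinder A w) : Real.log (μ.real (cylinder A w)) + P * w.length - Real.log c₀ ≤
      birkhoff (shift A) φ w.length x := by
  have h := Real.log_le_log (hG.real_cylinder_pos hc hx) (hG.real_cylinder_le hc hx)
  rw [Real.log_mul (by linarith) (Real.exp_pos _).ne', Real.log_exp] at h
  linarith

lemma potential_le (hG : IsGibbsWith A φ μ c₀ P) (hc : 1 ≤ c₀) (x : Space A) :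
    φ x ≤ P + Real.log c₀ := by
  have h := hG.birkhoff_le_log hc (mem_cylinder_word x 1)
  have h2 : Real.log (μ.real (cylinder A (word x 1))) ≤ 0 :=
    Real.log_nonpos measureReal_nonneg (measure_real_le_one _ _)
  simp [birkhoff] at h
  linarith

lemma real_cylinder_append_le (hG : IsGibbsWith A φ μ c₀ P) (hc : 1 ≤ c₀) (u v : List S) :
    μ.real (cylinder A (u ++ v)) ≤
      c₀ ^ 3 * (μ.real (cylinder A u) * μ.real (cylinder A v)) := by
  rcases (cylinder A (u ++ v)).eq_empty_or_nonempty with h | ⟨x, hx⟩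
  · rw [h]; simp; positivity
  obtain ⟨hu, hv⟩ := mem_cylinder_append.1 hx
  have h1 := hG.real_cylinder_le hc hx
  have h2 := hG.exp_le hc hu
  have h3 := hG.exp_le hc hv
  rw [List.length_append, birkhoff_add, show -(P * ((u.length + v.length : ℕ) : ℝ)) +
    (birkhoff (shift A) φ u.length x + birkhoff (shift A) φ v.length ((shift A)^[u.length] x)) =
    (-(P * u.length) + birkhoff (shift A) φ u.length x) +
    (-(P * v.length) + birkhoff (shift A) φ v.length ((shift A)^[u.length] x)) by push_cast; ring,
    Real.exp_add] at h1
  have h4 := mul_le_mul h2 h3 (Real.exp_pos _).le (by positivity)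
  calc _ ≤ _ := h1
    _ ≤ c₀ * (c₀ * μ.real (cylinder A u) * (c₀ * μ.real (cylinder A v))) := by gcongr
    _ = _ := by ring

lemma le_real_cylinder_append (hG : IsGibbsWith A φ μ c₀ P) (hc : 1 ≤ c₀) {u v : List S}
    (h : (cylinder A (u ++ v)).Nonempty) :
    μ.real (cylinder A u) * μ.real (cylinder A v) ≤
      c₀ ^ 3 * μ.real (cylinder A (u ++ v)) := by
  obtain ⟨x, hx⟩ := h
  obtain ⟨hu, hv⟩ := mem_cylinder_append.1 hx
  have h1 := hG.exp_le hc hx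
  have h2 := hG.real_cylinder_le hc hu
  have h3 := hG.real_cylinder_le hc hv
  rw [List.length_append, birkhoff_add, show -(P * ((u.length + v.length : ℕ) : ℝ)) +
    (birkhoff (shift A) φ u.length x + birkhoff (shift A) φ v.length ((shift A)^[u.length] x)) =
    (-(P * u.length) + birkhoff (shift A) φ u.length x) +
    (-(P * v.length) + birkhoff (shift A) φ v.length ((shift A)^[u.length] x)) by push_cast; ring,
    Real.exp_add] at h1
  have h4 := mul_le_mul h2 h3 measureReal_nonneg (by positivity)
  calc _ ≤ _ := h4
    _ = c₀ * c₀ * (Real.exp (-(P * u.length) + birkhoff (shift A) φ u.length x) *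
      Real.exp (-(P * v.length) +
        birkhoff (shift A) φ v.length ((shift A)^[u.length] x))) := by ring
    _ ≤ c₀ * c₀ * (c₀ * μ.real (cylinder A (u ++ v))) := by gcongr
    _ = _ := by ring

/-- Quasi-Bernoulli upper bound. -/
lemma map_restrict_le (hG : IsGibbsWith A φ μ c₀ P) (hc : 1 ≤ c₀) (u : List S) :
    Measure.map (shift A)^[u.length] (μ.restrict (cylinder A u)) ≤
      (ENNReal.ofReal (c₀ ^ 3) * μ (cylinder A u)) • μ := by
  have : IsFiniteMeasure ((ENNReal.ofReal (c₀ ^ 3) * μ (cylinder A u)) • μ) :=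
    μ.smul_finite (ENNReal.mul_ne_top ENNReal.ofReal_ne_top (measure_ne_top _ _))
  refine measure_le_of_cylinder_le _ _ fun v _ => ?_
  rw [Measure.map_apply (measurable_iterate_shift _) (measurableSet_cylinder v),
    Measure.restrict_apply (measurable_iterate_shift _ (measurableSet_cylinder v)),
    Measure.smul_apply, smul_eq_mul, inter_comm]
  have e : cylinder A u ∩ (shift A)^[u.length] ⁻¹' cylinder A v = cylinder A (u ++ v) := by
    ext x; exact mem_cylinder_append.symm
  have h := ENNReal.ofReal_le_ofReal (hG.real_cylinder_append_le hc u v)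
  rw [ENNReal.ofReal_mul (by positivity), ENNReal.ofReal_mul measureReal_nonneg,
    ofReal_measureReal, ofReal_measureReal, ofReal_measureReal] at h
  rwa [e, mul_assoc]

lemma measure_preimage_iterate_le (hG : IsGibbsWith A φ μ c₀ P) (hc : 1 ≤ c₀) (n : ℕ)
    {s : Set (Space A)} (hs : MeasurableSet s) :
    μ ((shift A)^[n] ⁻¹' s) ≤ ENNReal.ofReal (c₀ ^ 3) * μ s := by
  have hdisj : Pairwise (Function.onFun Disjoint
      fun w : {w : List S // w.length = n} => cylinder A (w : List S)) := by
    intro u v huv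
    exact disjoint_cylinder (u.2.trans v.2.symm) (fun h => huv (Subtype.ext h))
  have hcover : ⋃ w : {w : List S // w.length = n}, cylinder A (w : List S) = univ := by
    refine eq_univ_of_forall fun x => mem_iUnion.2 ⟨⟨word x n, length_word x n⟩, ?_⟩
    exact mem_cylinder_word x n
  have h1 : ∑' w : {w : List S // w.length = n}, μ (cylinder A (w : List S)) = 1 := by
    rw [← measure_iUnion hdisj fun w => measurableSet_cylinder _, hcover, measure_univ]
  calc μ ((shift A)^[n] ⁻¹' s)
      = μ (⋃ w : {w : List S // w.length = n},
          (shift A)^[n] ⁻¹' s ∩ cylinder A (w : List S)) := by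
        rw [← inter_iUnion, hcover, inter_univ]
    _ ≤ ∑' w : {w : List S // w.length = n}, μ ((shift A)^[n] ⁻¹' s ∩ cylinder A (w : List S)) :=
        measure_iUnion_le _
    _ ≤ ∑' w : {w : List S // w.length = n},
          ENNReal.ofReal (c₀ ^ 3) * μ (cylinder A (w : List S)) * μ s := by
        refine ENNReal.tsum_le_tsum fun w => ?_
        have h := hG.map_restrict_le hc (w : List S) s
        rw [Measure.map_apply (measurable_iterate_shift _) hs,
          Measure.restrict_apply (measurable_iterate_shift _ hs), w.2] at h
        exact h
    _ = _ := by
        rw [ENNReal.tsum_mul_right, ENNReal.tsum_mul_left, h1, mul_one]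

/-- Quasi-Bernoulli lower bound. -/
lemma exists_le_sum (hG : IsGibbsWith A φ μ c₀ P) (hc : 1 ≤ c₀) (hA : NoZeroRowCol A)
    {Λ : Finset (List S)} (hΛ : ∀ v w : List S, Admissible A v → Admissible A w →
      ∃ l ∈ Λ, Admissible A (v ++ l ++ w)) :
    ∃ κ : ℝ, 0 < κ ∧ ∀ w : List S, Admissible A w → ∀ s : Set (Space A), MeasurableSet s →
      ENNReal.ofReal κ * μ (cylinder A w) * μ s ≤
        ∑ l ∈ Λ, μ (cylinder A (w ++ l) ∩ (shift A)^[(w ++ l).length] ⁻¹' s) := by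
  obtain ⟨d, hd0, hd⟩ : ∃ d : ℝ, 0 < d ∧ ∀ l ∈ Λ, (cylinder A l).Nonempty →
      d ≤ μ.real (cylinder A l) := by
    classical
    rcases (Λ.filter fun l => (cylinder A l).Nonempty).eq_empty_or_nonempty with h | h
    · refine ⟨1, one_pos, fun l hl hne => ?_⟩
      have : l ∈ Λ.filter fun l => (cylinder A l).Nonempty := Finset.mem_filter.2 ⟨hl, hne⟩
      rw [h] at this
      simp at this
    · refine ⟨(Λ.filter fun l => (cylinder A l).Nonempty).inf' h fun l => μ.real (cylinder A l),
        ?_, fun l hl hne => Finset.inf'_le _ (Finset.mem_filter.2 ⟨hl, hne⟩)⟩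
      rw [Finset.lt_inf'_iff]
      intro l hl
      obtain ⟨x, hx⟩ := (Finset.mem_filter.1 hl).2
      exact hG.real_cylinder_pos hc hx
  refine ⟨(c₀ ^ 6)⁻¹ * d, by positivity, fun w hw s hs => ?_⟩
  have hle : (ENNReal.ofReal ((c₀ ^ 6)⁻¹ * d) * μ (cylinder A w)) • μ ≤
      ∑ l ∈ Λ, Measure.map (shift A)^[(w ++ l).length] (μ.restrict (cylinder A (w ++ l))) := by
    refine measure_le_of_cylinder_le _ _ fun v hv => ?_
    rw [Measure.smul_apply, smul_eq_mul, Measure.finsetSum_apply]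
    by_cases hva : Admissible A v
    · obtain ⟨l, hl, hadm⟩ := hΛ w v hw hva
      have hne := hA.cylinder_nonempty hadm
      have hne' : (cylinder A (w ++ l)).Nonempty := hne.mono (cylinder_append_subset _ _)
      have hnel : (cylinder A l).Nonempty := by
        obtain ⟨x, hx⟩ := hne'
        exact ⟨_, (mem_cylinder_append.1 hx).2⟩
      refine le_trans ?_ (Finset.single_le_sum (f := fun l => Measure.map
        (shift A)^[(w ++ l).length] (μ.restrict (cylinder A (w ++ l))) (cylinder A v))
        (fun _ _ => zero_le) hl)
      change _ ≤ Measure.map _ _ _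
      rw [Measure.map_apply (measurable_iterate_shift _) (measurableSet_cylinder v),
        Measure.restrict_apply (measurable_iterate_shift _ (measurableSet_cylinder v)), inter_comm]
      have e : cylinder A (w ++ l) ∩ (shift A)^[(w ++ l).length] ⁻¹' cylinder A v =
          cylinder A (w ++ l ++ v) := by
        ext x; exact mem_cylinder_append.symm
      rw [e, ← ofReal_measureReal (μ := μ) (s := cylinder A w),
        ← ofReal_measureReal (μ := μ) (s := cylinder A v),
        ← ENNReal.ofReal_mul (by positivity), ← ENNReal.ofReal_mul (by positivity),
        ← ofReal_measureReal]
      apply ENNReal.ofReal_le_ofReal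
      have h1 := hG.le_real_cylinder_append hc hne
      have h2 := hG.le_real_cylinder_append hc hne'
      rw [mul_assoc, mul_assoc, inv_mul_le_iff₀ (by positivity)]
      have h3 := hd l hl hnel
      calc d * (μ.real (cylinder A w) * μ.real (cylinder A v))
          ≤ μ.real (cylinder A l) * (μ.real (cylinder A w) * μ.real (cylinder A v)) := by gcongr
        _ = μ.real (cylinder A w) * μ.real (cylinder A l) * μ.real (cylinder A v) := by ring
        _ ≤ c₀ ^ 3 * μ.real (cylinder A (w ++ l)) * μ.real (cylinder A v) := by gcongr
        _ = c₀ ^ 3 * (μ.real (cylinder A (w ++ l)) * μ.real (cylinder A v)) := by ring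
        _ ≤ c₀ ^ 3 * (c₀ ^ 3 * μ.real (cylinder A (w ++ l ++ v))) := by gcongr
        _ = _ := by ring
    · have : cylinder A v = ∅ := by
        by_contra h
        obtain ⟨x, hx⟩ := nonempty_iff_ne_empty.2 h
        exact hva (admissible_of_mem hv hx)
      rw [this]
      simp
  have := hle s
  rw [Measure.smul_apply, smul_eq_mul, Measure.finsetSum_apply] at this
  refine this.trans (le_of_eq (Finset.sum_congr rfl fun l _ => ?_))
  rw [Measure.map_apply (measurable_iterate_shift _) hs,
    Measure.restrict_apply (measurable_iterate_shift _ hs), inter_comm]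

end IsGibbsWith

end Gibbs

end CMS

namespace CMS

section Tightness

variable {S : Type*} [Countable S] [TopologicalSpace S] [DiscreteTopology S] {A : S → S → Prop}
  {φ : Space A → ℝ} {μ : Measure (Space A)} [IsProbabilityMeasure μ] {c₀ P : ℝ}

lemma measurable_comp_coord {β : Type*} [MeasurableSpace β] (g : S → β) (i : ℕ) :
    Measurable fun x : Space A => g (x.1 i) := by
  borelize S
  exact (measurable_of_countable g).comp (continuous_coord i).measurable

lemma mem_cylinder_singleton {a : S} {x : Space A} : x ∈ cylinder A [a] ↔ x.1 0 = a := by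
  rw [mem_cylinder]
  constructor
  · intro h; exact h 0 (by simp)
  · intro h i hi
    obtain rfl : i = 0 := by simpa using hi
    exact h

namespace IsGibbsWith

lemma lintegral_prod_le (hG : IsGibbsWith A φ μ c₀ P) (hc : 1 ≤ c₀) (g : S → ℝ≥0∞) (n : ℕ) :
    ∫⁻ x, ∏ i ∈ Finset.range n, g (x.1 i) ∂μ ≤
      (ENNReal.ofReal (c₀ ^ 3) * ∫⁻ x, g (x.1 0) ∂μ) ^ n := by
  have hdisj : Pairwise (Function.onFun Disjoint fun a : S => cylinder A [a]) :=
    fun a b hab => disjoint_cylinder rfl fun h => hab (by simpa using h)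
  have hcover : ⋃ a : S, cylinder A [a] = univ :=
    eq_univ_of_forall fun x => mem_iUnion.2 ⟨x.1 0, mem_cylinder_singleton.2 rfl⟩
  have split (f : Space A → ℝ≥0∞) : ∫⁻ x, f x ∂μ = ∑' a, ∫⁻ x in cylinder A [a], f x ∂μ := by
    rw [← lintegral_iUnion (fun a => measurableSet_cylinder _) hdisj, hcover, Measure.restrict_univ]
  induction n with
  | zero => simp
  | succ n ih =>
    have hm (n : ℕ) : Measurable fun x : Space A => ∏ i ∈ Finset.range n, g (x.1 i) :=
      Finset.measurable_prod _ fun i _ => measurable_comp_coord g i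
    have h0 : ∫⁻ x, g (x.1 0) ∂μ = ∑' a, g a * μ (cylinder A [a]) := by
      rw [split]
      refine tsum_congr fun a => ?_
      rw [setLIntegral_congr_fun (g := fun _ => g a) (measurableSet_cylinder _)
        fun x hx => by rw [mem_cylinder_singleton.1 hx], setLIntegral_const]
    rw [split]
    calc ∑' a, ∫⁻ x in cylinder A [a], ∏ i ∈ Finset.range (n + 1), g (x.1 i) ∂μ
        ≤ ∑' a, g a * μ (cylinder A [a]) * (ENNReal.ofReal (c₀ ^ 3) *
          ∫⁻ x, ∏ i ∈ Finset.range n, g (x.1 i) ∂μ) := by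
          refine ENNReal.tsum_le_tsum fun a => ?_
          rw [setLIntegral_congr_fun (g := fun x => g a *
            ∏ i ∈ Finset.range n, g ((shift A x).1 i)) (measurableSet_cylinder _)
            fun x hx => by
              rw [Finset.prod_range_succ', mem_cylinder_singleton.1 hx, mul_comm]; rfl,
            lintegral_const_mul (f := fun x => ∏ i ∈ Finset.range n, g ((shift A x).1 i)) _
              ((hm n).comp measurable_shift),
            ← lintegral_map (f := fun x : Space A => ∏ i ∈ Finset.range n, g (x.1 i)) (hm n)
              measurable_shift, mul_assoc]
          gcongr
          refine (lintegral_mono' (hG.map_restrict_le hc [a]) le_rfl).trans (le_of_eq ?_)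
          rw [lintegral_smul_measure, smul_eq_mul]
          ring
      _ = (∑' a, g a * μ (cylinder A [a])) * (ENNReal.ofReal (c₀ ^ 3) *
          ∫⁻ x, ∏ i ∈ Finset.range n, g (x.1 i) ∂μ) := by rw [ENNReal.tsum_mul_right]
      _ ≤ (∑' a, g a * μ (cylinder A [a])) * (ENNReal.ofReal (c₀ ^ 3) *
          (ENNReal.ofReal (c₀ ^ 3) * ∫⁻ x, g (x.1 0) ∂μ) ^ n) := by gcongr
      _ = _ := by rw [← h0]; ring

end IsGibbsWith

lemma exists_finset_letter_le (μ : Measure (Space A)) [IsProbabilityMeasure μ] {δ : ℝ≥0∞}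
    (hδ : 0 < δ) : ∃ F : Finset S, μ {x | x.1 0 ∉ F} ≤ δ := by
  have hdisj : Pairwise (Function.onFun Disjoint fun a : S => cylinder A [a]) :=
    fun a b hab => disjoint_cylinder rfl fun h => hab (by simpa using h)
  have hne : ∑' a : S, μ (cylinder A [a]) ≠ ⊤ := by
    rw [← measure_iUnion hdisj fun a => measurableSet_cylinder _]
    exact measure_ne_top _ _
  obtain ⟨F, hF⟩ := ((ENNReal.tendsto_tsum_compl_atTop_zero hne).eventually_le_const hδ).exists
  refine ⟨F, le_trans ?_ hF⟩
  refine le_trans (measure_mono ?_) (measure_iUnion_le fun a : {a // a ∉ F} => cylinder A [(a : S)])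
  intro x hx
  exact mem_iUnion.2 ⟨⟨x.1 0, hx⟩, mem_cylinder_singleton.2 rfl⟩

namespace IsGibbsWith

lemma exists_finset_birkhoff_le (hG : IsGibbsWith A φ μ c₀ P) (hc : 1 ≤ c₀) {η : ℝ} (hη : 0 < η)
    (L : ℝ) : ∃ F : Finset S, ∀ n : ℕ, 1 ≤ n → ∀ j : ℕ,
      μ {x | η < (empirical (shift A) x n : Measure (Space A)).real {y | y.1 j ∉ F}} ≤
        ENNReal.ofReal (c₀ ^ 3 * Real.exp (-(n * L))) := by
  classical
  have hc3 : 0 < c₀ ^ 3 := by positivity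
  set θ : ℝ := (Real.log (2 * c₀ ^ 3) + L) / η with hθ
  obtain ⟨F, hF⟩ := exists_finset_letter_le μ (δ := ENNReal.ofReal (Real.exp (-θ)))
    (ENNReal.ofReal_pos.2 (Real.exp_pos _))
  refine ⟨F, fun n hn j => ?_⟩
  have hn0 : (0 : ℝ) < n := by exact_mod_cast hn
  have hE (j : ℕ) : MeasurableSet {y : Space A | y.1 j ∉ F} :=
    measurable_comp_coord (fun a => a ∉ F) j (measurableSet_singleton True) |>.congr (by ext; simp)
  set f : S → ℝ := fun a => if a ∈ F then 0 else 1 with hf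
  set g : S → ℝ≥0∞ := fun a => ENNReal.ofReal (Real.exp (θ * f a)) with hg
  have hsum (x : Space A) : birkhoff (shift A) ({y : Space A | y.1 j ∉ F}.indicator fun _ => 1) n x =
      ∑ i ∈ Finset.range n, f (((shift A)^[j] x).1 i) := by
    refine Finset.sum_congr rfl fun i _ => ?_
    simp only [indicator, mem_ofPred_eq, iterate_shift_apply, hf, add_comm i j]
    split_ifs <;> simp_all
  have hInt : ∫⁻ x, g (x.1 0) ∂μ ≤ 2 := by
    calc ∫⁻ x, g (x.1 0) ∂μ
        ≤ ∫⁻ x, (1 + {x : Space A | x.1 0 ∉ F}.indicator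
          (fun _ => ENNReal.ofReal (Real.exp θ)) x) ∂μ := by
          refine lintegral_mono fun x => ?_
          by_cases h : x.1 0 ∈ F <;> simp [hg, hf, h, indicator]
      _ = 1 + ENNReal.ofReal (Real.exp θ) * μ {x : Space A | x.1 0 ∉ F} := by
          rw [lintegral_add_left measurable_const, lintegral_indicator (hE 0)]
          simp
      _ ≤ 1 + ENNReal.ofReal (Real.exp θ) * ENNReal.ofReal (Real.exp (-θ)) := by gcongr
      _ = 2 := by
          rw [← ENNReal.ofReal_mul (Real.exp_pos _).le, ← Real.exp_add]
          simp [one_add_one_eq_two]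
  set V : Set (Space A) := {x | η * n < ∑ i ∈ Finset.range n, f (x.1 i)} with hV
  have hVm : MeasurableSet V := measurableSet_lt measurable_const
    (Finset.measurable_sum _ fun i _ => measurable_comp_coord f i)
  have hVle : μ V ≤ ENNReal.ofReal (Real.exp (-(n * L))) := by
    rcases le_or_gt θ 0 with hθ0 | hθ0
    · have : Real.log (2 * c₀ ^ 3) + L ≤ 0 := by
        by_contra h
        have : 0 < θ := by rw [hθ]; apply div_pos <;> linarith
        linarith
      have h1 : 0 ≤ Real.log (2 * c₀ ^ 3) :=
        Real.log_nonneg (by linarith [one_le_pow₀ hc (n := 3)])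
      refine prob_le_one.trans ?_
      rw [← ENNReal.ofReal_one]
      apply ENNReal.ofReal_le_ofReal
      rw [Real.one_le_exp_iff]
      nlinarith
    have hm : Measurable fun x : Space A => ∏ i ∈ Finset.range n, g (x.1 i) :=
      Finset.measurable_prod _ fun i _ => measurable_comp_coord g i
    have h1 := mul_meas_ge_le_lintegral (μ := μ) hm (ENNReal.ofReal (Real.exp (θ * (η * n))))
    have h2 : μ V ≤ μ {x | ENNReal.ofReal (Real.exp (θ * (η * n))) ≤
        ∏ i ∈ Finset.range n, g (x.1 i)} := by
      refine measure_mono fun x hx => ?_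
      rw [mem_ofPred_eq, ← ENNReal.ofReal_prod_of_nonneg fun i _ => (Real.exp_pos _).le,
        ← Real.exp_sum, ← Finset.mul_sum]
      exact ENNReal.ofReal_le_ofReal (Real.exp_le_exp.2 (by gcongr; exact le_of_lt hx))
    have h3 : ENNReal.ofReal (Real.exp (θ * (η * n))) * μ V ≤
        ENNReal.ofReal ((2 * c₀ ^ 3) ^ n) := by
      refine (mul_le_mul_right h2 _).trans (h1.trans ((hG.lintegral_prod_le hc g n).trans ?_))
      rw [ENNReal.ofReal_pow (by positivity) n, mul_comm (2 : ℝ), ENNReal.ofReal_mul hc3.le,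
        ENNReal.ofReal_ofNat]
      gcongr
    have h4 : θ * (η * n) = n * (Real.log (2 * c₀ ^ 3) + L) := by
      rw [hθ]; field_simp
    calc μ V = ENNReal.ofReal (Real.exp (-(θ * (η * n)))) *
          (ENNReal.ofReal (Real.exp (θ * (η * n))) * μ V) := by
          rw [← mul_assoc, ← ENNReal.ofReal_mul (Real.exp_pos _).le, ← Real.exp_add]
          simp
      _ ≤ ENNReal.ofReal (Real.exp (-(θ * (η * n)))) * ENNReal.ofReal ((2 * c₀ ^ 3) ^ n) := by
          gcongr
      _ = _ := by
          rw [← ENNReal.ofReal_mul (Real.exp_pos _).le, h4]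
          congr 1
          rw [← Real.exp_log (show 0 < 2 * c₀ ^ 3 by positivity), ← Real.exp_nat_mul,
            ← Real.exp_add, Real.log_exp]
          congr 1
          ring
  have hsub : {x | η < (empirical (shift A) x n : Measure (Space A)).real {y | y.1 j ∉ F}} ⊆
      (shift A)^[j] ⁻¹' V := by
    intro x hx
    rw [mem_ofPred_eq, empirical_real_apply _ _ hn (hE j), hsum, lt_inv_mul_iff₀ hn0] at hx
    rw [mem_preimage, hV, mem_ofPred_eq, mul_comm]
    exact hx
  refine (measure_mono hsub).trans ((hG.measure_preimage_iterate_le hc j hVm).trans ?_)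
  rw [ENNReal.ofReal_mul hc3.le]
  gcongr

lemma exists_isCompact (hG : IsGibbsWith A φ μ c₀ P) (hc : 1 ≤ c₀) (L : ℝ) :
    ∃ K : Set (ProbabilityMeasure (Space A)), IsCompact K ∧ ∀ n : ℕ, 1 ≤ n →
      μ {x | empirical (shift A) x n ∉ K} ≤ ENNReal.ofReal (c₀ ^ 3 * Real.exp (-(n * L))) := by
  have hη (e : ℕ) : (0 : ℝ) < (1 / 2) ^ (e.unpair.1 + e.unpair.2) := by positivity
  choose F hF using fun e : ℕ => hG.exists_finset_birkhoff_le hc (hη e)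
    (L + (e + 1) * Real.log 2)
  set Kl : ℕ → Set (Space A) := fun l => {x | ∀ j, x.1 j ∈ F (Nat.pair l j)} with hKl
  have hKlc (l : ℕ) : IsCompact (Kl l) := by
    have hcl : IsClosed {x : ℕ → S | ∀ i, A (x i) (x (i + 1))} := by
      have : {x : ℕ → S | ∀ i, A (x i) (x (i + 1))} =
          ⋂ i, (fun x : ℕ → S => (x i, x (i + 1))) ⁻¹' {p | A p.1 p.2} := by
        ext; simp
      rw [this]
      exact isClosed_iInter fun i => (isClosed_discrete _).preimage
        ((continuous_apply i).prodMk (continuous_apply (i + 1)))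
    have he : IsClosedEmbedding fun x : Space A => x.1 := hcl.isClosedEmbedding_subtypeVal
    have := he.isCompact_preimage (isCompact_univ_pi fun j =>
      ((F (Nat.pair l j)).finite_toSet.isCompact))
    convert this using 1
    ext x; simp [hKl]
  set u : ℕ → ℝ≥0 := fun l => 2 * (1 / 2) ^ l with hu
  have hu0 : Tendsto u atTop (𝓝 0) := by
    have := (tendsto_pow_atTop_nhds_zero_of_lt_one (zero_le) (show (1 / 2 : ℝ≥0) < 1 by
      exact one_half_lt_one)).const_mul (2 : ℝ≥0)
    rwa [mul_zero] at this
  refine ⟨_, isCompact_setOfPred_probabilityMeasure_mass_eq_compl_isCompact_le hu0 hKlc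
    (Or.inl inferInstance), fun n hn => ?_⟩
  set B : ℕ → Set (Space A) := fun e => {x | (1 / 2 : ℝ) ^ (e.unpair.1 + e.unpair.2) <
    (empirical (shift A) x n : Measure (Space A)).real {y | y.1 e.unpair.2 ∉ F e}} with hB
  have hsub : {x | empirical (shift A) x n ∉
      {ν : ProbabilityMeasure (Space A) | ∀ l, ν (Kl l)ᶜ ≤ u l}} ⊆ ⋃ e, B e := by
    intro x hx
    by_contra hcon
    apply hx
    intro l
    have hb (j : ℕ) : (empirical (shift A) x n : Measure (Space A))
        {y | y.1 j ∉ F (Nat.pair l j)} ≤ ENNReal.ofReal ((1 / 2 : ℝ) ^ (l + j)) := by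
      have h1 : x ∉ B (Nat.pair l j) := fun h => hcon (mem_iUnion.2 ⟨_, h⟩)
      simp only [hB, mem_ofPred_eq, Nat.unpair_pair, not_lt] at h1
      rw [← ofReal_measureReal]
      exact ENNReal.ofReal_le_ofReal h1
    have h2 : (empirical (shift A) x n : Measure (Space A)) (Kl l)ᶜ ≤ (u l : ℝ≥0∞) := by
      have : (Kl l)ᶜ = ⋃ j, {y : Space A | y.1 j ∉ F (Nat.pair l j)} := by
        ext y; simp [hKl]
      rw [this]
      refine (measure_iUnion_le _).trans ((ENNReal.tsum_le_tsum hb).trans ?_)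
      rw [← ENNReal.ofReal_tsum_of_nonneg (fun j => by positivity)]
      · simp only [pow_add]
        rw [tsum_mul_left, tsum_geometric_two, hu, mul_comm]
        apply le_of_eq
        rw [ENNReal.ofReal_mul (by norm_num), ENNReal.ofReal_pow (by norm_num)]
        push_cast
        rw [ENNReal.ofReal_div_of_pos (by norm_num)]
        simp
      · simp only [pow_add]
        exact summable_geometric_two.mul_left _
    have h3 : ((empirical (shift A) x n (Kl l)ᶜ : ℝ≥0) : ℝ≥0∞) ≤ (u l : ℝ≥0∞) := by
      rwa [ProbabilityMeasure.ennreal_coeFn_eq_coeFn_toMeasure]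
    exact_mod_cast h3
  refine (measure_mono hsub).trans ((measure_iUnion_le _).trans ?_)
  have hb (e : ℕ) : μ (B e) ≤
      ENNReal.ofReal (c₀ ^ 3 * Real.exp (-(n * L)) * ((1 / 2) * (1 / 2) ^ e)) := by
    refine (hF e n hn _).trans (ENNReal.ofReal_le_ofReal ?_)
    rw [mul_assoc]
    gcongr
    have : (1 / 2 : ℝ) * (1 / 2) ^ e = Real.exp (-((e + 1) * Real.log 2)) := by
      rw [← pow_succ', ← Real.exp_log (show (0 : ℝ) < 1 / 2 by norm_num), ← Real.exp_nat_mul,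
        one_div, Real.log_inv]
      congr 1
      push_cast
      ring
    rw [this, ← Real.exp_add, Real.exp_le_exp]
    have h1 : (1 : ℝ) ≤ n := by exact_mod_cast hn
    have h2 : 0 ≤ (e + 1) * Real.log 2 := by positivity
    nlinarith
  refine (ENNReal.tsum_le_tsum hb).trans ?_
  rw [← ENNReal.ofReal_tsum_of_nonneg (fun j => by positivity)
    ((summable_geometric_two.mul_left _).mul_left _), tsum_mul_left, tsum_mul_left,
    tsum_geometric_two]
  norm_num

end IsGibbsWith

end Tightness

end CMS

namespace CMS

section FreeEnergy

variable {X : Type*} [MeasurableSpace X] {T : X → X} {φ : X → ℝ} {P : ℝ}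

lemma integrable_of_integralGtBot (hφ : Measurable φ) {D : ℝ} (hD : ∀ x, φ x ≤ D)
    {ν : Measure X} [IsFiniteMeasure ν] (h : IntegralGtBot φ ν) : Integrable φ ν := by
  have h1 : Integrable (fun x => max (-φ x) 0) ν := by
    refine ⟨(hφ.neg.max measurable_const).aestronglyMeasurable, ?_⟩
    rw [hasFiniteIntegral_iff_ofReal (ae_of_all _ fun x => (le_max_right (-φ x) 0 : (0 : ℝ) ≤ _))]
    refine lt_of_eq_of_lt ?_ (lt_top_iff_ne_top.2 h)
    refine lintegral_congr fun x => ?_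
    rcases le_total (-φ x) 0 with h | h
    · rw [max_eq_right h, ENNReal.ofReal_of_nonpos h, ENNReal.ofReal_zero]
    · rw [max_eq_left h]
  refine Integrable.mono' (h1.add (integrable_const (|D|))) hφ.aestronglyMeasurable
    (ae_of_all _ fun x => ?_)
  rw [Real.norm_eq_abs, abs_le, Pi.add_apply]
  have h2 := le_max_left (-φ x) 0
  have h3 := le_max_right (-φ x) 0
  have h4 := le_abs_self D
  have h5 := abs_nonneg D
  exact ⟨by linarith, by linarith [hD x]⟩

lemma integralGtBot_of_integrable {ν : Measure X} (h : Integrable φ ν) : IntegralGtBot φ ν := by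
  refine ne_top_of_le_ne_top h.2.ne (lintegral_mono fun x => ?_)
  rw [← ofReal_norm, Real.norm_eq_abs]
  exact ENNReal.ofReal_le_ofReal (neg_le_abs _)

lemma eintegral_eq {ν : Measure X} (h : Integrable φ ν) : eintegral φ ν = ((∫ x, φ x ∂ν : ℝ) : EReal) := by
  have h1 : ∫⁻ x, ENNReal.ofReal (φ x) ∂ν ≠ ⊤ :=
    ne_top_of_le_ne_top h.2.ne (lintegral_mono fun x => by
      rw [← ofReal_norm, Real.norm_eq_abs]
      exact ENNReal.ofReal_le_ofReal (le_abs_self _))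
  have h2 : ∫⁻ x, ENNReal.ofReal (-φ x) ∂ν ≠ ⊤ := integralGtBot_of_integrable h
  rw [eintegral, integral_eq_lintegral_pos_part_sub_lintegral_neg_part h, EReal.coe_sub,
    EReal.coe_ennreal_toReal h1, EReal.coe_ennreal_toReal h2]

lemma le_freeEnergy {ν : ProbabilityMeasure X} (hinv : Invariant T (ν : Measure X))
    (hInt : Integrable φ (ν : Measure X)) {h r : ℝ} (hh : ENNReal.ofReal h ≤ entropy T (ν : Measure X))
    (hr : r ≤ ∫ x, φ x ∂(ν : Measure X)) : ((h + r - P : ℝ) : EReal) ≤ freeEnergy T φ P ν := by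
  rw [freeEnergy, if_pos ⟨hinv, integralGtBot_of_integrable hInt⟩, eintegral_eq hInt, EReal.coe_sub,
    EReal.coe_add]
  have h1 : ((h : ℝ) : EReal) ≤ ((entropy T (ν : Measure X) : ℝ≥0∞) : EReal) :=
    le_trans (EReal.coe_le_coe_iff.2 (Real.le_coe_toNNReal h)) (EReal.coe_ennreal_le_coe_ennreal_iff.2 hh)
  exact EReal.sub_le_sub (add_le_add h1 (EReal.coe_le_coe_iff.2 hr)) le_rfl

end FreeEnergy

section Blocks

variable {S : Type*} {A : S → S → Prop} {ι : Type*}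

/-- The concatenation of a sequence of blocks of length `N`. -/
def concatSeq (b : ι → List S) (a : S) (N : ℕ) (ω : ℕ → ι) : ℕ → S :=
  fun t => (b (ω (t / N))).getD (t % N) a

lemma concatSeq_rel {b : ι → List S} {a : S} {N : ℕ} (hN : 1 ≤ N) (hlen : ∀ i, (b i).length = N)
    (hadm : ∀ i, Admissible A (b i ++ [a])) (hhead : ∀ i, (b i).getD 0 a = a) (ω : ℕ → ι) (t : ℕ) :
    A (concatSeq b a N ω t) (concatSeq b a N ω (t + 1)) := by
  have key (i : ι) (s : ℕ) (hs : s < N) : A ((b i).getD s a) ((b i).getD (s + 1) a) := by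
    have h1 := List.isChain_iff_getElem.1 (show List.IsChain A (b i ++ [a]) from (hadm i).2) s
      (by simp [hlen]; omega)
    rw [List.getElem_append_left (by rw [hlen]; exact hs)] at h1
    rw [List.getD_eq_getElem _ _ (by rw [hlen]; exact hs)]
    rcases Nat.lt_or_ge (s + 1) N with h | h
    · rw [List.getElem_append_left (by rw [hlen]; exact h)] at h1
      rwa [List.getD_eq_getElem _ _ (by rw [hlen]; exact h)]
    · rw [List.getElem_append_right (by rw [hlen]; exact h)] at h1
      rw [List.getD_eq_default _ _ (by rw [hlen]; exact h)]
      simpa using h1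
  have hk := key (ω (t / N)) (t % N) (Nat.mod_lt _ hN)
  have e := Nat.div_add_mod t N
  rcases Nat.lt_or_ge (t % N + 1) N with h | h
  · have h1 : (t + 1) / N = t / N := by
      conv_lhs => rw [← e, add_assoc, Nat.mul_add_div hN, Nat.div_eq_of_lt h, add_zero]
    have h2 : (t + 1) % N = t % N + 1 := by
      have := Nat.div_add_mod (t + 1) N
      rw [h1] at this
      omega
    simp only [concatSeq, h1, h2]
    exact hk
  · have h0 : t % N + 1 = N := le_antisymm (Nat.mod_lt _ hN) h
    have e' : t + 1 = N * (t / N + 1) := by rw [Nat.mul_add, mul_one]; omega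
    have h1 : (t + 1) / N = t / N + 1 := by rw [e', Nat.mul_div_cancel_left _ hN]
    have h2 : (t + 1) % N = 0 := by rw [e', Nat.mul_mod_right]
    simp only [concatSeq, h1, h2, hhead]
    rwa [h0, List.getD_eq_default (n := N) _ _ (by rw [hlen])] at hk

lemma birkhoff_indicator_nonneg {X : Type*} (T : X → X) (s : Set X) (n : ℕ) (x : X) :
    0 ≤ birkhoff T (s.indicator fun _ => 1) n x :=
  Finset.sum_nonneg fun i _ => indicator_nonneg (fun _ _ => zero_le_one) _

lemma birkhoff_indicator_le {X : Type*} (T : X → X) (s : Set X) (n : ℕ) (x : X) :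
    birkhoff T (s.indicator fun _ => 1) n x ≤ n := by
  have := birkhoff_le T (φ := s.indicator fun _ => 1) (B := 1)
    (fun x => indicator_le_self' (fun _ _ => zero_le_one) x |>.trans le_rfl) n x
  simpa using this

lemma abs_birkhoff_indicator_sub_le {u : List S} {n : ℕ} {x y : Space A}
    (h : ∀ i < n, x.1 i = y.1 i) :
    |birkhoff (shift A) ((cylinder A u).indicator fun _ => 1) n x -
      birkhoff (shift A) ((cylinder A u).indicator fun _ => 1) n y| ≤ u.length := by
  rcases le_total n u.length with hn | hn
  · have h1 := birkhoff_indicator_nonneg (shift A) (cylinder A u) n x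
    have h2 := birkhoff_indicator_nonneg (shift A) (cylinder A u) n y
    have h3 := birkhoff_indicator_le (shift A) (cylinder A u) n x
    have h4 := birkhoff_indicator_le (shift A) (cylinder A u) n y
    have h5 : (n : ℝ) ≤ u.length := by exact_mod_cast hn
    rw [abs_le]; constructor <;> linarith
  · obtain ⟨m, rfl⟩ : ∃ m, n = m + u.length := ⟨n - u.length, by omega⟩
    rw [birkhoff_add, birkhoff_add]
    have e : birkhoff (shift A) ((cylinder A u).indicator fun _ => 1) m x =
        birkhoff (shift A) ((cylinder A u).indicator fun _ => (1 : ℝ)) m y := by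
      refine Finset.sum_congr rfl fun i hi => ?_
      have hi := Finset.mem_range.1 hi
      have : (shift A)^[i] x ∈ cylinder A u ↔ (shift A)^[i] y ∈ cylinder A u := by
        rw [mem_cylinder, mem_cylinder]
        refine forall₂_congr fun j hj => ?_
        rw [iterate_shift_apply, iterate_shift_apply, h _ (by omega)]
      by_cases hx : (shift A)^[i] x ∈ cylinder A u
      · rw [indicator_of_mem hx, indicator_of_mem (this.1 hx)]
      · rw [indicator_of_notMem hx, indicator_of_notMem (fun h => hx (this.2 h))]
    have h1 := birkhoff_indicator_nonneg (shift A) (cylinder A u) u.length ((shift A)^[m] x)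
    have h2 := birkhoff_indicator_nonneg (shift A) (cylinder A u) u.length ((shift A)^[m] y)
    have h3 := birkhoff_indicator_le (shift A) (cylinder A u) u.length ((shift A)^[m] x)
    have h4 := birkhoff_indicator_le (shift A) (cylinder A u) u.length ((shift A)^[m] y)
    rw [e, abs_le]; constructor <;> linarith

variable [Countable S] [TopologicalSpace S] [DiscreteTopology S]

lemma measurable_of_coord {β : Type*} [MeasurableSpace β] {Θ : β → Space A}
    (h : ∀ (i : ℕ) (a : S), MeasurableSet {ω | (Θ ω).1 i = a}) : Measurable Θ := by
  borelize S
  have hb : (inferInstance : MeasurableSpace (Space A)) =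
      MeasurableSpace.comap (fun x : Space A => x.1) (borel (ℕ → S)) := borel_comap
  change @Measurable _ _ _ (borel (Space A)) Θ
  rw [show borel (Space A) = _ from hb, measurable_comap_iff, ← BorelSpace.measurable_eq (α := ℕ → S)]
  exact measurable_pi_lambda _ fun i => measurable_to_countable' fun a => h i a

namespace IsGibbsWith

variable {φ : Space A → ℝ} {μ : Measure (Space A)} [IsProbabilityMeasure μ] {c₀ P : ℝ}

/-- Freely concatenable blocks carry an invariant measure with large free energy. -/
lemma exists_block_measure [Fintype ι] [Nonempty ι] (hG : IsGibbsWith A φ μ c₀ P) (hc : 1 ≤ c₀)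
    (hφ : Measurable φ) {b : ι → List S} (hb : Function.Injective b) {a : S} {N : ℕ} (hN : 1 ≤ N)
    (hlen : ∀ i, (b i).length = N) (hadm : ∀ i, Admissible A (b i ++ [a]))
    (hhead : ∀ i, (b i).getD 0 a = a) :
    ∃ ν : ProbabilityMeasure (Space A),
      (((N : ℝ)⁻¹ * (Real.log (∑ i, μ.real (cylinder A (b i))) - Real.log c₀) : ℝ) : EReal) ≤
        freeEnergy (shift A) φ P ν ∧
      ∀ (u : List S) (ρ δ : ℝ), (∀ i, ∀ x ∈ cylinder A (b i), |(N : ℝ)⁻¹ * birkhoff (shift A)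
        ((cylinder A u).indicator fun _ => 1) N x - ρ| ≤ δ) →
        |(ν : Measure (Space A)).real (cylinder A u) - ρ| ≤ δ := by
  classical
  let _ : MeasurableSpace ι := ⊤
  have hN0 : (0 : ℝ) < N := by exact_mod_cast hN
  set Θ : (ℕ → ι) → Space A := fun ω => ⟨concatSeq b a N ω, concatSeq_rel hN hlen hadm hhead ω⟩
    with hΘdef
  have hΘ : Measurable Θ := by
    refine measurable_of_coord fun t c => ?_
    exact (measurable_of_countable fun i : ι => (b i).getD (t % N) a = c).comp
      (measurable_pi_apply (t / N)) (measurableSet_singleton True) |>.congr (by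
        ext ω; simp [hΘdef, concatSeq])
  have hshiftc (ω : ℕ → ι) (c : ℕ) : (shift A)^[N * c] (Θ ω) = Θ (fun i => ω (i + c)) := by
    apply Subtype.ext
    funext t
    rw [iterate_shift_apply]
    change (b (ω ((t + N * c) / N))).getD ((t + N * c) % N) a =
      (b (ω (t / N + c))).getD (t % N) a
    rw [Nat.add_mul_div_left _ _ hN, Nat.add_mul_mod_self_left]
  have hshift (ω : ℕ → ι) : (shift A)^[N] (Θ ω) = Θ (fun i => ω (i + 1)) := by
    simpa using hshiftc ω 1
  have hmem (ω : ℕ → ι) : Θ ω ∈ cylinder A (b (ω 0)) := by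
    refine mem_cylinder.2 fun i hi => ?_
    have hi' : i < N := by rwa [hlen] at hi
    change (b (ω (i / N))).getD (i % N) a = _
    rw [Nat.div_eq_of_lt hi', Nat.mod_eq_of_lt hi', List.getD_eq_getElem _ _ hi]
  set m : ι → ℝ := fun i => μ.real (cylinder A (b i)) with hm
  have hmpos (i : ι) : 0 < m i := hG.real_cylinder_pos hc (hmem fun _ => i)
  set Z : ℝ := ∑ i, m i with hZ
  have hZpos : 0 < Z := Finset.sum_pos (fun i _ => hmpos i) Finset.univ_nonempty
  set q : ι → ℝ := fun i => m i / Z with hq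
  have hqpos (i : ι) : 0 < q i := div_pos (hmpos i) hZpos
  have hq1 : ∑ i, q i = 1 := by rw [hq, ← Finset.sum_div, div_self hZpos.ne']
  set π : Measure ι := (PMF.ofFintype (fun i => ENNReal.ofReal (q i)) (by
    rw [← ENNReal.ofReal_sum_of_nonneg fun i _ => (hqpos i).le, hq1, ENNReal.ofReal_one])).toMeasure
    with hπ
  have hπi (i : ι) : π {i} = ENNReal.ofReal (q i) := by
    rw [hπ, PMF.toMeasure_apply_singleton _ _ (measurableSet_singleton i)]; rfl
  have hprob := isProbabilityMeasure_blockMeasure (T := shift A) π measurable_shift hΘ hN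
  set ν : ProbabilityMeasure (Space A) := ⟨blockMeasure (shift A) Θ π N, hprob⟩ with hν
  have hνm : (ν : Measure (Space A)) = blockMeasure (shift A) Θ π N := rfl
  set Q := Measure.infinitePi fun _ : ℕ => π with hQ
  have hinv : Invariant (shift A) (ν : Measure (Space A)) :=
    invariant_blockMeasure π measurable_shift hΘ hN hshift
  refine ⟨ν, ?_, fun u ρ δ hu => ?_⟩
  · set l : List (List S) := Finset.univ.toList.map b with hl
    have hent := le_entropy_blockMeasure (T := shift A) π measurable_shift hΘ hN
      (fun x => l.idxOf (word x N))
      (by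
        refine measurable_to_countable' fun k => ?_
        exact measurable_word N {w | l.idxOf w = k})
      ((Set.finite_Iic l.length).subset (by
        rintro _ ⟨x, rfl⟩; exact List.idxOf_le_length))
      (fun i => l.idxOf (b i))
      (fun i j hij => hb ((List.idxOf_inj (by simp [hl])).1 hij))
      (fun ω c => by
        rw [hshiftc]
        have := mem_cylinder_iff_word.1 (hmem fun i => ω (i + c))
        rw [hlen] at this
        rw [this, zero_add])
    have hH : partitionEntropy π id = ENNReal.ofReal (∑ i, -(q i * Real.log (q i))) := by
      rw [partitionEntropy, tsum_fintype, ENNReal.ofReal_sum_of_nonneg]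
      · refine Finset.sum_congr rfl fun i _ => ?_
        rw [preimage_id, hπi, ENNReal.toReal_ofReal (hqpos i).le]
      · intro i _
        have : q i ≤ 1 := hq1 ▸ Finset.single_le_sum (fun j _ => (hqpos j).le) (Finset.mem_univ i)
        have := Real.log_nonpos (hqpos i).le this
        nlinarith [hqpos i]
    rw [hH, ← ENNReal.ofReal_mul (by positivity)] at hent
    set D := P + Real.log c₀ with hD
    have hφD (x : Space A) : φ x ≤ D := hG.potential_le hc x
    set g : ι → ℝ := fun i => N * D - (Real.log (m i) + P * N - Real.log c₀) with hg
    have hsum (ω : ℕ → ι) : ∑ i ∈ Finset.range N, ENNReal.ofReal (D - φ ((shift A)^[i] (Θ ω))) =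
        ENNReal.ofReal (N * D - birkhoff (shift A) φ N (Θ ω)) := by
      rw [← ENNReal.ofReal_sum_of_nonneg fun i _ => sub_nonneg.2 (hφD _), Finset.sum_sub_distrib]
      simp [birkhoff]
    have hgle (ω : ℕ → ι) : N * D - birkhoff (shift A) φ N (Θ ω) ≤ g (ω 0) := by
      have := hG.log_le_birkhoff hc (hmem ω)
      rw [hlen] at this
      simp only [hg, hm]
      linarith
    have hg0 (i : ι) : 0 ≤ g i := by
      refine le_trans ?_ (hgle fun _ => i)
      exact sub_nonneg.2 (birkhoff_le _ hφD _ _)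
    have hlint : ∫⁻ x, ENNReal.ofReal (D - φ x) ∂(ν : Measure (Space A)) ≤
        ENNReal.ofReal ((N : ℝ)⁻¹ * ∑ i, g i * q i) := by
      rw [hνm, lintegral_blockMeasure π measurable_shift hΘ
        (f := fun x => ENNReal.ofReal (D - φ x)) (measurable_const.sub hφ).ennreal_ofReal, ENNReal.ofReal_mul (by positivity),
        ENNReal.ofReal_inv_of_pos hN0, ENNReal.ofReal_natCast]
      gcongr
      calc ∫⁻ ω, ∑ i ∈ Finset.range N, ENNReal.ofReal (D - φ ((shift A)^[i] (Θ ω))) ∂Q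
          ≤ ∫⁻ ω, ENNReal.ofReal (g (ω 0)) ∂Q := by
            refine lintegral_mono fun ω => ?_
            rw [hsum]
            exact ENNReal.ofReal_le_ofReal (hgle ω)
        _ = ∫⁻ i, ENNReal.ofReal (g i) ∂π :=
            (measurePreserving_eval_infinitePi (fun _ : ℕ => π) 0).lintegral_comp
              (f := fun i => ENNReal.ofReal (g i)) (measurable_of_countable _)
        _ = _ := by
            rw [lintegral_fintype, ENNReal.ofReal_sum_of_nonneg
              fun i _ => mul_nonneg (hg0 i) (hqpos i).le]
            refine Finset.sum_congr rfl fun i _ => ?_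
            rw [hπi, ENNReal.ofReal_mul (hg0 i)]
    have hψ : Integrable (fun x => D - φ x) (ν : Measure (Space A)) := by
      refine ⟨(measurable_const.sub hφ).aestronglyMeasurable, ?_⟩
      rw [hasFiniteIntegral_iff_ofReal (ae_of_all _ fun x => sub_nonneg.2 (hφD x))]
      exact hlint.trans_lt ENNReal.ofReal_lt_top
    have hφi : Integrable φ (ν : Measure (Space A)) := by
      refine ((integrable_const D).sub hψ).congr (ae_of_all _ fun x => ?_)
      simp
    have hr : D - (N : ℝ)⁻¹ * ∑ i, g i * q i ≤ ∫ x, φ x ∂(ν : Measure (Space A)) := by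
      have h1 : ∫ x, (D - φ x) ∂(ν : Measure (Space A)) ≤ (N : ℝ)⁻¹ * ∑ i, g i * q i := by
        rw [integral_eq_lintegral_of_nonneg_ae (ae_of_all _ fun x => sub_nonneg.2 (hφD x))
          (measurable_const.sub hφ).aestronglyMeasurable]
        refine ENNReal.toReal_le_of_le_ofReal ?_ hlint
        exact mul_nonneg (by positivity) (Finset.sum_nonneg fun i _ => mul_nonneg (hg0 i) (hqpos i).le)
      rw [integral_sub (integrable_const _) hφi] at h1
      simp at h1
      linarith
    refine le_trans (le_of_eq ?_) (le_freeEnergy hinv hφi hent hr)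
    congr 1
    have e1 : ∑ i, g i * q i = N * D - P * N + Real.log c₀ - ∑ i, q i * Real.log (m i) := by
      calc ∑ i, g i * q i = ∑ i, ((N * D - P * N + Real.log c₀) * q i - q i * Real.log (m i)) :=
            Finset.sum_congr rfl fun i _ => by simp only [hg]; ring
        _ = _ := by rw [Finset.sum_sub_distrib, ← Finset.mul_sum, hq1, mul_one]
    have e2 : ∑ i, -(q i * Real.log (q i)) = Real.log Z - ∑ i, q i * Real.log (m i) := by
      calc ∑ i, -(q i * Real.log (q i)) = ∑ i, (Real.log Z * q i - q i * Real.log (m i)) :=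
            Finset.sum_congr rfl fun i _ => by
              simp only [hq]
              rw [Real.log_div (hmpos i).ne' hZpos.ne']; ring
        _ = _ := by rw [Finset.sum_sub_distrib, ← Finset.mul_sum, hq1, mul_one]
    rw [e1, e2]
    field_simp
    ring
  · have hsm := measurableSet_cylinder (A := A) u
    have hν1 : (ν : Measure (Space A)) (cylinder A u) = (N : ℝ≥0∞)⁻¹ *
        ∫⁻ ω, ENNReal.ofReal (birkhoff (shift A) ((cylinder A u).indicator fun _ => 1) N (Θ ω)) ∂Q := by
      have := lintegral_blockMeasure (T := shift A) (N := N) π measurable_shift hΘ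
        (f := (cylinder A u).indicator 1) (measurable_one.indicator hsm)
      rw [lintegral_indicator_one hsm] at this
      rw [hνm, this]
      congr 1
      refine lintegral_congr fun ω => ?_
      rw [birkhoff, ENNReal.ofReal_sum_of_nonneg fun i _ =>
        indicator_nonneg (fun _ _ => zero_le_one) _]
      refine Finset.sum_congr rfl fun i _ => ?_
      by_cases h : (shift A)^[i] (Θ ω) ∈ cylinder A u <;> simp [h]
    have hinvN : (N : ℝ≥0∞)⁻¹ = ENNReal.ofReal (N : ℝ)⁻¹ := by
      rw [ENNReal.ofReal_inv_of_pos hN0, ENNReal.ofReal_natCast]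
    have hmeasB : Measurable fun ω => ENNReal.ofReal
        (birkhoff (shift A) ((cylinder A u).indicator fun _ => 1) N (Θ ω)) := by
      refine Measurable.ennreal_ofReal (Finset.measurable_sum _ fun i _ => ?_)
      exact ((measurable_const.indicator hsm).comp ((measurable_iterate_shift i).comp hΘ))
    rw [hinvN, ← lintegral_const_mul _ hmeasB] at hν1
    simp_rw [← ENNReal.ofReal_mul (inv_nonneg.2 hN0.le)] at hν1
    have hup : (ν : Measure (Space A)) (cylinder A u) ≤ ENNReal.ofReal (ρ + δ) := by
      rw [hν1]
      refine (lintegral_mono (g := fun _ => ENNReal.ofReal (ρ + δ)) fun ω =>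
        ENNReal.ofReal_le_ofReal ?_).trans (by simp)
      linarith [(abs_le.1 (hu _ _ (hmem ω))).2]
    have hlo : ENNReal.ofReal (ρ - δ) ≤ (ν : Measure (Space A)) (cylinder A u) := by
      rw [hν1]
      refine le_trans (by simp) (lintegral_mono (f := fun _ => ENNReal.ofReal (ρ - δ)) fun ω =>
        ENNReal.ofReal_le_ofReal ?_)
      linarith [(abs_le.1 (hu _ _ (hmem ω))).1]
    have hpos : 0 ≤ ρ + δ := by
      obtain ⟨i⟩ := ‹Nonempty ι›
      have h1 := (abs_le.1 (hu _ _ (hmem fun _ => i))).2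
      have h2 := mul_nonneg (inv_nonneg.2 hN0.le)
        (birkhoff_indicator_nonneg (shift A) (cylinder A u) N (Θ fun _ => i))
      linarith
    rw [abs_le]
    constructor
    · have := (ENNReal.ofReal_le_iff_le_toReal (measure_ne_top _ _)).1 hlo
      rw [Measure.real]; linarith
    · have := ENNReal.toReal_le_of_le_ofReal hpos hup
      rw [Measure.real]; linarith

end IsGibbsWith

end Blocks

end CMS

namespace CMS

section Upper

variable {S : Type*} [Countable S] [TopologicalSpace S] [DiscreteTopology S] {A : S → S → Prop}
  {φ : Space A → ℝ} {μ : Measure (Space A)} [IsProbabilityMeasure μ] {c₀ P : ℝ}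

namespace IsGibbsWith

lemma exists_pos_le_real_cylinder (hG : IsGibbsWith A φ μ c₀ P) (hc : 1 ≤ c₀)
    (Λ : Finset (List S)) : ∃ d : ℝ, 0 < d ∧ ∀ l ∈ Λ, (cylinder A l).Nonempty →
      d ≤ μ.real (cylinder A l) := by
  classical
  rcases (Λ.filter fun l => (cylinder A l).Nonempty).eq_empty_or_nonempty with h | h
  · refine ⟨1, one_pos, fun l hl hne => ?_⟩
    have : l ∈ Λ.filter fun l => (cylinder A l).Nonempty := Finset.mem_filter.2 ⟨hl, hne⟩
    rw [h] at this
    simp at this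
  · refine ⟨(Λ.filter fun l => (cylinder A l).Nonempty).inf' h fun l => μ.real (cylinder A l),
      ?_, fun l hl hne => Finset.inf'_le _ (Finset.mem_filter.2 ⟨hl, hne⟩)⟩
    rw [Finset.lt_inf'_iff]
    intro l hl
    obtain ⟨x, hx⟩ := (Finset.mem_filter.1 hl).2
    exact hG.real_cylinder_pos hc hx

end IsGibbsWith

/-- A set of words of equal length carries, up to a constant factor, its mass on finitely many words
that can be linked to a given letter by the same connecting words. -/
lemma exists_finset_words (hA : NoZeroRowCol A) {Λ : Finset (List S)}
    (hΛ : ∀ v w : List S, Admissible A v → Admissible A w → ∃ l ∈ Λ, Admissible A (v ++ l ++ w))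
    (μ : Measure (Space A)) [IsProbabilityMeasure μ] (a : S) {n : ℕ} (hn : 1 ≤ n)
    (D : Set (List S)) (h : 0 < μ.real {x | word x n ∈ D}) :
    ∃ l₁ ∈ Λ, ∃ l₂ ∈ Λ, ∃ W : Finset (List S), W.Nonempty ∧
      (∀ w ∈ W, w ∈ D ∧ w.length = n ∧ Admissible A ([a] ++ l₁ ++ w ++ l₂ ++ [a])) ∧
      μ.real {x | word x n ∈ D} ≤ 2 * (Λ.card : ℝ) ^ 2 * ∑ w ∈ W, μ.real (cylinder A w) := by
  classical
  set Z := μ.real {x | word x n ∈ D} with hZ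
  obtain ⟨t, ht⟩ : ∃ t : Finset ↥(D ∩ {w : List S | w.length = n}),
      Z / 2 < ∑ w ∈ t, μ.real (cylinder A (w : List S)) := by
    have h1 : ENNReal.ofReal (Z / 2) < ∑' w : ↥(D ∩ {w : List S | w.length = n}),
        μ (cylinder A (w : List S)) := by
      rw [← measure_word_mem, ← ofReal_measureReal, ENNReal.ofReal_lt_ofReal_iff h]
      exact half_lt_self h
    rw [ENNReal.tsum_eq_iSup_sum, lt_iSup_iff] at h1
    obtain ⟨t, ht⟩ := h1
    refine ⟨t, ?_⟩
    rw [← ENNReal.ofReal_lt_ofReal_iff_of_nonneg (by positivity),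
      ENNReal.ofReal_sum_of_nonneg fun _ _ => measureReal_nonneg]
    simpa using ht
  set V : Finset (List S) := (t.map (Function.Embedding.subtype _)).filter
    fun w => (cylinder A w).Nonempty with hV
  have hVsum : Z / 2 < ∑ w ∈ V, μ.real (cylinder A w) := by
    rw [hV, Finset.sum_filter_of_ne, Finset.sum_map]
    · exact ht
    · intro w _ hw
      by_contra hne
      rw [not_nonempty_iff_eq_empty.1 hne] at hw
      simp at hw
  have hVmem (w : List S) (hw : w ∈ V) : w ∈ D ∧ w.length = n ∧ Admissible A w := by
    obtain ⟨h1, x, hx⟩ := Finset.mem_filter.1 hw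
    obtain ⟨v, -, rfl⟩ := Finset.mem_map.1 h1
    have hl : (v : List S).length = n := v.2.2
    refine ⟨v.2.1, hl, admissible_of_mem (fun h0 => ?_) hx⟩
    change (v : List S) = [] at h0
    rw [h0] at hl
    simp at hl
    omega
  have hlink (w : List S) (hw : w ∈ V) : ∃ p ∈ Λ ×ˢ Λ,
      Admissible A ([a] ++ p.1 ++ w ++ p.2 ++ [a]) := by
    have ha : Admissible A [a] := ⟨by simp, List.isChain_singleton a⟩
    obtain ⟨l₁, h1, h1'⟩ := hΛ [a] w ha (hVmem w hw).2.2
    obtain ⟨l₂, h2, h2'⟩ := hΛ _ [a] h1' ha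
    exact ⟨(l₁, l₂), Finset.mem_product.2 ⟨h1, h2⟩, h2'⟩
  choose! p hp hp' using hlink
  have hfib := Finset.sum_fiberwise_of_maps_to hp fun w => μ.real (cylinder A w)
  obtain ⟨q, hq, hqle⟩ : ∃ q ∈ Λ ×ˢ Λ, Z / 2 / (Λ ×ˢ Λ).card <
      ∑ w ∈ V.filter fun w => p w = q, μ.real (cylinder A w) := by
    by_contra! hcon
    have := Finset.sum_le_sum hcon
    rw [hfib, Finset.sum_const, nsmul_eq_mul] at this
    have hcard : (0 : ℝ) < (Λ ×ˢ Λ).card := by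
      rw [Nat.cast_pos, Finset.card_pos]
      obtain ⟨w, hw⟩ : V.Nonempty := by
        rw [Finset.nonempty_iff_ne_empty]
        intro h0
        rw [h0, Finset.sum_empty] at hVsum
        linarith
      exact ⟨_, hp w hw⟩
    rw [mul_div_cancel₀ _ hcard.ne'] at this
    linarith
  obtain ⟨hq1, hq2⟩ := Finset.mem_product.1 hq
  have hcard : (0 : ℝ) < (Λ.card : ℝ) ^ 2 := by
    have : (0 : ℝ) < Λ.card := by rw [Nat.cast_pos, Finset.card_pos]; exact ⟨_, hq1⟩
    positivity
  have hcard2 : ((Λ ×ˢ Λ).card : ℝ) = (Λ.card : ℝ) ^ 2 := by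
    rw [Finset.card_product]; push_cast; ring
  rw [hcard2] at hqle
  refine ⟨q.1, hq1, q.2, hq2, V.filter fun w => p w = q, ?_, fun w hw => ?_, ?_⟩
  · rw [Finset.nonempty_iff_ne_empty]
    intro h0
    rw [h0, Finset.sum_empty] at hqle
    have : 0 < Z / 2 / (Λ.card : ℝ) ^ 2 := by positivity
    linarith
  · obtain ⟨hw1, rfl⟩ := Finset.mem_filter.1 hw
    exact ⟨(hVmem w hw1).1, (hVmem w hw1).2.1, hp' w hw1⟩
  · rw [div_div, div_lt_iff₀ (by positivity)] at hqle
    linarith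

lemma abs_average_sub_le {l₁ w l₂ u : List S} {n N M r : ℕ} (hn : 1 ≤ n) (hw : w.length = n)
    (hN : N = 1 + l₁.length + n + l₂.length) (h₁ : l₁.length ≤ M) (h₂ : l₂.length ≤ M)
    (hu : u.length ≤ r) {a : S} {x z : Space A} (hx : x ∈ cylinder A ([a] ++ l₁ ++ w ++ l₂))
    (hz : z ∈ cylinder A w) :
    |(N : ℝ)⁻¹ * birkhoff (shift A) ((cylinder A u).indicator fun _ => 1) N x -
      (n : ℝ)⁻¹ * birkhoff (shift A) ((cylinder A u).indicator fun _ => 1) n z| ≤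
      (2 + 4 * M + r) / n := by
  set f : Space A → ℝ := (cylinder A u).indicator fun _ => 1 with hf
  set p := 1 + l₁.length with hp
  set q := l₂.length with hq
  have hn0 : (0 : ℝ) < n := by exact_mod_cast hn
  have hsplit : birkhoff (shift A) f N x = birkhoff (shift A) f p x +
      birkhoff (shift A) f n ((shift A)^[p] x) +
      birkhoff (shift A) f q ((shift A)^[p + n] x) := by
    rw [hN, birkhoff_add, birkhoff_add]
  have hy : (shift A)^[p] x ∈ cylinder A w := by
    have h1 := (mem_cylinder_append.1 (mem_cylinder_append.1 hx).1).2
    simpa [hp, add_comm] using h1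
  have hyz : ∀ i < n, ((shift A)^[p] x).1 i = z.1 i := by
    intro i hi
    rw [mem_cylinder.1 hy i (by omega), mem_cylinder.1 hz i (by omega)]
  have h1 := abs_le.1 (abs_birkhoff_indicator_sub_le (u := u) hyz)
  have b1 := birkhoff_indicator_nonneg (shift A) (cylinder A u) p x
  have b2 := birkhoff_indicator_le (shift A) (cylinder A u) p x
  have b3 := birkhoff_indicator_nonneg (shift A) (cylinder A u) q ((shift A)^[p + n] x)
  have b4 := birkhoff_indicator_le (shift A) (cylinder A u) q ((shift A)^[p + n] x)
  have b5 := birkhoff_indicator_nonneg (shift A) (cylinder A u) n z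
  have b6 := birkhoff_indicator_le (shift A) (cylinder A u) n z
  rw [← hf] at h1 b1 b2 b3 b4 b5 b6
  set s := birkhoff (shift A) f n z with hs
  set t := birkhoff (shift A) f N x with ht
  have hpM : (p : ℝ) ≤ 1 + M := by rw [hp]; push_cast; gcongr
  have hqM : (q : ℝ) ≤ M := by exact_mod_cast h₂
  have hur : (u.length : ℝ) ≤ r := by exact_mod_cast hu
  have hNr : (N : ℝ) = n + p + q := by
    have : N = n + p + q := by omega
    rw [this]; push_cast; ring
  have hN0 : (0 : ℝ) < N := by rw [hNr]; positivity
  have hts1 : t - s ≤ p + q + r := by linarith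
  have hts2 : -r ≤ t - s := by linarith
  have e : (N : ℝ)⁻¹ * t - (n : ℝ)⁻¹ * s = ((t - s) - (s / n) * (p + q)) / N := by
    rw [hNr]
    have : (n : ℝ) + p + q ≠ 0 := by rw [← hNr]; exact hN0.ne'
    field_simp
    ring
  have hsn : s / n ≤ 1 := by rw [div_le_one hn0]; exact b6
  have hsn0 : 0 ≤ s / n := by positivity
  have hpq : (0 : ℝ) ≤ p + q := by positivity
  have hM0 : (0 : ℝ) ≤ M := by positivity
  have hr0 : (0 : ℝ) ≤ r := by positivity
  rw [e, abs_div, abs_of_pos hN0]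
  have hbound : |(t - s) - (s / n) * (p + q)| ≤ 2 + 4 * M + r := by
    have hm1 : (s / n) * (p + q) ≤ p + q := mul_le_of_le_one_left hpq hsn
    have hm2 : 0 ≤ (s / n) * (p + q) := mul_nonneg hsn0 hpq
    rw [abs_le]
    constructor <;> linarith
  gcongr
  omega

namespace IsGibbsWith

lemma exists_le_freeEnergy (hG : IsGibbsWith A φ μ c₀ P) (hc : 1 ≤ c₀) (hφ : Measurable φ)
    (hA : NoZeroRowCol A) {Λ : Finset (List S)}
    (hΛ : ∀ v w : List S, Admissible A v → Admissible A w → ∃ l ∈ Λ, Admissible A (v ++ l ++ w))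
    (μ₀ : ProbabilityMeasure (Space A)) (U : Finset (List S)) {ε : ℝ} (hε : 0 < ε) :
    ∃ (C : ℝ) (n₀ : ℕ), ∀ n : ℕ, n₀ ≤ n →
      0 < μ.real {x | empirical (shift A) x n ∈ nbd μ₀ U (ε / 2)} →
      ∃ ν ∈ nbd μ₀ U ε, (((n : ℝ)⁻¹ *
        (Real.log (μ.real {x | empirical (shift A) x n ∈ nbd μ₀ U (ε / 2)}) - C) : ℝ) : EReal) ≤
        freeEnergy (shift A) φ P ν := by
  classical
  obtain ⟨x₀⟩ : Nonempty (Space A) := by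
    by_contra h
    rw [not_nonempty_iff] at h
    have := measure_univ (μ := μ)
    rw [univ_eq_empty_iff.2 h] at this
    simp at this
  set a := x₀.1 0 with ha
  obtain ⟨d, hd0, hd⟩ := hG.exists_pos_le_real_cylinder hc (insert [a] Λ)
  obtain ⟨M, hM⟩ : ∃ M, ∀ l ∈ Λ, l.length ≤ M := ⟨Λ.sup List.length, fun l hl => Finset.le_sup hl⟩
  obtain ⟨r, hr⟩ : ∃ r, ∀ l ∈ U, l.length ≤ r := ⟨U.sup List.length, fun l hl => Finset.le_sup hl⟩
  set K : ℝ := (Λ.card : ℝ) ^ 2 with hK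
  obtain ⟨n₀, hn₀⟩ := exists_nat_gt ((2 + 4 * M + r) / (ε / 2))
  refine ⟨Real.log (2 * K * (c₀ ^ 9 * d⁻¹ ^ 3)) + Real.log c₀, max n₀ 1, fun n hnn hpos => ?_⟩
  have hn : 1 ≤ n := (le_max_right _ _).trans hnn
  have hn0 : (0 : ℝ) < n := by exact_mod_cast hn
  have hnn0 : (n₀ : ℝ) ≤ n := by exact_mod_cast (le_max_left _ _).trans hnn
  set Z := μ.real {x | empirical (shift A) x n ∈ nbd μ₀ U (ε / 2)} with hZ
  set D : Set (List S) := {w | ∃ z ∈ cylinder A w, empirical (shift A) z n ∈ nbd μ₀ U (ε / 2)} with hD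
  have hZD : Z ≤ μ.real {x | word x n ∈ D} := by
    refine measureReal_mono (fun x hx => ?_) (measure_ne_top _ _)
    exact ⟨x, mem_cylinder_word x n, hx⟩
  obtain ⟨l₁, hl₁, l₂, hl₂, W, hWne, hW, hWsum⟩ :=
    exists_finset_words hA hΛ μ a hn D (hpos.trans_le hZD)
  have : Nonempty W := hWne.to_subtype
  set b : W → List S := fun w => [a] ++ l₁ ++ (w : List S) ++ l₂ with hb
  set N := 1 + l₁.length + n + l₂.length with hN
  have hlen (w : W) : (b w).length = N := by
    have := (hW w w.2).2.1
    simp [hb, this, hN]; omega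
  obtain ⟨ν, hν, hνu⟩ := hG.exists_block_measure hc hφ (b := b) (a := a) (N := N)
    (fun v w hvw => by
      apply Subtype.ext
      simpa [hb] using hvw)
    (by omega) hlen (fun w => (hW w w.2).2.2) (fun w => by simp [hb])
  have hbne (w : W) : (cylinder A (b w)).Nonempty :=
    (hA.cylinder_nonempty (hW w w.2).2.2).mono (cylinder_append_subset _ _)
  refine ⟨ν, fun u hu => ?_, le_trans ?_ hν⟩
  · refine lt_of_le_of_lt (b := ε / 2 + (2 + 4 * M + r) / n) ?_ ?_
    · refine hνu u _ _ fun w x hx => ?_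
      obtain ⟨z, hz, hzn⟩ := (hW w w.2).1
      have h1 := abs_average_sub_le hn (hW w w.2).2.1 hN (hM _ hl₁) (hM _ hl₂) (hr u hu) hx hz
      have h2 := hzn u hu
      rw [empirical_real_apply _ _ hn (measurableSet_cylinder u)] at h2
      have h3 := abs_sub_le ((N : ℝ)⁻¹ * birkhoff (shift A) ((cylinder A u).indicator fun _ => 1) N x)
        ((n : ℝ)⁻¹ * birkhoff (shift A) ((cylinder A u).indicator fun _ => 1) n z)
        ((μ₀ : Measure (Space A)).real (cylinder A u))
      linarith
    · have : (2 + 4 * M + r) / n < ε / 2 := by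
        rw [div_lt_iff₀ hn0]
        rw [div_lt_iff₀ (by positivity)] at hn₀
        nlinarith
      linarith
  · rw [EReal.coe_le_coe_iff]
    set Zb := ∑ w, μ.real (cylinder A (b w)) with hZb
    have hmass (w : W) : μ.real (cylinder A (w : List S)) ≤
        c₀ ^ 9 * d⁻¹ ^ 3 * μ.real (cylinder A (b w)) := by
      have n1 := hbne w
      have n2 := n1.mono (cylinder_append_subset _ _)
      have n3 := n2.mono (cylinder_append_subset _ _)
      have n4 := n3.mono (cylinder_append_subset _ _)
      have e1 := hG.le_real_cylinder_append hc n1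
      have e2 := hG.le_real_cylinder_append hc n2
      have e3 := hG.le_real_cylinder_append hc n3
      have m1 := hd l₂ (Finset.mem_insert_of_mem hl₂) (by
        obtain ⟨x, hx⟩ := n1; exact ⟨_, (mem_cylinder_append.1 hx).2⟩)
      have m2 := hd l₁ (Finset.mem_insert_of_mem hl₁) (by
        obtain ⟨x, hx⟩ := n3; exact ⟨_, (mem_cylinder_append.1 hx).2⟩)
      have m3 := hd [a] (Finset.mem_insert_self _ _) n4
      have hc0 : 0 < c₀ := by linarith
      have hd3 : d ^ 3 * μ.real (cylinder A (w : List S)) ≤ c₀ ^ 9 * μ.real (cylinder A (b w)) := by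
        calc d ^ 3 * μ.real (cylinder A (w : List S))
            = d * d * μ.real (cylinder A (w : List S)) * d := by ring
          _ ≤ μ.real (cylinder A [a]) * μ.real (cylinder A l₁) * μ.real (cylinder A (w : List S)) *
              μ.real (cylinder A l₂) := by gcongr
          _ ≤ c₀ ^ 3 * μ.real (cylinder A ([a] ++ l₁)) * μ.real (cylinder A (w : List S)) *
              μ.real (cylinder A l₂) := by gcongr
          _ = c₀ ^ 3 * (μ.real (cylinder A ([a] ++ l₁)) * μ.real (cylinder A (w : List S))) *
              μ.real (cylinder A l₂) := by ring
          _ ≤ c₀ ^ 3 * (c₀ ^ 3 * μ.real (cylinder A ([a] ++ l₁ ++ (w : List S)))) *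
              μ.real (cylinder A l₂) := by gcongr
          _ = c₀ ^ 3 * (c₀ ^ 3 * (μ.real (cylinder A ([a] ++ l₁ ++ (w : List S))) *
              μ.real (cylinder A l₂))) := by ring
          _ ≤ c₀ ^ 3 * (c₀ ^ 3 * (c₀ ^ 3 * μ.real (cylinder A (b w)))) := by gcongr
          _ = _ := by ring
      rw [inv_pow, mul_comm (c₀ ^ 9), mul_assoc, ← div_eq_inv_mul, le_div_iff₀ (by positivity)]
      linarith
    have hZle : Z ≤ 2 * K * (c₀ ^ 9 * d⁻¹ ^ 3) * Zb := by
      refine hZD.trans (hWsum.trans ?_)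
      rw [mul_assoc (2 * K)]
      refine mul_le_mul_of_nonneg_left ?_ (by positivity)
      rw [← Finset.sum_coe_sort, hZb, Finset.mul_sum]
      exact Finset.sum_le_sum fun w _ => hmass w
    have hZbpos : 0 < Zb := by
      refine Finset.sum_pos (fun w _ => ?_) Finset.univ_nonempty
      obtain ⟨x, hx⟩ := hbne w
      exact hG.real_cylinder_pos hc hx
    have hZb1 : Zb ≤ 1 := by
      rw [hZb, ← measureReal_biUnion_finset]
      · exact measure_real_le_one _ _
      · intro v _ w _ hvw
        refine disjoint_cylinder ((hlen v).trans (hlen w).symm) fun h => hvw ?_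
        apply Subtype.ext
        simpa [hb] using h
      · exact fun w _ => measurableSet_cylinder _
    have hKpos : 0 < 2 * K * (c₀ ^ 9 * d⁻¹ ^ 3) := by
      by_contra hcon
      have := mul_nonpos_of_nonpos_of_nonneg (not_lt.1 hcon) hZbpos.le
      linarith
    have hlog : Real.log Z ≤ Real.log (2 * K * (c₀ ^ 9 * d⁻¹ ^ 3)) + Real.log Zb := by
      rw [← Real.log_mul hKpos.ne' hZbpos.ne']
      exact Real.log_le_log hpos hZle
    have hneg : Real.log Zb - Real.log c₀ ≤ 0 := by
      linarith [Real.log_nonpos hZbpos.le hZb1, Real.log_nonneg hc]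
    calc _ ≤ (n : ℝ)⁻¹ * (Real.log Zb - Real.log c₀) :=
          mul_le_mul_of_nonneg_left (by linarith) (by positivity)
      _ ≤ (N : ℝ)⁻¹ * (Real.log Zb - Real.log c₀) := by
        refine mul_le_mul_of_nonpos_right ?_ hneg
        have : (n : ℝ) ≤ N := by exact_mod_cast (by omega : n ≤ N)
        gcongr

end IsGibbsWith

end Upper

end CMS

namespace CMS

variable {S : Type*} [Countable S] [TopologicalSpace S] [DiscreteTopology S] {A : S → S → Prop}

lemma exists_innerApprox_measure_diff_le (ν : Measure (Space A)) [IsFiniteMeasure ν]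
    {U : Set (Space A)} (hU : IsOpen U) {δ : ℝ≥0∞} (hδ : δ ≠ 0) :
    ∃ N, ∀ n, N ≤ n → ν (U \ innerApprox U n) ≤ δ := by
  have hm (n : ℕ) : MeasurableSet (innerApprox U n) := by
    have := measurable_word (A := A) n {w | cylinder A w ⊆ U}
    exact this
  have h : Tendsto (fun n => ν (U \ innerApprox U n)) atTop (𝓝 (ν (⋂ n, U \ innerApprox U n))) := by
    refine tendsto_measure_iInter_atTop (fun n => (hU.measurableSet.diff (hm n)).nullMeasurableSet)
      (fun m n h => sdiff_subset_sdiff_right (monotone_innerApprox U h)) ⟨0, measure_ne_top _ _⟩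
  rw [← sdiff_iUnion, iUnion_innerApprox hU, sdiff_self, measure_empty] at h
  exact eventually_atTop.1 (h.eventually_le_const (pos_iff_ne_zero.2 hδ))

lemma exists_itin_approx (ν : Measure (Space A)) [IsFiniteMeasure ν] {p : Space A → ℕ}
    (hp : Measurable p) (hfin : (range p).Finite) {δ : ℝ} (hδ : 0 < δ) :
    ∃ (N : ℕ) (g : (Fin N → S) → ℕ),
      ν {x | p x ≠ g (itin (shift A) (fun x => x.1 0) N x)} ≤ ENNReal.ofReal δ := by
  classical
  set R := hfin.toFinset with hR
  set δ' : ℝ≥0∞ := ENNReal.ofReal δ / (2 * (R.card + 1)) with hδ'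
  have hδ0 : δ' ≠ 0 := by
    refine (ENNReal.div_pos (by simpa using hδ) ?_).ne'
    exact ENNReal.mul_ne_top (by simp) (by simp)
  have hD (c : ℕ) : MeasurableSet (p ⁻¹' {c}) := hp (measurableSet_singleton c)
  have h1 (c : ℕ) : ∃ U, p ⁻¹' {c} ⊆ U ∧ IsOpen U ∧ ν (U \ p ⁻¹' {c}) ≤ δ' := by
    obtain ⟨U, hU, hUo, -, h⟩ := (hD c).exists_isOpen_sdiff_lt (μ := ν) (measure_ne_top _ _) hδ0
    exact ⟨U, hU, hUo, h.le⟩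
  choose U hU hUo hUd using h1
  choose N hN using fun c => exists_innerApprox_measure_diff_le ν (hUo c) hδ0
  set M := R.sup N with hM
  set g : (Fin M → S) → ℕ := fun f =>
    if h : ∃ c, cylinder A (List.ofFn f) ⊆ U c ∧ c ∈ R then h.choose else 0 with hg
  refine ⟨M, g, ?_⟩
  have hsub : {x | p x ≠ g (itin (shift A) (fun x => x.1 0) M x)} ⊆
      (⋃ c ∈ R, (U c \ p ⁻¹' {c})) ∪ ⋃ c ∈ R, (U c \ innerApprox (U c) M) := by
    intro x hx
    by_contra hcon
    simp only [mem_union, mem_iUnion, not_or, not_exists] at hcon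
    have hitin : List.ofFn (itin (shift A) (fun x => x.1 0) M x) = word x M := by
      unfold word itin
      congr 1
      funext i
      simp [iterate_shift_apply]
    have hpR : p x ∈ R := by simp [hR]
    have hin : x ∈ innerApprox (U (p x)) M := by
      by_contra h
      exact hcon.2 (p x) hpR ⟨hU _ rfl, h⟩
    have hex : ∃ c, cylinder A (List.ofFn (itin (shift A) (fun x => x.1 0) M x)) ⊆ U c ∧ c ∈ R := by
      rw [hitin]; exact ⟨p x, hin, hpR⟩
    have hgx : g (itin (shift A) (fun x => x.1 0) M x) = hex.choose := by
      simp only [hg]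
      rw [dif_pos hex]
    obtain ⟨h2, h3⟩ := hex.choose_spec
    refine hcon.1 _ h3 ⟨h2 (by rw [hitin]; exact mem_cylinder_word x M), fun h => hx ?_⟩
    rw [hgx]
    exact h
  refine (measure_mono hsub).trans ((measure_union_le _ _).trans ?_)
  have b1 : ν (⋃ c ∈ R, (U c \ p ⁻¹' {c})) ≤ R.card * δ' := by
    refine (measure_biUnion_finset_le _ _).trans ((Finset.sum_le_card_nsmul _ _ _ fun c _ => hUd c).trans ?_)
    simp
  have b2 : ν (⋃ c ∈ R, (U c \ innerApprox (U c) M)) ≤ R.card * δ' := by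
    refine (measure_biUnion_finset_le _ _).trans
      ((Finset.sum_le_card_nsmul _ _ _ fun c hc => hN c M (Finset.le_sup hc)).trans ?_)
    simp
  calc _ ≤ R.card * δ' + R.card * δ' := add_le_add b1 b2
    _ ≤ (2 * (R.card + 1)) * δ' := by rw [← two_mul, ← mul_assoc]; gcongr; simp
    _ ≤ ENNReal.ofReal δ := ENNReal.mul_div_le

lemma preimage_itin (k : ℕ) (x : Space A) :
    itin (shift A) (fun x => x.1 0) k ⁻¹' {itin (shift A) (fun x => x.1 0) k x} =
      cylinder A (word x k) := by
  ext y
  rw [mem_preimage, mem_singleton_iff, itin_eq_iff, mem_cylinder_word_iff]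
  simp [iterate_shift_apply]

namespace IsGibbsWith

variable {φ : Space A → ℝ} {μ : Measure (Space A)} [IsProbabilityMeasure μ] {c₀ P : ℝ}

lemma freeEnergy_le (hG : IsGibbsWith A φ μ c₀ P) (hc : 1 ≤ c₀) (hφ : Measurable φ)
    {ν : ProbabilityMeasure (Space A)} (hinv : Invariant (shift A) (ν : Measure (Space A)))
    (hbot : IntegralGtBot φ (ν : Measure (Space A))) {k : ℕ} (hk : 1 ≤ k) :
    Integrable (fun x => Real.log (μ.real (cylinder A (word x k))) -
      Real.log ((ν : Measure (Space A)).real (cylinder A (word x k)))) (ν : Measure (Space A)) ∧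
    freeEnergy (shift A) φ P ν ≤ (((k : ℝ)⁻¹ * ((∫ x, (Real.log (μ.real (cylinder A (word x k))) -
      Real.log ((ν : Measure (Space A)).real (cylinder A (word x k)))) ∂(ν : Measure (Space A))) +
        Real.log c₀) : ℝ) : EReal) := by
  let : MeasurableSpace S := ⊤
  have hp₀ : Measurable fun x : Space A => x.1 0 := measurable_comp_coord (fun a => a) 0
  set I := itin (shift A) (fun x : Space A => x.1 0) k with hI
  have hIm : Measurable I := measurable_itin measurable_shift hp₀ k
  have hk0 : (0 : ℝ) < k := by exact_mod_cast hk
  have hT : MeasurePreserving (shift A) (ν : Measure (Space A)) (ν : Measure (Space A)) :=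
    ⟨measurable_shift, hinv⟩
  have hInt := integrable_of_integralGtBot hφ (hG.potential_le hc) hbot
  have hTi (i : ℕ) : MeasurePreserving (shift A)^[i] (ν : Measure (Space A)) (ν : Measure (Space A)) :=
    hT.iterate i
  have hSi (i : ℕ) : Integrable (fun x => φ ((shift A)^[i] x)) (ν : Measure (Space A)) :=
    (hTi i).integrable_comp_of_integrable hInt
  have hS : Integrable (fun x => birkhoff (shift A) φ k x) (ν : Measure (Space A)) :=
    integrable_finsetSum _ fun i _ => hSi i
  have hSint : ∫ x, birkhoff (shift A) φ k x ∂(ν : Measure (Space A)) =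
      k * ∫ x, φ x ∂(ν : Measure (Space A)) := by
    unfold birkhoff
    rw [integral_finsetSum _ fun i _ => hSi i]
    have (i : ℕ) : ∫ x, φ ((shift A)^[i] x) ∂(ν : Measure (Space A)) =
        ∫ x, φ x ∂(ν : Measure (Space A)) := by
      rw [← integral_map (f := φ) (hTi i).measurable.aemeasurable hφ.aestronglyMeasurable,
        (hTi i).map_eq]
    simp [this]
  have hmeas (m : Measure (Space A)) :
      Measurable fun x : Space A => -Real.log (m.real (cylinder A (word x k))) := by
    have : Measurable fun x : Space A => -Real.log (m.real (I ⁻¹' {I x})) :=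
      (measurable_from_top (f := fun a => -Real.log (m.real (I ⁻¹' {a})))).comp
        (show @Measurable _ _ _ ⊤ I from fun s _ => hIm s.to_countable.measurableSet)
    simpa only [hI, preimage_itin] using this
  have hnonneg (m : Measure (Space A)) [IsProbabilityMeasure m] (x : Space A) :
      0 ≤ -Real.log (m.real (cylinder A (word x k))) :=
    neg_nonneg.2 (Real.log_nonpos measureReal_nonneg (measure_real_le_one _ _))
  have hgle (x : Space A) : -Real.log (μ.real (cylinder A (word x k))) ≤
      P * k + Real.log c₀ - birkhoff (shift A) φ k x := by
    have := hG.birkhoff_le_log hc (mem_cylinder_word x k)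
    rw [length_word] at this
    linarith
  have hgint : Integrable (fun x => -Real.log (μ.real (cylinder A (word x k))))
      (ν : Measure (Space A)) := by
    refine Integrable.mono' ((integrable_const (P * k + Real.log c₀)).sub hS)
      (hmeas μ).aestronglyMeasurable (ae_of_all _ fun x => ?_)
    rw [Real.norm_of_nonneg (hnonneg μ x)]
    exact hgle x
  have hH : partitionEntropy (ν : Measure (Space A)) I =
      ∫⁻ x, ENNReal.ofReal (-Real.log ((ν : Measure (Space A)).real (cylinder A (word x k))))
        ∂(ν : Measure (Space A)) := by
    rw [partitionEntropy_eq_lintegral _ hIm]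
    simp only [hI, preimage_itin]
  have hHle : partitionEntropy (ν : Measure (Space A)) I ≤
      ∫⁻ x, ENNReal.ofReal (-Real.log (μ.real (cylinder A (word x k)))) ∂(ν : Measure (Space A)) := by
    have h := partitionEntropy_le_cross (ν : Measure (Space A)) hIm
      (fun a => μ.real (I ⁻¹' {a})) (by
        have h (a : Fin k → S) : ENNReal.ofReal (μ.real (I ⁻¹' {a})) = μ (I ⁻¹' {a}) :=
          ofReal_measureReal
        simp only [h]
        exact (tsum_fiber μ hIm).le) (ae_of_all _ fun x => by
          simp only [hI, preimage_itin]
          exact hG.real_cylinder_pos hc (mem_cylinder_word x k))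
    simpa only [hI, preimage_itin] using h
  have hHtop : partitionEntropy (ν : Measure (Space A)) I ≠ ⊤ := by
    refine ne_top_of_le_ne_top ?_ hHle
    exact ((hasFiniteIntegral_iff_ofReal (ae_of_all _ fun x => hnonneg μ x)).1 hgint.2).ne
  have hlint : Integrable (fun x => -Real.log ((ν : Measure (Space A)).real (cylinder A (word x k))))
      (ν : Measure (Space A)) := by
    refine ⟨(hmeas _).aestronglyMeasurable, ?_⟩
    rw [hasFiniteIntegral_iff_ofReal (ae_of_all _ fun x => hnonneg _ x), ← hH]
    exact hHtop.lt_top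
  set H := ∫ x, -Real.log ((ν : Measure (Space A)).real (cylinder A (word x k)))
    ∂(ν : Measure (Space A)) with hHdef
  have hH0 : 0 ≤ H := integral_nonneg fun x => hnonneg _ x
  have hHeq : partitionEntropy (ν : Measure (Space A)) I = ENNReal.ofReal H := by
    rw [hH, hHdef, ofReal_integral_eq_lintegral_ofReal hlint (ae_of_all _ fun x => hnonneg _ x)]
  have hent : entropy (shift A) (ν : Measure (Space A)) ≤ ENNReal.ofReal (H / k) :=
    entropy_le_of_generating _ hT hp₀ (fun p hp hfin δ hδ => exists_itin_approx _ hp hfin hδ) hk hH0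
      hHeq.le
  have hfeq : (fun x : Space A => Real.log (μ.real (cylinder A (word x k))) -
      Real.log ((ν : Measure (Space A)).real (cylinder A (word x k)))) =
      fun x : Space A => -Real.log ((ν : Measure (Space A)).real (cylinder A (word x k))) -
        -Real.log (μ.real (cylinder A (word x k))) := by
    funext x; ring
  have hφle : (k : ℝ) * ∫ x, φ x ∂(ν : Measure (Space A)) ≤ P * k + Real.log c₀ -
      ∫ x, -Real.log (μ.real (cylinder A (word x k))) ∂(ν : Measure (Space A)) := by
    rw [← hSint]
    have h1 : ∫ x, -Real.log (μ.real (cylinder A (word x k))) ∂(ν : Measure (Space A)) ≤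
        ∫ x, (P * k + Real.log c₀ - birkhoff (shift A) φ k x) ∂(ν : Measure (Space A)) :=
      integral_mono hgint ((integrable_const _).sub hS) hgle
    rw [integral_sub (integrable_const _) hS] at h1
    simp at h1
    simp
    linarith
  rw [hfeq]
  refine ⟨hlint.sub hgint, ?_⟩
  rw [integral_sub hlint hgint, ← hHdef, freeEnergy, if_pos ⟨hinv, hbot⟩, eintegral_eq hInt]
  have he : ((entropy (shift A) (ν : Measure (Space A)) : ℝ≥0∞) : EReal) ≤ ((H / k : ℝ) : EReal) := by
    refine (EReal.coe_ennreal_le_coe_ennreal_iff.2 hent).trans ?_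
    rw [EReal.coe_ennreal_ofReal, max_eq_left (by positivity)]
  refine (EReal.sub_le_sub (add_le_add_left he _) le_rfl).trans ?_
  rw [← EReal.coe_add, ← EReal.coe_sub, EReal.coe_le_coe_iff, ← div_eq_inv_mul, le_div_iff₀ hk0]
  have : (H / k + ∫ x, φ x ∂(ν : Measure (Space A)) - P) * k =
      H + k * (∫ x, φ x ∂(ν : Measure (Space A))) - P * k := by
    field_simp
  rw [this]
  linarith

end IsGibbsWith

end CMS

namespace CMS

variable {S : Type*} {A : S → S → Prop}

/-- The points starting with the words of `τ`, joined by connecting words from `Λ`. -/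
def concatSet (A : S → S → Prop) (Λ : Finset (List S)) : (m : ℕ) → (Fin m → List S) → Set (Space A)
  | 0, _ => univ
  | m + 1, τ => ⋃ l ∈ Λ, cylinder A (τ 0 ++ l) ∩
      (shift A)^[(τ 0 ++ l).length] ⁻¹' concatSet A Λ m fun i => τ i.succ

lemma exists_birkhoff_of_mem_concatSet {Λ : Finset (List S)} {k M : ℕ}
    (hM : ∀ l ∈ Λ, l.length ≤ M) (u : List S) (m : ℕ) (τ : Fin m → List S)
    (z : Fin m → Space A) (hτ : ∀ i, (τ i).length = k) (hz : ∀ i, z i ∈ cylinder A (τ i))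
    {x : Space A} (hx : x ∈ concatSet A Λ m τ) :
    ∃ N, m * k ≤ N ∧ N ≤ m * (k + M) ∧
      |birkhoff (shift A) ((cylinder A u).indicator fun _ => 1) N x -
        ∑ i, birkhoff (shift A) ((cylinder A u).indicator fun _ => 1) k (z i)| ≤
        m * (u.length + M) := by
  induction m generalizing x with
  | zero => exact ⟨0, by simp, by simp, by simp [birkhoff]⟩
  | succ m ih =>
    simp only [concatSet, mem_iUnion, exists_prop] at hx
    obtain ⟨l, hl, hxl, hx'⟩ := hx
    obtain ⟨N, h1, h2, h3⟩ := ih (fun i => τ i.succ) (fun i => z i.succ) (fun i => hτ _)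
      (fun i => hz _) hx'
    have hlM := hM l hl
    rw [mem_cylinder_append] at hxl
    set f : Space A → ℝ := (cylinder A u).indicator fun _ => 1 with hf
    refine ⟨k + l.length + N, by rw [Nat.succ_mul]; omega, by rw [Nat.succ_mul]; omega, ?_⟩
    have hlen : (τ 0 ++ l).length = k + l.length := by simp [hτ]
    rw [hlen] at h3
    rw [birkhoff_add, birkhoff_add, Fin.sum_univ_succ]
    have e1 : |birkhoff (shift A) f k x - birkhoff (shift A) f k (z 0)| ≤ u.length := by
      refine abs_birkhoff_indicator_sub_le fun i hi => ?_
      have ha := mem_cylinder.1 hxl.1 i (by rw [hτ]; exact hi)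
      have hb := mem_cylinder.1 (hz 0) i (by rw [hτ]; exact hi)
      rw [ha, hb]
    have e2 := birkhoff_indicator_nonneg (shift A) (cylinder A u) l.length ((shift A)^[k] x)
    have e3 := birkhoff_indicator_le (shift A) (cylinder A u) l.length ((shift A)^[k] x)
    have e4 : (l.length : ℝ) ≤ M := by exact_mod_cast hlM
    rw [← hf] at e2 e3
    rw [abs_le] at e1 h3 ⊢
    push_cast
    constructor <;> linarith [e1.1, e1.2, h3.1, h3.2]

variable [Countable S] [TopologicalSpace S] [DiscreteTopology S]

lemma measurableSet_concatSet (Λ : Finset (List S)) (m : ℕ) (τ : Fin m → List S) :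
    MeasurableSet (concatSet A Λ m τ) := by
  induction m with
  | zero => exact MeasurableSet.univ
  | succ m ih =>
    exact Finset.measurableSet_biUnion _ fun l _ =>
      (measurableSet_cylinder _).inter (measurable_iterate_shift _ (ih _))

lemma le_measure_iUnion_concatSet {μ : Measure (Space A)} {Λ : Finset (List S)} {κ : ℝ≥0∞}
    (hκ : ∀ w : List S, Admissible A w → ∀ s : Set (Space A), MeasurableSet s →
      κ * μ (cylinder A w) * μ s ≤
        ∑ l ∈ Λ, μ (cylinder A (w ++ l) ∩ (shift A)^[(w ++ l).length] ⁻¹' s)) [IsProbabilityMeasure μ]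
    (k m : ℕ) (E : Set (Fin m → List S))
    (hE : ∀ τ ∈ E, ∀ i, Admissible A (τ i) ∧ (τ i).length = k) :
    κ ^ m * ∑' τ, E.indicator (fun τ => ∏ i, μ (cylinder A (τ i))) τ ≤
      (Λ.card : ℝ≥0∞) ^ m * μ (⋃ τ ∈ E, concatSet A Λ m τ) := by
  induction m with
  | zero =>
    simp only [pow_zero, one_mul, concatSet, Finset.univ_eq_empty, Finset.prod_empty]
    rw [tsum_eq_single (default : Fin 0 → List S) fun b hb => (hb (Subsingleton.elim _ _)).elim]
    by_cases h : default ∈ E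
    · rw [indicator_of_mem h, biUnion_const ⟨_, h⟩]
      simp
    · rw [indicator_of_notMem h]
      exact zero_le
  | succ m ih =>
    set Ew : List S → Set (Fin m → List S) := fun w => {τ | (Fin.cons w τ : Fin (m + 1) → List S) ∈ E}
      with hEw
    set B : List S → Set (Space A) := fun w => ⋃ τ ∈ Ew w, concatSet A Λ m τ with hB
    have hBm (w : List S) : MeasurableSet (B w) :=
      MeasurableSet.biUnion (to_countable _) fun τ _ => measurableSet_concatSet Λ m τ
    have hsum : ∑' τ, E.indicator (fun τ => ∏ i, μ (cylinder A (τ i))) τ =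
        ∑' w, μ (cylinder A w) * ∑' τ, (Ew w).indicator (fun τ => ∏ i, μ (cylinder A (τ i))) τ := by
      rw [← (Fin.consEquiv fun _ => List S).tsum_eq, ENNReal.tsum_prod']
      refine tsum_congr fun w => ?_
      rw [← ENNReal.tsum_mul_left]
      refine tsum_congr fun τ => ?_
      by_cases h : (Fin.cons w τ : Fin (m + 1) → List S) ∈ E
      · have h' : τ ∈ Ew w := h
        have h2 : (Fin.consEquiv fun _ => List S) (w, τ) ∈ E := h
        rw [indicator_of_mem h', indicator_of_mem h2, Fin.prod_univ_succ]
        rfl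
      · have h' : τ ∉ Ew w := h
        have h2 : (Fin.consEquiv fun _ => List S) (w, τ) ∉ E := h
        rw [indicator_of_notMem h', indicator_of_notMem h2, mul_zero]
    have hterm (w : List S) : κ * μ (cylinder A w) * μ (B w) ≤
        ∑ l ∈ Λ, μ (cylinder A (w ++ l) ∩ (shift A)^[(w ++ l).length] ⁻¹' B w) := by
      rcases (Ew w).eq_empty_or_nonempty with h | ⟨τ, hτ⟩
      · simp [hB, h]
      · exact hκ w (by simpa using (hE _ hτ 0).1) _ (hBm w)
    have hdisj (l : List S) (hl : l ∈ Λ) :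
        ∑' w, μ (cylinder A (w ++ l) ∩ (shift A)^[(w ++ l).length] ⁻¹' B w) ≤
          μ (⋃ τ ∈ E, concatSet A Λ (m + 1) τ) := by
      rw [← measure_iUnion]
      · refine measure_mono (iUnion_subset fun w x hx => ?_)
        obtain ⟨hx1, hx2⟩ := hx
        simp only [hB, mem_preimage, mem_iUnion, exists_prop] at hx2
        obtain ⟨τ, hτ, hx3⟩ := hx2
        refine mem_iUnion₂.2 ⟨Fin.cons w τ, hτ, ?_⟩
        simp only [concatSet, mem_iUnion, exists_prop]
        exact ⟨l, hl, by simpa using hx1, by simpa using hx3⟩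
      · intro v w hvw
        have hlen (w : List S) (x : Space A)
            (hx : x ∈ cylinder A (w ++ l) ∩ (shift A)^[(w ++ l).length] ⁻¹' B w) : w.length = k := by
          obtain ⟨-, hx2⟩ := hx
          simp only [hB, mem_preimage, mem_iUnion, exists_prop] at hx2
          obtain ⟨τ, hτ, -⟩ := hx2
          simpa using (hE _ hτ 0).2
        refine disjoint_left.2 fun x hx hx' => ?_
        have := disjoint_cylinder (A := A) ((hlen v x hx).trans (hlen w x hx').symm) hvw
        exact disjoint_left.1 this (cylinder_append_subset _ _ hx.1) (cylinder_append_subset _ _ hx'.1)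
      · exact fun w => (measurableSet_cylinder _).inter (measurable_iterate_shift _ (hBm w))
    calc κ ^ (m + 1) * ∑' τ, E.indicator (fun τ => ∏ i, μ (cylinder A (τ i))) τ
        = ∑' w, κ * μ (cylinder A w) *
            (κ ^ m * ∑' τ, (Ew w).indicator (fun τ => ∏ i, μ (cylinder A (τ i))) τ) := by
          rw [hsum, ← ENNReal.tsum_mul_left]
          exact tsum_congr fun w => by ring
      _ ≤ ∑' w, κ * μ (cylinder A w) * ((Λ.card : ℝ≥0∞) ^ m * μ (B w)) := by
          refine ENNReal.tsum_le_tsum fun w => mul_le_mul_right (ih (Ew w) fun τ hτ i => ?_) _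
          simpa using hE _ hτ i.succ
      _ = (Λ.card : ℝ≥0∞) ^ m * ∑' w, κ * μ (cylinder A w) * μ (B w) := by
          rw [← ENNReal.tsum_mul_left]
          exact tsum_congr fun w => by ring
      _ ≤ (Λ.card : ℝ≥0∞) ^ m * ∑' w, ∑ l ∈ Λ,
            μ (cylinder A (w ++ l) ∩ (shift A)^[(w ++ l).length] ⁻¹' B w) :=
          mul_le_mul_right (ENNReal.tsum_le_tsum hterm) _
      _ = (Λ.card : ℝ≥0∞) ^ m * ∑ l ∈ Λ, ∑' w,
            μ (cylinder A (w ++ l) ∩ (shift A)^[(w ++ l).length] ⁻¹' B w) := by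
          rw [Summable.tsum_finsetSum fun _ _ => ENNReal.summable]
      _ ≤ (Λ.card : ℝ≥0∞) ^ m * ∑ l ∈ Λ, μ (⋃ τ ∈ E, concatSet A Λ (m + 1) τ) :=
          mul_le_mul_right (Finset.sum_le_sum hdisj) _
      _ = _ := by
          rw [Finset.sum_const, nsmul_eq_mul, pow_succ, mul_assoc]

end CMS

namespace CMS

lemma exists_measure_average_ge {X J : Type*} [MeasurableSpace X] (ν : Measure X)
    [IsProbabilityMeasure ν] (s : Finset J) (f : J → X → ℝ) (hf : ∀ j, Measurable (f j))
    (hi : ∀ j, Integrable (f j) ν) :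
    ∃ m₀, ∀ m, m₀ ≤ m → 2⁻¹ ≤ (Measure.infinitePi fun _ : ℕ => ν)
      {ω | ∀ j ∈ s, |∑ i : Fin m, f j (ω i) - m * ∫ x, f j x ∂ν| ≤ m} := by
  set Q := Measure.infinitePi fun _ : ℕ => ν
  set Γ : ℕ → Set (ℕ → X) := fun n =>
    {ω | ∀ m, n ≤ m → ∀ j ∈ s, |∑ i : Fin m, f j (ω i) - m * ∫ x, f j x ∂ν| ≤ m} with hΓ
  have hmono : Monotone Γ := fun n n' h ω hω m hm => hω m (h.trans hm)
  have hj (j : J) : ∀ᵐ ω ∂Q, Tendsto (fun n : ℕ => (∑ i ∈ Finset.range n, f j (ω i)) / n) atTop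
      (𝓝 (∫ x, f j x ∂ν)) := by
    have hev (i : ℕ) : MeasurePreserving (Function.eval i) Q ν :=
      measurePreserving_eval_infinitePi (fun _ : ℕ => ν) i
    have hInt : Integrable (fun ω : ℕ → X => f j (ω 0)) Q :=
      (hev 0).integrable_comp_of_integrable (hi j)
    have hind := ProbabilityTheory.iIndepFun_infinitePi (P := fun _ : ℕ => ν)
      (X := fun _ : ℕ => f j) fun _ => hf j
    have h := ProbabilityTheory.strong_law_ae_real (μ := Q) (fun i ω => f j (ω i)) hInt
      (fun i i' hii => hind.indepFun hii) (fun i => by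
        refine ⟨((hf j).comp (measurable_pi_apply i)).aemeasurable,
          ((hf j).comp (measurable_pi_apply 0)).aemeasurable, ?_⟩
        have (i : ℕ) : Measure.map (fun ω : ℕ → X => f j (ω i)) Q = Measure.map (f j) ν := by
          rw [← (hev i).map_eq, Measure.map_map (hf j) (hev i).measurable]
          rfl
        rw [this, this])
    have h0 : ∫ ω, f j (ω 0) ∂Q = ∫ x, f j x ∂ν := by
      rw [← (hev 0).map_eq, integral_map (hev 0).measurable.aemeasurable
        (hf j).aestronglyMeasurable]
    simpa only [h0] using h
  have hae : ∀ᵐ ω ∂Q, ω ∈ ⋃ n, Γ n := by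
    have h := (ae_ball_iff s.countable_toSet).2 fun j _ => hj j
    filter_upwards [h] with ω hω
    have h2 : ∀ᶠ m : ℕ in atTop, ∀ j ∈ s, |∑ i : Fin m, f j (ω i) - m * ∫ x, f j x ∂ν| ≤ m := by
      rw [eventually_all_finset]
      intro j hj
      have h3 := (Metric.tendsto_atTop.1 (hω j hj)) 1 one_pos
      obtain ⟨N, hN⟩ := h3
      filter_upwards [eventually_ge_atTop (max N 1)] with m hm
      have hm0 : (0 : ℝ) < m := by exact_mod_cast (le_max_right _ _).trans hm
      have h4 := (hN m ((le_max_left _ _).trans hm)).le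
      rw [Real.dist_eq, Finset.sum_range] at h4
      have h5 : ∑ i : Fin m, f j (ω i) - m * ∫ x, f j x ∂ν =
          m * ((∑ i : Fin m, f j (ω i)) / m - ∫ x, f j x ∂ν) := by
        field_simp
      rw [h5, abs_mul, abs_of_pos hm0]
      nlinarith
    obtain ⟨n, hn⟩ := eventually_atTop.1 h2
    exact mem_iUnion.2 ⟨n, hn⟩
  have hlim := tendsto_measure_iUnion_atTop (μ := Q) hmono
  have h1 : Q (⋃ n, Γ n) = 1 := (measure_congr (eventuallyEq_univ.2 hae)).trans measure_univ
  rw [h1] at hlim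
  obtain ⟨m₀, hm₀⟩ := (hlim.eventually_const_le (show (2⁻¹ : ℝ≥0∞) < 1 by
    rw [ENNReal.inv_lt_one]; norm_num)).exists
  refine ⟨m₀, fun m hm => hm₀.trans (measure_mono fun ω hω => hω m hm)⟩

variable {S : Type*} [Countable S] [TopologicalSpace S] [DiscreteTopology S] {A : S → S → Prop}

lemma measurable_comp_word {β : Type*} [MeasurableSpace β] (k : ℕ) (g : List S → β) :
    Measurable fun x : Space A => g (word x k) := fun s _ => measurable_word k (g ⁻¹' s)

lemma measurable_birkhoff {X : Type*} [MeasurableSpace X] {T : X → X} (hT : Measurable T) {f : X → ℝ}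
    (hf : Measurable f) (n : ℕ) : Measurable (birkhoff T f n) := by
  unfold birkhoff
  exact Finset.measurable_sum _ fun i _ => hf.comp (hT.iterate i)

lemma integrable_birkhoff_indicator {X : Type*} [MeasurableSpace X] {T : X → X} (hT : Measurable T)
    (ν : Measure X) [IsFiniteMeasure ν] {s : Set X} (hs : MeasurableSet s) (n : ℕ) :
    Integrable (birkhoff T (s.indicator fun _ => 1) n) ν := by
  refine Integrable.mono' (integrable_const (n : ℝ))
    (measurable_birkhoff hT (measurable_const.indicator hs) n).aestronglyMeasurable
    (ae_of_all _ fun x => ?_)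
  rw [Real.norm_of_nonneg (birkhoff_indicator_nonneg _ _ _ _)]
  exact birkhoff_indicator_le _ _ _ _

lemma integral_birkhoff_indicator {X : Type*} [MeasurableSpace X] {T : X → X} {ν : Measure X}
    [IsFiniteMeasure ν] (hT : MeasurePreserving T ν ν) {s : Set X} (hs : MeasurableSet s) (n : ℕ) :
    ∫ x, birkhoff T (s.indicator fun _ => 1) n x ∂ν = n * ν.real s := by
  have hi : Integrable (s.indicator fun _ => (1 : ℝ)) ν := (integrable_const _).indicator hs
  unfold birkhoff
  have hi' (i : ℕ) : Integrable (fun x => s.indicator (fun _ => (1 : ℝ)) (T^[i] x)) ν :=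
    (hT.iterate i).integrable_comp_of_integrable hi
  rw [integral_finsetSum _ fun i _ => hi' i]
  have (i : ℕ) : ∫ x, s.indicator (fun _ => (1 : ℝ)) (T^[i] x) ∂ν = ν.real s := by
    rw [← integral_map (f := s.indicator fun _ => (1 : ℝ)) (hT.iterate i).measurable.aemeasurable
      (measurable_const.indicator hs).aestronglyMeasurable, (hT.iterate i).map_eq,
      integral_indicator_const _ hs]
    simp
  simp [this]

lemma infinitePi_word_eq (ν : Measure (Space A)) [IsProbabilityMeasure ν] {k m : ℕ}
    {τ : Fin m → List S} (hτ : ∀ i, (τ i).length = k) :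
    (Measure.infinitePi fun _ : ℕ => ν) {ω | ∀ i : Fin m, word (ω i) k = τ i} =
      ∏ i, ν (cylinder A (τ i)) := by
  classical
  have h := Measure.infinitePi_pi (fun _ : ℕ => ν) (s := Finset.range m)
    (t := fun i => if h : i < m then cylinder A (τ ⟨i, h⟩) else univ) (by
      intro i hi
      rw [dif_pos (Finset.mem_range.1 hi)]
      exact measurableSet_cylinder _)
  rw [Finset.prod_range] at h
  simp only [Fin.is_lt, dite_true, Fin.eta] at h
  rw [← h]
  congr 1
  ext ω
  simp only [Set.mem_pi, Finset.coe_range, mem_Iio]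
  constructor
  · intro hω i hi
    rw [dif_pos hi, mem_cylinder_iff_word, hτ]
    exact hω ⟨i, hi⟩
  · intro hω i
    have := hω i i.2
    rw [dif_pos i.2, mem_cylinder_iff_word, hτ] at this
    exact this

lemma exists_good_words {μ : Measure (Space A)} [IsProbabilityMeasure μ]
    (hpos : ∀ (x : Space A) n, 0 < μ.real (cylinder A (word x n)))
    {ν : Measure (Space A)} [IsProbabilityMeasure ν] (hinv : Invariant (shift A) ν) (k : ℕ)
    (hInt : Integrable (fun x => Real.log (μ.real (cylinder A (word x k))) -
      Real.log (ν.real (cylinder A (word x k)))) ν) {D : ℝ}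
    (hD : D = ∫ x, (Real.log (μ.real (cylinder A (word x k))) -
      Real.log (ν.real (cylinder A (word x k)))) ∂ν) (U : Finset (List S)) :
    ∃ m₀, ∀ m, m₀ ≤ m → ∃ E : Set (Fin m → List S),
      (∀ τ ∈ E, ∃ z : Fin m → Space A, (∀ i, τ i = word (z i) k) ∧ ∀ u ∈ U,
        |∑ i, birkhoff (shift A) ((cylinder A u).indicator fun _ => 1) k (z i) -
          m * (k * ν.real (cylinder A u))| ≤ m) ∧
      ENNReal.ofReal (Real.exp (m * (D - 1))) * 2⁻¹ ≤
        ∑' τ, E.indicator (fun τ => ∏ i, μ (cylinder A (τ i))) τ := by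
  classical
  set f : Option (List S) → Space A → ℝ := fun j => match j with
    | none => fun x => Real.log (μ.real (cylinder A (word x k))) -
      Real.log (ν.real (cylinder A (word x k)))
    | some u => birkhoff (shift A) ((cylinder A u).indicator fun _ => 1) k with hf
  have hT : MeasurePreserving (shift A) ν ν := ⟨measurable_shift, hinv⟩
  obtain ⟨m₀, hm₀⟩ := exists_measure_average_ge ν (insert none (U.image some)) f
    (by
      rintro (_ | u)
      · exact measurable_comp_word k fun w =>
          Real.log (μ.real (cylinder A w)) - Real.log (ν.real (cylinder A w))
      · exact measurable_birkhoff measurable_shift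
          (measurable_const.indicator (measurableSet_cylinder u)) k)
    (by
      rintro (_ | u)
      · exact hInt
      · exact integrable_birkhoff_indicator measurable_shift ν (measurableSet_cylinder u) k)
  refine ⟨m₀, fun m hm => ?_⟩
  set E : Set (Fin m → List S) := {τ | ∃ z : Fin m → Space A, (∀ i, τ i = word (z i) k) ∧
    |∑ i, f none (z i) - m * D| ≤ m ∧ ∀ u ∈ U,
        |∑ i, birkhoff (shift A) ((cylinder A u).indicator fun _ => 1) k (z i) -
          m * (k * ν.real (cylinder A u))| ≤ m} with hE
  refine ⟨E, fun τ ⟨z, hz, _, hzu⟩ => ⟨z, hz, hzu⟩, ?_⟩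
  have hsub : {ω : ℕ → Space A | ∀ j ∈ insert none (U.image some),
      |∑ i : Fin m, f j (ω i) - m * ∫ x, f j x ∂ν| ≤ m} ⊆
      ⋃ τ ∈ E, {ω | ∀ i : Fin m, word (ω i) k = τ i} := by
    intro ω hω
    refine mem_iUnion₂.2 ⟨fun i => word (ω i) k, ⟨fun i => ω i, fun _ => rfl, ?_, fun u hu => ?_⟩,
      fun _ => rfl⟩
    · rw [hD]
      exact hω none (by simp)
    · have := hω (some u) (by simp [hu])
      simp only [hf] at this
      rwa [integral_birkhoff_indicator hT (measurableSet_cylinder u)] at this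
  have hlow : (2⁻¹ : ℝ≥0∞) ≤ ∑' τ : E, ∏ i, ν (cylinder A ((τ : Fin m → List S) i)) := by
    refine (hm₀ m hm).trans ((measure_mono hsub).trans
      ((measure_biUnion_le _ (to_countable E) _).trans (ENNReal.tsum_le_tsum fun τ => ?_)))
    obtain ⟨z, hz, -⟩ := τ.2
    rw [infinitePi_word_eq ν fun i => by rw [hz i, length_word]]
  have hterm (τ : Fin m → List S) (hτ : τ ∈ E) :
      ENNReal.ofReal (Real.exp (m * (D - 1))) * ∏ i, ν (cylinder A (τ i)) ≤
        ∏ i, μ (cylinder A (τ i)) := by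
    obtain ⟨z, hz, hz0, -⟩ := hτ
    have e (m' : Measure (Space A)) [IsProbabilityMeasure m'] (w : List S) :
        m' (cylinder A w) = ENNReal.ofReal (m'.real (cylinder A w)) := by
      rw [ofReal_measureReal]
    simp_rw [e ν, e μ]
    rw [← ENNReal.ofReal_prod_of_nonneg fun _ _ => measureReal_nonneg,
      ← ENNReal.ofReal_prod_of_nonneg fun _ _ => measureReal_nonneg,
      ← ENNReal.ofReal_mul (Real.exp_nonneg _)]
    refine ENNReal.ofReal_le_ofReal ?_
    by_cases h0 : ∃ i, ν.real (cylinder A (τ i)) = 0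
    · obtain ⟨i, hi⟩ := h0
      rw [Finset.prod_eq_zero (Finset.mem_univ i) hi, mul_zero]
      exact Finset.prod_nonneg fun _ _ => measureReal_nonneg
    · push Not at h0
      have hν (i : Fin m) : 0 < ν.real (cylinder A (τ i)) := measureReal_nonneg.lt_of_ne' (h0 i)
      have hμ (i : Fin m) : 0 < μ.real (cylinder A (τ i)) := by rw [hz i]; exact hpos _ _
      have hprod (m' : Measure (Space A)) (h : ∀ i, 0 < m'.real (cylinder A (τ i))) :
          ∏ i, m'.real (cylinder A (τ i)) = Real.exp (∑ i, Real.log (m'.real (cylinder A (τ i)))) := by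
        rw [Real.exp_sum]
        exact Finset.prod_congr rfl fun i _ => (Real.exp_log (h i)).symm
      rw [hprod ν hν, hprod μ hμ, ← Real.exp_add, Real.exp_le_exp]
      have h1 : ∑ i, f none (z i) = ∑ i, Real.log (μ.real (cylinder A (τ i))) -
          ∑ i, Real.log (ν.real (cylinder A (τ i))) := by
        rw [← Finset.sum_sub_distrib]
        exact Finset.sum_congr rfl fun i _ => by rw [hz i]
      rw [h1, abs_le] at hz0
      linarith [hz0.1]
  rw [← tsum_subtype E fun τ => ∏ i, μ (cylinder A (τ i))]
  calc _ ≤ ENNReal.ofReal (Real.exp (m * (D - 1))) *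
        ∑' τ : E, ∏ i, ν (cylinder A ((τ : Fin m → List S) i)) := mul_le_mul_right hlow _
    _ ≤ _ := by
      rw [← ENNReal.tsum_mul_left]
      exact ENNReal.tsum_le_tsum fun τ => hterm τ τ.2

end CMS

namespace CMS

variable {S : Type*} [Countable S] [TopologicalSpace S] [DiscreteTopology S] {A : S → S → Prop}

lemma empirical_mem_nbd_of_concatSet {ν : ProbabilityMeasure (Space A)} {U : Finset (List S)}
    {Λ : Finset (List S)} {k m n M r : ℕ} {ε : ℝ} (hn : 1 ≤ n) (hk : 1 ≤ k) (hm : m = n / k + 1)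
    (hM : ∀ l ∈ Λ, l.length ≤ M) (hr : ∀ u ∈ U, u.length ≤ r) {τ : Fin m → List S}
    {z : Fin m → Space A} (hτ : ∀ i, τ i = word (z i) k)
    (hz : ∀ u ∈ U, |∑ i, birkhoff (shift A) ((cylinder A u).indicator fun _ => 1) k (z i) -
      m * (k * (ν : Measure (Space A)).real (cylinder A u))| ≤ m)
    (hε : ((2 * M + r + 1 : ℕ) : ℝ) / k + ((2 * M + r + 1 + 2 * k : ℕ) : ℝ) / n < ε)
    {x : Space A} (hx : x ∈ concatSet A Λ m τ) : empirical (shift A) x n ∈ nbd ν U ε := by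
  intro u hu
  obtain ⟨N, hN1, hN2, hN3⟩ := exists_birkhoff_of_mem_concatSet hM u m τ z
    (fun i => by rw [hτ, length_word]) (fun i => by rw [hτ]; exact mem_cylinder_word _ _) hx
  rw [empirical_real_apply _ _ hn (measurableSet_cylinder u)]
  set a := (ν : Measure (Space A)).real (cylinder A u) with ha
  have ha0 : 0 ≤ a := measureReal_nonneg
  have ha1 : a ≤ 1 := measure_real_le_one _ _
  set f : Space A → ℝ := (cylinder A u).indicator fun _ => 1 with hf
  have hn0 : (0 : ℝ) < n := by exact_mod_cast hn
  have hk0 : (0 : ℝ) < k := by exact_mod_cast hk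
  have hnk1 : n ≤ m * k := by
    rw [hm]
    have := Nat.div_add_mod n k
    have := Nat.mod_lt n hk
    nlinarith
  have hnk2 : m * k ≤ n + k := by
    rw [hm, add_mul, one_mul]
    exact Nat.add_le_add_right (Nat.div_mul_le_self n k) k
  obtain ⟨q, rfl⟩ := Nat.exists_eq_add_of_le (hnk1.trans hN1)
  rw [birkhoff_add] at hN3
  have e1 := birkhoff_indicator_nonneg (shift A) (cylinder A u) q ((shift A)^[n] x)
  have e2 := birkhoff_indicator_le (shift A) (cylinder A u) q ((shift A)^[n] x)
  rw [← hf] at e1 e2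
  have e3 : (q : ℝ) ≤ m * M + k := by
    have : q ≤ m * M + k := by nlinarith
    exact_mod_cast this
  have e4 : ((m : ℝ) * k) * a ≤ n * a + k := by
    have h : (m : ℝ) * k ≤ n + k := by exact_mod_cast hnk2
    nlinarith
  have e5 : (n : ℝ) * a ≤ (m * k) * a := by
    have h : (n : ℝ) ≤ m * k := by exact_mod_cast hnk1
    gcongr
  have e6 : (m : ℝ) * u.length ≤ m * r := by
    have : (u.length : ℝ) ≤ r := by exact_mod_cast hr u hu
    gcongr
  have e7 := hz u hu
  have e8 : (m : ℝ) ≤ n / k + 1 := by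
    rw [← sub_le_iff_le_add, le_div_iff₀ hk0]
    have h : (m : ℝ) * k ≤ n + k := by exact_mod_cast hnk2
    linarith
  have hmain : |birkhoff (shift A) f n x - n * a| ≤ m * ((2 * M + r + 1 : ℕ) : ℝ) + 2 * k := by
    rw [abs_le] at hN3 e7 ⊢
    push_cast
    constructor <;> nlinarith [hN3.1, hN3.2, e7.1, e7.2]
  have hrew : (n : ℝ)⁻¹ * birkhoff (shift A) f n x - a =
      (n : ℝ)⁻¹ * (birkhoff (shift A) f n x - n * a) := by
    field_simp
  rw [hrew, abs_mul, abs_of_pos (by positivity : (0 : ℝ) < (n : ℝ)⁻¹)]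
  refine lt_of_le_of_lt ?_ hε
  calc (n : ℝ)⁻¹ * |birkhoff (shift A) f n x - n * a|
      ≤ (n : ℝ)⁻¹ * ((n / k + 1) * ((2 * M + r + 1 : ℕ) : ℝ) + 2 * k) := by
        gcongr
        refine hmain.trans ?_
        gcongr
    _ = _ := by
        push_cast
        field_simp
        ring

namespace IsGibbsWith

variable {φ : Space A → ℝ} {μ : Measure (Space A)} [IsProbabilityMeasure μ] {c₀ P : ℝ}

lemma exists_le_measure_nbd (hG : IsGibbsWith A φ μ c₀ P) (hc : 1 ≤ c₀) (hφ : Measurable φ)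
    (hA : NoZeroRowCol A) {Λ : Finset (List S)}
    (hΛ : ∀ v w : List S, Admissible A v → Admissible A w → ∃ l ∈ Λ, Admissible A (v ++ l ++ w))
    {ν : ProbabilityMeasure (Space A)} (hinv : Invariant (shift A) (ν : Measure (Space A)))
    (hbot : IntegralGtBot φ (ν : Measure (Space A))) (U : Finset (List S)) {ε : ℝ} (hε : 0 < ε) :
    ∃ (C : ℝ) (k₀ : ℕ), ∀ k, k₀ ≤ k → ∃ (D : ℝ) (n₀ : ℕ),
      freeEnergy (shift A) φ P ν ≤ (((k : ℝ)⁻¹ * (D + C) : ℝ) : EReal) ∧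
      ∀ n, n₀ ≤ n → ENNReal.ofReal (Real.exp (((n / k + 1 : ℕ) : ℝ) * (D - C) - Real.log 2)) ≤
        μ {x | empirical (shift A) x n ∈ nbd ν U ε} := by
  obtain ⟨κ, hκ0, hκ⟩ := hG.exists_le_sum hc hA hΛ
  obtain ⟨M, hM⟩ : ∃ M, ∀ l ∈ Λ, l.length ≤ M := ⟨Λ.sup List.length, fun l hl => Finset.le_sup hl⟩
  obtain ⟨r, hr⟩ : ∃ r, ∀ l ∈ U, l.length ≤ r := ⟨U.sup List.length, fun l hl => Finset.le_sup hl⟩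
  have hΛ0 : 0 < Λ.card := by
    obtain ⟨x₀⟩ : Nonempty (Space A) := by
      by_contra h
      rw [not_nonempty_iff] at h
      have := measure_univ (μ := μ)
      rw [univ_eq_empty_iff.2 h] at this
      simp at this
    have hw := admissible_word x₀ (le_refl 1)
    obtain ⟨l, hl, -⟩ := hΛ _ _ hw hw
    exact Finset.card_pos.2 ⟨l, hl⟩
  have hΛ0' : (0 : ℝ) < Λ.card := by exact_mod_cast hΛ0
  obtain ⟨k₁, hk₁⟩ := exists_nat_gt (((2 * M + r + 1 : ℕ) : ℝ) / (ε / 2))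
  set κ' : ℝ := κ / Λ.card with hκ'
  have hκ'0 : 0 < κ' := by positivity
  refine ⟨Real.log c₀ + 1 + |Real.log κ'|, max k₁ 1, fun k hkk => ?_⟩
  have hk : 1 ≤ k := (le_max_right _ _).trans hkk
  have hk0 : (0 : ℝ) < k := by exact_mod_cast hk
  obtain ⟨hInt, hF⟩ := hG.freeEnergy_le hc hφ hinv hbot hk
  set D := ∫ x, (Real.log (μ.real (cylinder A (word x k))) -
      Real.log ((ν : Measure (Space A)).real (cylinder A (word x k)))) ∂(ν : Measure (Space A)) with hD
  obtain ⟨m₀, hm₀⟩ := exists_good_words (fun x n => hG.real_cylinder_pos hc (mem_cylinder_word x n))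
    hinv k hInt hD U
  obtain ⟨n₁, hn₁⟩ := exists_nat_gt (((2 * M + r + 1 + 2 * k : ℕ) : ℝ) / (ε / 2))
  refine ⟨D, max (max n₁ 1) (k * m₀), hF.trans ?_, fun n hn => ?_⟩
  · rw [EReal.coe_le_coe_iff]
    gcongr
    linarith [abs_nonneg (Real.log κ')]
  have hn1 : 1 ≤ n := (le_max_right _ _).trans ((le_max_left _ _).trans hn)
  have hnn1 : n₁ ≤ n := (le_max_left _ _).trans ((le_max_left _ _).trans hn)
  have hn0 : (0 : ℝ) < n := by exact_mod_cast hn1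
  set m := n / k + 1 with hm
  obtain ⟨E, hE, hEsum⟩ := hm₀ m (by
    have : m₀ ≤ n / k := (Nat.le_div_iff_mul_le hk).2 (by
      rw [mul_comm]; exact (le_max_right _ _).trans hn)
    omega)
  have hB := le_measure_iUnion_concatSet (μ := μ) hκ k m E (fun τ hτ i => by
    obtain ⟨z, hz, -⟩ := hE τ hτ
    rw [hz i]
    exact ⟨admissible_word _ hk, length_word _ _⟩)
  refine le_trans ?_ (measure_mono (show (⋃ τ ∈ E, concatSet A Λ m τ) ⊆ _ from ?_))
  · have h1 := (mul_le_mul_right hEsum (ENNReal.ofReal κ ^ m)).trans hB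
    rw [← ENNReal.ofReal_pow hκ0.le, show (2⁻¹ : ℝ≥0∞) = ENNReal.ofReal 2⁻¹ by
      rw [ENNReal.ofReal_inv_of_pos two_pos]; simp, ← ENNReal.ofReal_mul (by positivity),
      ← ENNReal.ofReal_mul (by positivity),
      ← ofReal_measureReal (measure_ne_top μ _), ← ENNReal.ofReal_natCast Λ.card,
      ← ENNReal.ofReal_pow (by positivity), ← ENNReal.ofReal_mul (by positivity),
      ENNReal.ofReal_le_ofReal_iff (by positivity)] at h1
    rw [← ofReal_measureReal (measure_ne_top μ _)]
    refine ENNReal.ofReal_le_ofReal ?_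
    have h2 : κ' ^ m * (Real.exp (m * (D - 1)) * 2⁻¹) ≤ μ.real (⋃ τ ∈ E, concatSet A Λ m τ) := by
      rw [hκ', div_pow, div_mul_eq_mul_div, div_le_iff₀ (by positivity), mul_comm (μ.real _)]
      exact h1
    refine le_trans ?_ h2
    have h3 : κ' ^ m = Real.exp (m * Real.log κ') := by
      rw [Real.exp_nat_mul, Real.exp_log hκ'0]
    have h4 : (2⁻¹ : ℝ) = Real.exp (-Real.log 2) := by
      rw [Real.exp_neg, Real.exp_log two_pos]
    rw [h3, h4, ← Real.exp_add, ← Real.exp_add, Real.exp_le_exp]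
    have h5 : (m : ℝ) * (D - (Real.log c₀ + 1 + |Real.log κ'|)) ≤ m * (Real.log κ' + (D - 1)) := by
      refine mul_le_mul_of_nonneg_left ?_ (by positivity)
      linarith [Real.log_nonneg hc, neg_abs_le (Real.log κ')]
    linarith
  · refine iUnion₂_subset fun τ hτ x hx => ?_
    obtain ⟨z, hz, hzu⟩ := hE τ hτ
    refine empirical_mem_nbd_of_concatSet hn1 hk hm hM hr hz hzu ?_ hx
    have a1 : ((2 * M + r + 1 : ℕ) : ℝ) / k < ε / 2 := by
      rw [div_lt_iff₀ hk0]
      rw [div_lt_iff₀ (by positivity)] at hk₁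
      have : (k₁ : ℝ) ≤ k := by exact_mod_cast (le_max_left _ _).trans hkk
      nlinarith
    have a2 : ((2 * M + r + 1 + 2 * k : ℕ) : ℝ) / n < ε / 2 := by
      rw [div_lt_iff₀ hn0]
      rw [div_lt_iff₀ (by positivity)] at hn₁
      have : (n₁ : ℝ) ≤ n := by exact_mod_cast hnn1
      nlinarith
    linarith

end IsGibbsWith

end CMS

namespace CMS

section Rate

variable {m : ℕ → ℝ≥0∞} {c : ℝ}

lemma le_liminf_rate (h : ∀ᶠ n : ℕ in atTop, ENNReal.ofReal (Real.exp (n * c)) ≤ m n) :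
    (c : EReal) ≤ atTop.liminf fun n : ℕ => (((n : ℝ)⁻¹ : ℝ) : EReal) * ENNReal.log (m n) := by
  refine le_liminf_of_le (by isBoundedDefault) ?_
  filter_upwards [h, eventually_ge_atTop 1] with n hn h1
  have hn0 : (0 : ℝ) < n := by exact_mod_cast h1
  have h2 : ((n * c : ℝ) : EReal) ≤ ENNReal.log (m n) := by
    rw [← EReal.exp_le_exp_iff, ENNReal.exp_log]
    exact hn
  calc (c : EReal) = (((n : ℝ)⁻¹ : ℝ) : EReal) * ((n * c : ℝ) : EReal) := by
        rw [← EReal.coe_mul, inv_mul_cancel_left₀ hn0.ne']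
    _ ≤ _ := mul_le_mul_of_nonneg_left h2 (EReal.coe_nonneg.2 (by positivity))

lemma limsup_rate_le (h : ∀ᶠ n : ℕ in atTop, m n ≤ ENNReal.ofReal (Real.exp (n * c))) :
    (atTop.limsup fun n : ℕ => (((n : ℝ)⁻¹ : ℝ) : EReal) * ENNReal.log (m n)) ≤ (c : EReal) := by
  refine limsup_le_of_le (by isBoundedDefault) ?_
  filter_upwards [h, eventually_ge_atTop 1] with n hn h1
  have hn0 : (0 : ℝ) < n := by exact_mod_cast h1
  have h2 : ENNReal.log (m n) ≤ ((n * c : ℝ) : EReal) := by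
    rw [← EReal.exp_le_exp_iff, ENNReal.exp_log]
    exact hn
  calc _ ≤ (((n : ℝ)⁻¹ : ℝ) : EReal) * ((n * c : ℝ) : EReal) :=
        mul_le_mul_of_nonneg_left h2 (EReal.coe_nonneg.2 (by positivity))
    _ = (c : EReal) := by rw [← EReal.coe_mul, inv_mul_cancel_left₀ hn0.ne']

lemma eventually_add_le_mul (B : ℝ) {c' : ℝ} (h : c' < c) :
    ∀ᶠ n : ℕ in atTop, B + n * c' ≤ n * c := by
  filter_upwards [tendsto_natCast_atTop_atTop.eventually_ge_atTop (B / (c - c'))] with n hn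
  rw [div_le_iff₀ (by linarith)] at hn
  linarith

end Rate

section AbstractLDP

variable {Y : Type*} [TopologicalSpace Y] [MeasurableSpace Y] {ξ : ℕ → Measure Y} {F : Y → EReal}

lemma rateOf_lt_iff {x : Y} {c : EReal} :
    c < rateOf F x ↔ ∃ G, IsOpen G ∧ x ∈ G ∧ ⨆ ν ∈ G, F ν < -c := by
  rw [rateOf, EReal.lt_neg_comm]
  simp only [iInf_lt_iff, exists_prop, and_assoc]

lemma exists_lt_of_rateOf_lt {x : Y} {c : EReal} (h : rateOf F x < c) {G : Set Y} (hG : IsOpen G)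
    (hx : x ∈ G) : ∃ ν ∈ G, -c < F ν := by
  rw [rateOf, EReal.neg_lt_comm] at h
  have := h.trans_le (iInf₂_le G ⟨hG, hx⟩)
  simpa only [lt_iSup_iff, exists_prop] using this

lemma lowerSemicontinuous_rateOf : LowerSemicontinuous (rateOf F) := by
  intro x c hc
  obtain ⟨G, hG, hx, h⟩ := rateOf_lt_iff.1 hc
  filter_upwards [hG.mem_nhds hx] with y hy
  exact rateOf_lt_iff.2 ⟨G, hG, hy, h⟩

lemma rateOf_nonneg (hF : ∀ ν, F ν ≤ 0) (x : Y) : 0 ≤ rateOf F x := by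
  by_contra! h
  obtain ⟨ν, -, hν⟩ := exists_lt_of_rateOf_lt h isOpen_univ (mem_univ x)
  rw [neg_zero] at hν
  exact absurd hν (hF ν).not_gt

/-- The lower bounds over open sets imply that the entropy-like functional is nonpositive. -/
lemma nonpos_of_lower (hle : ∀ n, ξ n univ ≤ 1)
    (hlow : ∀ G, IsOpen G → ∀ ν ∈ G, ∀ c : ℝ, (c : EReal) < F ν →
      ∀ᶠ n : ℕ in atTop, ENNReal.ofReal (Real.exp (n * c)) ≤ ξ n G) (ν : Y) : F ν ≤ 0 := by
  by_contra! h
  obtain ⟨c, h0, hc⟩ := EReal.lt_iff_exists_real_btwn.1 h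
  obtain ⟨n, h1, h2⟩ := ((hlow univ isOpen_univ ν (mem_univ ν) c hc).and
    (eventually_ge_atTop 1)).exists
  have h3 := h1.trans (hle n)
  rw [← ENNReal.ofReal_one, ENNReal.ofReal_le_ofReal_iff zero_le_one, Real.exp_le_one_iff] at h3
  have h4 : (0 : ℝ) < c := by exact_mod_cast h0
  have h5 : (1 : ℝ) ≤ n := by exact_mod_cast h2
  nlinarith

lemma hasLDP_lower
    (hlow : ∀ G, IsOpen G → ∀ ν ∈ G, ∀ c : ℝ, (c : EReal) < F ν →
      ∀ᶠ n : ℕ in atTop, ENNReal.ofReal (Real.exp (n * c)) ≤ ξ n G) {G : Set Y} (hG : IsOpen G) :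
    -(⨅ y ∈ G, rateOf F y) ≤
      atTop.liminf fun n : ℕ => (((n : ℝ)⁻¹ : ℝ) : EReal) * ENNReal.log (ξ n G) := by
  refine EReal.ge_of_forall_gt_iff_ge.1 fun c hc => ?_
  rw [EReal.lt_neg_comm] at hc
  simp only [iInf_lt_iff, exists_prop] at hc
  obtain ⟨y, hy, h⟩ := hc
  obtain ⟨ν, hν, h⟩ := exists_lt_of_rateOf_lt h hG hy
  rw [neg_neg] at h
  exact le_liminf_rate (hlow G hG ν hν c h)

lemma hasLDP_upper
    (hup : ∀ x G, IsOpen G → x ∈ G → ∃ V, IsOpen V ∧ x ∈ V ∧ ∀ c : ℝ, ⨆ ν ∈ G, F ν < c →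
      ∀ᶠ n : ℕ in atTop, ξ n V ≤ ENNReal.ofReal (Real.exp (n * c)))
    (htight : ∀ c : ℝ, ∃ K : Set Y, IsCompact K ∧
      ∀ᶠ n : ℕ in atTop, ξ n Kᶜ ≤ ENNReal.ofReal (Real.exp (n * c))) {K : Set Y} (hK : IsClosed K) :
    (atTop.limsup fun n : ℕ => (((n : ℝ)⁻¹ : ℝ) : EReal) * ENNReal.log (ξ n K)) ≤
      -(⨅ y ∈ K, rateOf F y) := by
  refine EReal.le_of_forall_lt_iff_le.1 fun c hc => ?_
  obtain ⟨c', hc', hcc⟩ := EReal.lt_iff_exists_real_btwn.1 hc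
  rw [EReal.coe_lt_coe_iff] at hcc
  rw [EReal.neg_lt_comm] at hc'
  have hloc (y : Y) (hy : y ∈ K) : ∃ V, V ∈ 𝓝 y ∧
      ∀ᶠ n : ℕ in atTop, ξ n V ≤ ENNReal.ofReal (Real.exp (n * c')) := by
    obtain ⟨G, hG, hyG, h⟩ := rateOf_lt_iff.1 (hc'.trans_le (iInf₂_le y hy))
    rw [neg_neg] at h
    obtain ⟨V, hV, hyV, hV'⟩ := hup y G hG hyG
    exact ⟨V, hV.mem_nhds hyV, hV' c' h⟩
  choose! V hV hVle using hloc
  obtain ⟨C, hC, hCle⟩ := htight c'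
  obtain ⟨t, htK, hcov⟩ := (hC.inter_left hK).elim_nhds_subcover V fun x hx => hV x hx.1
  refine limsup_rate_le ?_
  filter_upwards [hCle, (Finset.eventually_all t).2 fun y hy => hVle y (htK y hy).1,
    eventually_add_le_mul (Real.log (t.card + 1 : ℝ)) hcc] with n h1 h2 h3
  have hsub : K ⊆ (⋃ y ∈ t, V y) ∪ Cᶜ := fun y hy => by
    by_cases hyC : y ∈ C
    · exact Or.inl (hcov ⟨hy, hyC⟩)
    · exact Or.inr hyC
  calc ξ n K ≤ ξ n (⋃ y ∈ t, V y) + ξ n Cᶜ := (measure_mono hsub).trans (measure_union_le _ _)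
    _ ≤ (∑ y ∈ t, ENNReal.ofReal (Real.exp (n * c'))) + ENNReal.ofReal (Real.exp (n * c')) :=
        add_le_add ((measure_biUnion_finset_le _ _).trans (Finset.sum_le_sum h2)) h1
    _ = ENNReal.ofReal ((t.card + 1) * Real.exp (n * c')) := by
        rw [Finset.sum_const, nsmul_eq_mul, ENNReal.ofReal_mul (by positivity),
          ENNReal.ofReal_add (by positivity) zero_le_one, ENNReal.ofReal_natCast, ENNReal.ofReal_one]
        ring
    _ ≤ _ := by
        refine ENNReal.ofReal_le_ofReal ?_
        rw [← Real.exp_log (show (0 : ℝ) < t.card + 1 by positivity), ← Real.exp_add, Real.exp_le_exp]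
        exact h3

lemma goodRate_rateOf [T2Space Y]
    (hlow : ∀ G, IsOpen G → ∀ ν ∈ G, ∀ c : ℝ, (c : EReal) < F ν →
      ∀ᶠ n : ℕ in atTop, ENNReal.ofReal (Real.exp (n * c)) ≤ ξ n G)
    (htight : ∀ c : ℝ, ∃ K : Set Y, IsCompact K ∧
      ∀ᶠ n : ℕ in atTop, ξ n Kᶜ ≤ ENNReal.ofReal (Real.exp (n * c))) :
    GoodRate (rateOf F) := by
  refine ⟨lowerSemicontinuous_rateOf, fun α _ => ?_⟩
  obtain ⟨K, hK, h⟩ := htight (-(α + 2))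
  refine hK.of_isClosed_subset (lowerSemicontinuous_rateOf.isClosed_preimage (α : EReal)) ?_
  intro y hy
  by_contra hyK
  have h1 : rateOf F y < ((α + 1 : ℝ) : EReal) :=
    lt_of_le_of_lt hy (EReal.coe_lt_coe_iff.2 (by linarith))
  obtain ⟨ν, hν, hlt⟩ := exists_lt_of_rateOf_lt h1 hK.isClosed.isOpen_compl hyK
  rw [← EReal.coe_neg] at hlt
  obtain ⟨n, ⟨h2, h3⟩, h4⟩ := (((hlow _ hK.isClosed.isOpen_compl ν hν _ hlt).and h).and
    (eventually_ge_atTop 1)).exists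
  have h5 := h2.trans h3
  rw [ENNReal.ofReal_le_ofReal_iff (by positivity), Real.exp_le_exp] at h5
  have h6 : (1 : ℝ) ≤ n := by exact_mod_cast h4
  nlinarith

lemma expTight_of_forall
    (htight : ∀ c : ℝ, ∃ K : Set Y, IsCompact K ∧
      ∀ᶠ n : ℕ in atTop, ξ n Kᶜ ≤ ENNReal.ofReal (Real.exp (n * c))) : ExpTight ξ := fun L _ => by
  obtain ⟨K, hK, h⟩ := htight (-L)
  exact ⟨K, hK, limsup_rate_le h⟩

end AbstractLDP

end CMS

namespace CMS

section Mix

variable {X : Type*} [MeasurableSpace X] {T : X → X} {φ : X → ℝ} {P : ℝ}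

lemma le_entropy_of_le_freeEnergy {ν : ProbabilityMeasure X} (hInt : IntegralGtBot φ (ν : Measure X) →
    Integrable φ (ν : Measure X)) {a : ℝ} (h : (a : EReal) ≤ freeEnergy T φ P ν) :
    Invariant T (ν : Measure X) ∧ Integrable φ (ν : Measure X) ∧
      ENNReal.ofReal (a + P - ∫ x, φ x ∂(ν : Measure X)) ≤ entropy T (ν : Measure X) := by
  by_cases hF : Invariant T (ν : Measure X) ∧ IntegralGtBot φ (ν : Measure X)
  · refine ⟨hF.1, hInt hF.2, ?_⟩
    rw [freeEnergy, if_pos hF, eintegral_eq (hInt hF.2)] at h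
    rcases eq_or_ne (entropy T (ν : Measure X)) ⊤ with he | he
    · rw [he]; exact le_top
    · lift entropy T (ν : Measure X) to ℝ≥0 using he with e
      rw [EReal.coe_nnreal_eq_coe_real, ← EReal.coe_add, ← EReal.coe_sub, EReal.coe_le_coe_iff] at h
      rw [← ENNReal.ofReal_coe_nnreal]
      exact ENNReal.ofReal_le_ofReal (by linarith)
  · rw [freeEnergy, if_neg hF, le_bot_iff] at h
    exact absurd h (EReal.coe_ne_bot a)

lemma coe_mix (t : ℝ) (h0 : 0 ≤ t) (h1 : t ≤ 1) (μ ν : ProbabilityMeasure X) :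
    (mix t h0 h1 μ ν : Measure X) =
      ENNReal.ofReal t • (μ : Measure X) + ENNReal.ofReal (1 - t) • (ν : Measure X) := rfl

lemma mix_real_apply (t : ℝ) (h0 : 0 ≤ t) (h1 : t ≤ 1) (μ ν : ProbabilityMeasure X) (s : Set X) :
    (mix t h0 h1 μ ν : Measure X).real s =
      t * (μ : Measure X).real s + (1 - t) * (ν : Measure X).real s := by
  have h2 : 0 ≤ 1 - t := by linarith
  rw [coe_mix, measureReal_add_apply (by simp [ENNReal.mul_eq_top]) (by simp [ENNReal.mul_eq_top]),
    measureReal_ennreal_smul_apply, measureReal_ennreal_smul_apply, ENNReal.toReal_ofReal h0,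
    ENNReal.toReal_ofReal h2]

/-- The free energy is concave. -/
lemma le_freeEnergy_mix (hT : Measurable T) {μ ν : ProbabilityMeasure X}
    (hμ : IntegralGtBot φ (μ : Measure X) → Integrable φ (μ : Measure X))
    (hν : IntegralGtBot φ (ν : Measure X) → Integrable φ (ν : Measure X)) {a b : ℝ}
    (ha : (a : EReal) ≤ freeEnergy T φ P μ) (hb : (b : EReal) ≤ freeEnergy T φ P ν)
    (t : ℝ) (h0 : 0 ≤ t) (h1 : t ≤ 1) :
    ((t * a + (1 - t) * b : ℝ) : EReal) ≤ freeEnergy T φ P (mix t h0 h1 μ ν) := by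
  obtain ⟨hi1, hint1, he1⟩ := le_entropy_of_le_freeEnergy hμ ha
  obtain ⟨hi2, hint2, he2⟩ := le_entropy_of_le_freeEnergy hν hb
  have h2 : 0 ≤ 1 - t := by linarith
  have hj1 : Integrable φ (ENNReal.ofReal t • (μ : Measure X)) := hint1.smul_measure ENNReal.ofReal_ne_top
  have hj2 : Integrable φ (ENNReal.ofReal (1 - t) • (ν : Measure X)) :=
    hint2.smul_measure ENNReal.ofReal_ne_top
  have hI : ∫ x, φ x ∂(mix t h0 h1 μ ν : Measure X) =
      t * ∫ x, φ x ∂(μ : Measure X) + (1 - t) * ∫ x, φ x ∂(ν : Measure X) := by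
    rw [coe_mix, integral_add_measure hj1 hj2, integral_smul_measure, integral_smul_measure,
      ENNReal.toReal_ofReal h0, ENNReal.toReal_ofReal h2, smul_eq_mul, smul_eq_mul]
  have hinv : Invariant T (mix t h0 h1 μ ν : Measure X) := by
    rw [Invariant, coe_mix, Measure.map_add _ _ hT, Measure.map_smul, Measure.map_smul, hi1, hi2]
  have hent : ENNReal.ofReal (t * (a + P - ∫ x, φ x ∂(μ : Measure X)) +
      (1 - t) * (b + P - ∫ x, φ x ∂(ν : Measure X))) ≤ entropy T (mix t h0 h1 μ ν : Measure X) := by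
    refine ENNReal.ofReal_add_le.trans (le_trans ?_ (entropy_mix_le hT t h0 h1 μ ν))
    rw [ENNReal.ofReal_mul h0, ENNReal.ofReal_mul h2]
    gcongr
  have := le_freeEnergy (P := P) hinv (hj1.add_measure hj2) hent hI.ge
  refine le_trans (EReal.coe_le_coe_iff.2 (le_of_eq ?_)) this
  ring

end Mix

section Main

variable {S : Type*} [Countable S] [TopologicalSpace S] [DiscreteTopology S] {A : S → S → Prop}
  {φ : Space A → ℝ} {P : ℝ}

instance : BorelSpace (ProbabilityMeasure (Space A)) := ⟨rfl⟩

lemma mix_mem_nbd {μ ν μ' ν' : ProbabilityMeasure (Space A)} {U : Finset (List S)} {ε : ℝ}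
    (hμ : μ' ∈ nbd μ U ε) (hν : ν' ∈ nbd ν U ε) (t : ℝ) (h0 : 0 ≤ t) (h1 : t ≤ 1) :
    mix t h0 h1 μ' ν' ∈ nbd (mix t h0 h1 μ ν) U ε := fun u hu => by
  have h2 := abs_lt.1 (hμ u hu)
  have h3 := abs_lt.1 (hν u hu)
  rw [mix_real_apply, mix_real_apply, abs_lt]
  rcases h0.eq_or_lt with rfl | h0
  · constructor <;> linarith
  · constructor <;> nlinarith

lemma convexRate_rateOf_freeEnergy (hF : ∀ ν, freeEnergy (shift A) φ P ν ≤ 0)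
    (hInt : ∀ ν : ProbabilityMeasure (Space A), IntegralGtBot φ (ν : Measure (Space A)) →
      Integrable φ (ν : Measure (Space A))) :
    ConvexRate (rateOf (freeEnergy (shift A) φ P)) := by
  intro μ ν t h0 h1
  have hpos := rateOf_nonneg hF
  rcases h0.eq_or_lt with rfl | h0'
  · have : mix 0 h0 h1 μ ν = ν := by
      apply Subtype.ext
      change (mix 0 h0 h1 μ ν : Measure (Space A)) = ν
      simp [coe_mix]
    simp [this]
  rcases h1.eq_or_lt with rfl | h1'
  · have : mix 1 h0 h1 μ ν = μ := by
      apply Subtype.ext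
      change (mix 1 h0 h1 μ ν : Measure (Space A)) = μ
      simp [coe_mix]
    simp [this]
  have h2 : 0 < 1 - t := by linarith
  have hbotμ : rateOf (freeEnergy (shift A) φ P) μ ≠ ⊥ := ((EReal.bot_lt_zero).trans_le (hpos μ)).ne'
  have hbotν : rateOf (freeEnergy (shift A) φ P) ν ≠ ⊥ := ((EReal.bot_lt_zero).trans_le (hpos ν)).ne'
  rcases eq_or_ne (rateOf (freeEnergy (shift A) φ P) μ) ⊤ with hμ | hμ
  · rw [hμ, EReal.coe_mul_top_of_pos h0', EReal.top_add_of_ne_bot]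
    · exact le_top
    · exact (EReal.bot_lt_zero.trans_le (mul_nonneg (EReal.coe_nonneg.2 h2.le) (hpos ν))).ne'
  rcases eq_or_ne (rateOf (freeEnergy (shift A) φ P) ν) ⊤ with hν | hν
  · rw [hν, EReal.coe_mul_top_of_pos h2, EReal.add_top_of_ne_bot]
    · exact le_top
    · exact (EReal.bot_lt_zero.trans_le (mul_nonneg (EReal.coe_nonneg.2 h0) (hpos μ))).ne'
  obtain ⟨a, ha⟩ : ∃ a : ℝ, (a : EReal) = rateOf (freeEnergy (shift A) φ P) μ :=
    ⟨_, EReal.coe_toReal hμ hbotμ⟩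
  obtain ⟨b, hb⟩ : ∃ b : ℝ, (b : EReal) = rateOf (freeEnergy (shift A) φ P) ν :=
    ⟨_, EReal.coe_toReal hν hbotν⟩
  rw [← ha, ← hb, ← EReal.coe_mul, ← EReal.coe_mul, ← EReal.coe_add]
  refine EReal.le_of_forall_lt_iff_le.1 fun c hc => ?_
  rw [EReal.coe_lt_coe_iff] at hc
  by_contra! hlt
  obtain ⟨G, hG, hm, hsup⟩ := rateOf_lt_iff.1 hlt
  obtain ⟨U, ε, hε, hUG⟩ := exists_nbd_subset hG hm
  set δ := c - (t * a + (1 - t) * b) with hδ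
  obtain ⟨μ', hμ', hFμ⟩ := exists_lt_of_rateOf_lt (c := ((a + δ : ℝ) : EReal))
    (by rw [← ha, EReal.coe_lt_coe_iff]; linarith) (isOpen_nbd μ U ε) (mem_nbd_self μ U hε)
  obtain ⟨ν', hν', hFν⟩ := exists_lt_of_rateOf_lt (c := ((b + δ : ℝ) : EReal))
    (by rw [← hb, EReal.coe_lt_coe_iff]; linarith) (isOpen_nbd ν U ε) (mem_nbd_self ν U hε)
  rw [← EReal.coe_neg] at hFμ hFν
  have h3 := le_freeEnergy_mix measurable_shift (hInt μ') (hInt ν') hFμ.le hFν.le t h0 h1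
  rw [show t * -(a + δ) + (1 - t) * -(b + δ) = -c by rw [hδ]; ring, EReal.coe_neg] at h3
  exact absurd (h3.trans (le_iSup₂ (f := fun ν _ => freeEnergy (shift A) φ P ν) _
    (hUG (mix_mem_nbd hμ' hν' t h0 h1)))) hsup.not_ge

variable {μ : Measure (Space A)}

lemma empDistr_apply (n : ℕ) {s : Set (ProbabilityMeasure (Space A))} (hs : MeasurableSet s) :
    empDistr (shift A) μ n s = μ {x | empirical (shift A) x n ∈ s} :=
  Measure.map_apply (continuous_empirical n).measurable hs

namespace IsGibbsWith

variable [IsProbabilityMeasure μ] {c₀ : ℝ}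

lemma eventually_le_empDistr (hG : IsGibbsWith A φ μ c₀ P) (hc : 1 ≤ c₀) (hφ : Measurable φ)
    (hA : NoZeroRowCol A) {Λ : Finset (List S)}
    (hΛ : ∀ v w : List S, Admissible A v → Admissible A w → ∃ l ∈ Λ, Admissible A (v ++ l ++ w))
    {G : Set (ProbabilityMeasure (Space A))} (hGo : IsOpen G) {ν : ProbabilityMeasure (Space A)}
    (hν : ν ∈ G) {c : ℝ} (hlt : (c : EReal) < freeEnergy (shift A) φ P ν) :
    ∀ᶠ n : ℕ in atTop, ENNReal.ofReal (Real.exp (n * c)) ≤ empDistr (shift A) μ n G := by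
  by_cases hF : Invariant (shift A) (ν : Measure (Space A)) ∧ IntegralGtBot φ (ν : Measure (Space A))
  swap
  · rw [freeEnergy, if_neg hF] at hlt
    exact absurd hlt not_lt_bot
  obtain ⟨U, ε, hε, hUG⟩ := exists_nbd_subset hGo hν
  obtain ⟨c', hcc, hc'⟩ := EReal.lt_iff_exists_real_btwn.1 hlt
  rw [EReal.coe_lt_coe_iff] at hcc
  obtain ⟨C, k₀, h⟩ := hG.exists_le_measure_nbd hc hφ hA hΛ hF.1 hF.2 U hε
  set e := (c + c') / 2 with he
  obtain ⟨k₁, hk₁⟩ := exists_nat_gt (2 * C / (c' - e))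
  rw [div_lt_iff₀ (by linarith)] at hk₁
  set k := max (max k₀ k₁) 1 with hk
  have hk1 : 1 ≤ k := le_max_right _ _
  have hk0 : (0 : ℝ) < k := by exact_mod_cast hk1
  obtain ⟨D, n₀, hD, hn⟩ := h k ((le_max_left _ _).trans (le_max_left _ _))
  have hD' : k * e ≤ D - C := by
    have h1 := hc'.le.trans hD
    rw [EReal.coe_le_coe_iff, ← div_eq_inv_mul, le_div_iff₀ hk0] at h1
    have h2 : (k₁ : ℝ) ≤ k := by exact_mod_cast (le_max_right _ _).trans (le_max_left _ _)
    nlinarith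
  filter_upwards [eventually_ge_atTop n₀, eventually_add_le_mul (k * |e| + Real.log 2)
    (show c < e by linarith)] with n h1 h2
  refine le_trans (ENNReal.ofReal_le_ofReal (Real.exp_le_exp.2 ?_)) ((hn n h1).trans ?_)
  · have h3 : (n : ℝ) ≤ ((n / k + 1 : ℕ) : ℝ) * k := by
      have := Nat.lt_div_mul_add (a := n) hk1
      exact_mod_cast (by linarith : n ≤ (n / k + 1) * k)
    have h4 : ((n / k + 1 : ℕ) : ℝ) * k ≤ n + k := by
      have := Nat.div_mul_le_self n k
      exact_mod_cast (by linarith : (n / k + 1) * k ≤ n + k)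
    have h5 : ((n / k + 1 : ℕ) : ℝ) * (k * e) ≤ ((n / k + 1 : ℕ) : ℝ) * (D - C) :=
      mul_le_mul_of_nonneg_left hD' (by positivity)
    have h6 : n * e - k * |e| ≤ ((n / k + 1 : ℕ) : ℝ) * k * e := by
      have h7 := neg_abs_le ((((n / k + 1 : ℕ) : ℝ) * k - n) * e)
      rw [abs_mul, abs_of_nonneg (by linarith)] at h7
      nlinarith [abs_nonneg e]
    linarith
  · rw [empDistr_apply n hGo.measurableSet]
    exact measure_mono fun x hx => hUG hx

lemma exists_empDistr_le (hG : IsGibbsWith A φ μ c₀ P) (hc : 1 ≤ c₀) (hφ : Measurable φ)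
    (hA : NoZeroRowCol A) {Λ : Finset (List S)}
    (hΛ : ∀ v w : List S, Admissible A v → Admissible A w → ∃ l ∈ Λ, Admissible A (v ++ l ++ w))
    {G : Set (ProbabilityMeasure (Space A))} (hGo : IsOpen G) {ν : ProbabilityMeasure (Space A)}
    (hν : ν ∈ G) :
    ∃ V, IsOpen V ∧ ν ∈ V ∧ ∀ c : ℝ, ⨆ ρ ∈ G, freeEnergy (shift A) φ P ρ < c →
      ∀ᶠ n : ℕ in atTop, empDistr (shift A) μ n V ≤ ENNReal.ofReal (Real.exp (n * c)) := by
  obtain ⟨U, ε, hε, hUG⟩ := exists_nbd_subset hGo hν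
  refine ⟨nbd ν U (ε / 2), isOpen_nbd _ _ _, mem_nbd_self _ _ (half_pos hε), fun c hlt => ?_⟩
  obtain ⟨c', hc', hcc⟩ := EReal.lt_iff_exists_real_btwn.1 hlt
  rw [EReal.coe_lt_coe_iff] at hcc
  obtain ⟨C, n₀, h⟩ := hG.exists_le_freeEnergy hc hφ hA hΛ ν U hε
  filter_upwards [eventually_ge_atTop n₀, eventually_ge_atTop 1, eventually_add_le_mul C hcc]
    with n h1 h2 h3
  have hn0 : (0 : ℝ) < n := by exact_mod_cast h2
  rw [empDistr_apply n (isOpen_nbd _ _ _).measurableSet, ← ofReal_measureReal (measure_ne_top μ _)]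
  refine ENNReal.ofReal_le_ofReal ?_
  rcases (measureReal_nonneg (μ := μ)
    (s := {x | empirical (shift A) x n ∈ nbd ν U (ε / 2)})).eq_or_lt with h0 | h0
  · rw [← h0]; positivity
  obtain ⟨ρ, hρ, hle⟩ := h n h1 h0
  have h4 := (hle.trans (le_iSup₂ (f := fun ρ _ => freeEnergy (shift A) φ P ρ) ρ (hUG hρ))).trans hc'.le
  rw [EReal.coe_le_coe_iff, ← div_eq_inv_mul, div_le_iff₀ hn0] at h4
  rw [← Real.log_le_iff_le_exp h0]
  linarith

lemma exists_isCompact_empDistr_le (hG : IsGibbsWith A φ μ c₀ P) (hc : 1 ≤ c₀) (c : ℝ) :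
    ∃ K : Set (ProbabilityMeasure (Space A)), IsCompact K ∧
      ∀ᶠ n : ℕ in atTop, empDistr (shift A) μ n Kᶜ ≤ ENNReal.ofReal (Real.exp (n * c)) := by
  obtain ⟨K, hK, h⟩ := hG.exists_isCompact hc (-(c - 1))
  refine ⟨K, hK, ?_⟩
  filter_upwards [eventually_ge_atTop 1, eventually_add_le_mul (Real.log (c₀ ^ 3))
    (show c - 1 < c by linarith)] with n h1 h2
  rw [empDistr_apply n hK.isClosed.isOpen_compl.measurableSet]
  refine (h n h1).trans (ENNReal.ofReal_le_ofReal ?_)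
  rw [← Real.exp_log (show 0 < c₀ ^ 3 by positivity), ← Real.exp_add, Real.exp_le_exp]
  linarith

end IsGibbsWith

end Main

end CMS

open CMS in
/-- **Theorem A.** For a finitely irreducible countable Markov shift with a Gibbs state `μφ`
for a measurable potential `φ`, the distributions `ξ_n` of the empirical measures are
exponentially tight and satisfy the LDP with the convex good rate function
`I(μ) = -inf_{G ∋ μ} sup_G F`. -/
theorem theoremA {S : Type*} [Countable S] [TopologicalSpace S] [DiscreteTopology S]
    (A : S → S → Prop) (hA : NoZeroRowCol A) (hirr : FinitelyIrreducible A)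
    (φ : Space A → ℝ) (hφ : Measurable φ)
    (μφ : ProbabilityMeasure (Space A)) (c₀ P : ℝ) (hc₀ : 1 ≤ c₀)
    (hGibbs : IsGibbsWith A φ (μφ : Measure (Space A)) c₀ P) :
    ExpTight (fun n => empDistr (shift A) (μφ : Measure (Space A)) n) ∧
    HasLDP (fun n => empDistr (shift A) (μφ : Measure (Space A)) n)
      (rateOf (freeEnergy (shift A) φ P)) ∧
    GoodRate (rateOf (freeEnergy (shift A) φ P)) ∧
    ConvexRate (rateOf (freeEnergy (shift A) φ P)) := by
  obtain ⟨Λ, hΛ⟩ := hirr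
  have hlow : ∀ G : Set (ProbabilityMeasure (Space A)), IsOpen G → ∀ ν ∈ G, ∀ c : ℝ,
      (c : EReal) < freeEnergy (shift A) φ P ν → ∀ᶠ n : ℕ in atTop,
        ENNReal.ofReal (Real.exp (n * c)) ≤ empDistr (shift A) (μφ : Measure (Space A)) n G :=
    fun G hG ν hν c hlt => hGibbs.eventually_le_empDistr hc₀ hφ hA hΛ hG hν hlt
  have htight := hGibbs.exists_isCompact_empDistr_le hc₀
  have hle (n : ℕ) : empDistr (shift A) (μφ : Measure (Space A)) n univ ≤ 1 := by
    rw [empDistr_apply n MeasurableSet.univ]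
    exact prob_le_one
  exact ⟨expTight_of_forall htight,
    ⟨fun G hG => hasLDP_lower hlow hG, fun K hK => hasLDP_upper
      (fun ν G hG hν => hGibbs.exists_empDistr_le hc₀ hφ hA hΛ hG hν) htight hK⟩,
    goodRate_rateOf hlow htight,
    convexRate_rateOf_freeEnergy (nonpos_of_lower hle hlow) fun ν =>
      integrable_of_integralGtBot hφ (hGibbs.potential_le hc₀)⟩
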